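/- arXiv:math/0412365 — 2 statements merged into one kernel-verified Lean document; each statement's English description precedes it below -/
import Mathlib

section
/- Let H be a simple group such that for each integer n ≥ 2 there is a subgroup L_n of H with H_1(L_n) = 0 and H_2(L_n) = 0 and such that L_n possesses an element of order exactly n. Suppose that G is a group containing H as a subgroup in such a way that the normal closure of H in G is G itself. Then every perfect central extension of G is strongly torsion generated. -/
open CategoryTheory AlgebraicTopology

/-- The chain complex (over `ℤ`) associated to the nerve of the one-object groupoid on a
group `G`, i.e. the simplicial chain complex of the classifying space `BG`; its homology in
positive degrees is the integral group homology of `G`. -/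
noncomputable def classifyingComplex (G : Type) [Group G] : ChainComplex (ModuleCat ℤ) ℕ :=
  (alternatingFaceMapComplex (ModuleCat ℤ)).obj
    (((SimplicialObject.whiskering (Type) (ModuleCat ℤ)).obj (ModuleCat.free ℤ)).obj
      (nerve (SingleObj G)))

/-- The integral group homology `H_n(G; ℤ)` of a group `G`. -/
noncomputable def grpHomology (G : Type) [Group G] (n : ℕ) : ModuleCat ℤ :=
  (classifyingComplex G).homology n

/-- A group `G` is strongly torsion generated if for every `n ≥ 2` there is an element of
order exactly `n` whose normal closure is all of `G`. -/
def StronglyTorsionGenerated (G : Type*) [Group G] : Prop :=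
  ∀ n : ℕ, 2 ≤ n → ∃ g : G, orderOf g = n ∧ Subgroup.normalClosure {g} = ⊤

open Simplicial

namespace PCE

/-- basis element of the classifying complex -/
noncomputable def bas (L : Type) [Group L] {n : ℕ} (s : (nerve (SingleObj L)) _⦋n⦌) :
    (classifyingComplex L).X n :=
  ModuleCat.freeMk (R := ℤ) s

lemma sum_apply_aux {M N : ModuleCat.{0} ℤ} {k : ℕ} (c : Fin k → ℤ) (f : Fin k → (M ⟶ N)) (x : M) :
    (∑ i, c i • f i).hom x = ∑ i, c i • (f i).hom x := by
  rw [ModuleCat.hom_sum, LinearMap.sum_apply]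
  rfl

lemma d_bas (L : Type) [Group L] {n : ℕ} (s : (nerve (SingleObj L)) _⦋n+1⦌) :
    (classifyingComplex L).d (n+1) n (bas L s) =
      ∑ i : Fin (n+2), (-1 : ℤ)^(i : ℕ) • bas L ((nerve (SingleObj L)).δ i s) := by
  have h : (classifyingComplex L).d (n+1) n = ∑ i : Fin (n + 2), (-1 : ℤ) ^ (i : ℕ) •
      (ModuleCat.free ℤ).map ((nerve (SingleObj L)).δ i) :=
    alternatingFaceMapComplex_obj_d _ n
  refine (congrArg (fun ψ => ModuleCat.Hom.hom ψ (bas L s)) h).trans ?_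
  refine (sum_apply_aux _ _ _).trans ?_
  refine Finset.sum_congr rfl fun i _ => ?_
  exact congrArg (fun t => (-1 : ℤ) ^ (i : ℕ) • t) (ModuleCat.free_map_apply _ _)

lemma exact_of (L : Type) [Group L] (n : ℕ) (h : Subsingleton (grpHomology L (n+1)))
    (x : (classifyingComplex L).X (n+1)) (hx : (classifyingComplex L).d (n+1) n x = 0) :
    ∃ y : (classifyingComplex L).X (n+2), (classifyingComplex L).d (n+2) (n+1) y = x := by
  have h1 : (classifyingComplex L).ExactAt (n+1) := by
    rw [HomologicalComplex.exactAt_iff_isZero_homology]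
    exact (ModuleCat.isZero_of_iff_subsingleton).2 h
  rw [HomologicalComplex.exactAt_iff' _ (n+2) (n+1) n (by simp) (by simp)] at h1
  exact (ShortComplex.moduleCat_exact_iff _).1 h1 x hx

/-- the edge from vertex `i` to vertex `j` -/
def edge {L : Type} [Group L] {n : ℕ} (s : ComposableArrows (SingleObj L) n) (i j : Fin (n+1))
    (h : i ≤ j) : L := s.map (homOfLE h)

lemma edge_mul {L : Type} [Group L] {n : ℕ} (s : ComposableArrows (SingleObj L) n)
    (i j k : Fin (n+1)) (h : i ≤ j) (h' : j ≤ k) :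
    edge s i k (h.trans h') = edge s j k h' * edge s i j h :=
  s.map_comp (homOfLE h) (homOfLE h')

lemma edge_δ {L : Type} [Group L] {n : ℕ} (s : ComposableArrows (SingleObj L) (n+1))
    (m : Fin (n+2)) (i j : Fin (n+1)) (h : i ≤ j) :
    edge ((nerve (SingleObj L)).δ m s) i j h =
      edge s (m.succAbove i) (m.succAbove j) (by simpa using h) := rfl

variable {L : Type} [Group L] {A : Type} [AddCommGroup A]

/-- linear extension of a function on 2-simplices -/
noncomputable def ev (f : L → L → A) : (classifyingComplex L).X 2 →ₗ[ℤ] A :=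
  Finsupp.lift A ℤ ((nerve (SingleObj L)) _⦋2⦌)
    (fun s => f (edge (n := 2) s 1 2 (by decide)) (edge (n := 2) s 0 1 (by decide)))

lemma ev_bas (f : L → L → A) (s : (nerve (SingleObj L)) _⦋2⦌) :
    ev f (bas L s) =
      f (edge (n := 2) s 1 2 (by decide)) (edge (n := 2) s 0 1 (by decide)) := by
  unfold ev bas ModuleCat.freeMk
  erw [Finsupp.lift_apply, Finsupp.sum_single_index] <;> simp

lemma ev_d (f : L → L → A)
    (hf : ∀ a b c, f b c + f a (b * c) = f a b + f (a * b) c)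
    (y : (classifyingComplex L).X 3) : ev f ((classifyingComplex L).d 3 2 y) = 0 := by
  have key : (ev f).comp ((classifyingComplex L).d 3 2).hom = 0 := by
    refine Finsupp.lhom_ext' (fun s ↦ LinearMap.ext_ring ?_)
    change ev f ((classifyingComplex L).d 3 2 (bas L s)) = 0
    rw [d_bas, map_sum]
    simp only [map_zsmul, ev_bas]
    refine (Fin.sum_univ_four _).trans ?_
    have h0 := hf (edge (n := 3) s 2 3 (by decide)) (edge (n := 3) s 1 2 (by decide))
      (edge (n := 3) s 0 1 (by decide))
    have m1 := edge_mul (n := 3) s 0 1 2 (by decide) (by decide)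
    have m2 := edge_mul (n := 3) s 1 2 3 (by decide) (by decide)
    rw [← m1, ← m2] at h0
    have e : ∀ (m : Fin 4) (i j : Fin 3) (h : i ≤ j),
      edge (n := 2) ((nerve (SingleObj L)).δ m s) i j h =
      edge (n := 3) s (m.succAbove i) (m.succAbove j) (by simpa using h) := fun _ _ _ _ => rfl
    simp only [e]
    change (-1 : ℤ)^0 • f (edge (n := 3) s 2 3 _) (edge (n := 3) s 1 2 _)
      + (-1 : ℤ)^1 • f (edge (n := 3) s 2 3 _) (edge (n := 3) s 0 2 _)
      + (-1 : ℤ)^2 • f (edge (n := 3) s 1 3 _) (edge (n := 3) s 0 1 _)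
      + (-1 : ℤ)^3 • f (edge (n := 3) s 1 2 _) (edge (n := 3) s 0 1 _) = 0
    norm_num
    rw [← sub_eq_zero] at h0
    rw [← neg_eq_zero, ← h0]
    abel
  exact LinearMap.congr_fun key y

lemma cobound (h1 : Subsingleton (grpHomology L 1)) (h2 : Subsingleton (grpHomology L 2))
    (f : L → L → A)
    (hf : ∀ a b c, f b c + f a (b * c) = f a b + f (a * b) c) :
    ∃ g : L → A, ∀ a b, f a b = g a + g b - g (a * b) := by
  let K : L → (nerve (SingleObj L)) _⦋1⦌ := fun l =>
    ComposableArrows.mk₁ (C := SingleObj L) (X₀ := SingleObj.star L) (X₁ := SingleObj.star L) l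
  have hK : ∀ l, ∃ y, (classifyingComplex L).d 2 1 y = bas L (K l) := by
    intro l
    apply exact_of L 0 h1
    rw [d_bas, Fin.sum_univ_two]
    have : (nerve (SingleObj L)).δ 0 (K l) = (nerve (SingleObj L)).δ 1 (K l) :=
      ComposableArrows.ext₀ (Subsingleton.elim (α := Unit) _ _)
    rw [this]
    simp
  choose p hp using hK
  refine ⟨fun l => ev f (p l), fun a b => ?_⟩
  let s : (nerve (SingleObj L)) _⦋2⦌ :=
    ComposableArrows.mk₂ (C := SingleObj L) (X₀ := SingleObj.star L) (X₁ := SingleObj.star L)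
      (X₂ := SingleObj.star L) b a
  have hs : ev f (bas L s) = f a b := ev_bas f s
  have e0 : (nerve (SingleObj L)).δ 0 s = K a := nerve.δ₀_mk₂_eq _ _
  have e1 : (nerve (SingleObj L)).δ 1 s = K (a * b) := nerve.δ₁_mk₂_eq _ _
  have e2 : (nerve (SingleObj L)).δ 2 s = K b := nerve.δ₂_mk₂_eq _ _
  have hd : (classifyingComplex L).d 2 1 (bas L s - (p a + p b - p (a * b))) = 0 := by
    rw [map_sub, map_sub, map_add, hp, hp, hp, d_bas, Fin.sum_univ_three, e0, e1, e2]
    norm_num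
    abel
  obtain ⟨y, hy⟩ := exact_of L 1 h2 _ hd
  have := ev_d f hf y
  erw [hy] at this
  rw [map_sub, map_sub, map_add, hs] at this
  exact sub_eq_zero.1 this

lemma splits (h1 : Subsingleton (grpHomology L 1)) (h2 : Subsingleton (grpHomology L 2))
    {E G : Type} [Group E] [Group G] (φ : E →* G) (hsurj : Function.Surjective φ)
    (hker : φ.ker ≤ Subgroup.center E) (ι : L →* G) :
    ∃ s : L →* E, ∀ l, φ (s l) = ι l := by
  choose σ hσ using fun l => hsurj (ι l)
  let _ : CommGroup φ.ker := { (inferInstance : Group φ.ker) with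
    mul_comm := fun a b => Subtype.ext ((Subgroup.mem_center_iff.1 (hker b.2)) a.1) }
  have cen : ∀ (z : φ.ker) (e : E), e * z = z * e := fun z e =>
    Subgroup.mem_center_iff.1 (hker z.2) e
  obtain ⟨c, hc⟩ : ∃ c : L → L → φ.ker, ∀ a b, σ a * σ b = c a b * σ (a * b) :=
    ⟨fun a b => ⟨σ a * σ b * (σ (a * b))⁻¹, by simp [MonoidHom.mem_ker, hσ]⟩,
      fun a b => by simp⟩
  have hcoc : ∀ a b d, c b d * c a (b * d) = c a b * c (a * b) d := by
    intro a b d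
    apply Subtype.ext
    apply mul_right_cancel (b := σ (a * b * d))
    change (c b d : E) * (c a (b * d) : E) * σ (a * b * d) =
      (c a b : E) * (c (a * b) d : E) * σ (a * b * d)
    calc (c b d : E) * (c a (b * d) : E) * σ (a * b * d)
        = (c b d : E) * (σ a * σ (b * d)) := by rw [hc a (b * d), mul_assoc, mul_assoc a b d]
      _ = σ a * (c b d * σ (b * d)) := by rw [← mul_assoc, ← cen, mul_assoc]
      _ = σ a * σ b * σ d := by rw [← hc, mul_assoc]
      _ = c a b * (σ (a * b) * σ d) := by rw [hc a b, mul_assoc]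
      _ = _ := by rw [hc (a * b) d, ← mul_assoc]
  obtain ⟨g, hg⟩ := cobound (A := Additive φ.ker) h1 h2
    (fun a b => Additive.ofMul (c a b)) hcoc
  let γ : L → φ.ker := fun l => (g l).toMul
  have hγ : ∀ a b, c a b * γ (a * b) = γ a * γ b := by
    intro a b
    have : c a b = γ a * γ b / γ (a * b) := hg a b
    rw [this, div_mul_cancel]
  refine ⟨MonoidHom.mk' (fun l => (γ l : E)⁻¹ * σ l) ?_, ?_⟩
  · intro a b
    have h := congrArg (Subtype.val) (hγ a b)
    push_cast at h
    have hab := hc a b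
    have e1 : σ (a * b) = (c a b : E)⁻¹ * (σ a * σ b) := by rw [hab]; group
    have cinv : ∀ (z : φ.ker) (e : E), e * (z : E)⁻¹ = (z : E)⁻¹ * e := fun z e => by
      simpa using cen z⁻¹ e
    calc (γ (a * b) : E)⁻¹ * σ (a * b)
        = ((c a b : E) * γ (a * b))⁻¹ * (σ a * σ b) := by rw [e1]; group
      _ = (γ b : E)⁻¹ * ((γ a : E)⁻¹ * σ a) * σ b := by rw [h]; group
      _ = ((γ a : E)⁻¹ * σ a) * (γ b : E)⁻¹ * σ b := by rw [cinv (γ b)]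
      _ = _ := by group
  · intro l
    have : φ (γ l) = 1 := (γ l).2
    simp [this, hσ]

end PCE

theorem perfect_central_extension_stronglyTorsionGenerated
    (G : Type) [Group G] (H : Subgroup G) [IsSimpleGroup H]
    (hL : ∀ n : ℕ, 2 ≤ n → ∃ L : Subgroup ↥H,
      Subsingleton (grpHomology ↥L 1) ∧ Subsingleton (grpHomology ↥L 2) ∧
      ∃ x : ↥L, orderOf x = n)
    (hH : Subgroup.normalClosure (H : Set G) = ⊤)
    (E : Type) [Group E] (φ : E →* G) (hsurj : Function.Surjective φ)
    (hker : φ.ker ≤ Subgroup.center E) (hperf : commutator E = ⊤) :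
    StronglyTorsionGenerated E := by
  intro n hn
  obtain ⟨L, h1, h2, x, hx⟩ := hL n hn
  obtain ⟨s, hs⟩ := PCE.splits h1 h2 φ hsurj hker (H.subtype.comp L.subtype)
  have inj : Function.Injective (H.subtype.comp L.subtype) :=
    H.subtype_injective.comp L.subtype_injective
  have sinj : Function.Injective s := fun a b hab => inj (by rw [← hs, ← hs, hab])
  refine ⟨s x, by rw [orderOf_injective s sinj, hx], ?_⟩
  set N := Subgroup.normalClosure {s x} with hN
  have hxN : s x ∈ N := Subgroup.subset_normalClosure rfl
  have hM : (N.map φ).Normal := Subgroup.Normal.map inferInstance φ hsurj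
  have hxM : ((x : H) : G) ∈ N.map φ := ⟨s x, hxN, hs x⟩
  have hHM : H ≤ N.map φ := by
    rcases (hM.subgroupOf H).eq_bot_or_eq_top with hb | ht
    · exfalso
      have : (x : H) ∈ (N.map φ).subgroupOf H := hxM
      rw [hb, Subgroup.mem_bot] at this
      have : x = 1 := Subtype.ext this
      rw [this, orderOf_one] at hx
      omega
    · exact Subgroup.subgroupOf_eq_top.1 ht
  have hMtop : N.map φ = ⊤ := top_le_iff.1 (hH ▸ Subgroup.normalClosure_le_normal hHM)
  rw [← top_le_iff, ← hperf, commutator_def, Subgroup.commutator_le]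
  have dec : ∀ e : E, ∃ m ∈ N, ∃ z ∈ Subgroup.center E, e = m * z := by
    intro e
    obtain ⟨m, hm, hme⟩ : φ e ∈ N.map φ := hMtop ▸ Subgroup.mem_top _
    exact ⟨m, hm, m⁻¹ * e, hker (by simp [MonoidHom.mem_ker, hme]), by simp⟩
  intro e₁ _ e₂ _
  obtain ⟨m, hm, z, hz, rfl⟩ := dec e₁
  rw [Subgroup.mem_center_iff] at hz
  have : m * z * e₂ * (m * z)⁻¹ * e₂⁻¹ = m * (e₂ * m⁻¹ * e₂⁻¹) := by
    rw [mul_assoc m z e₂, ← hz e₂, mul_inv_rev]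
    group
  change m * z * e₂ * (m * z)⁻¹ * e₂⁻¹ ∈ N
  rw [this]
  exact N.mul_mem hm (Subgroup.Normal.conj_mem inferInstance _ (N.inv_mem hm) _)
end

section
/- Let A and C be abelian groups. Then there exists a group S such that S is strongly torsion generated, the centre of S is isomorphic to A, H_1(S) = 0, H_2(S) = 0, H_3(S) is isomorphic to C, and moreover H_4(S) is isomorphic to A. -/
open CategoryTheory AlgebraicTopology

set_option linter.unusedSectionVars false

namespace RH

/-- actions on abelian groups -/
@[ext] structure Rp (G M : Type) [Group G] [AddCommGroup M] where
  act : G → M →+ M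
  act_one : ∀ m, act 1 m = m
  act_mul : ∀ g h m, act (g * h) m = act g (act h m)

instance (G M : Type) [Group G] [AddCommGroup M] : CoeFun (Rp G M) fun _ => G → M →+ M := ⟨Rp.act⟩

abbrev Ch (G M : Type) [AddCommGroup M] (n : ℕ) := (Fin n → G) →₀ M

section basic
variable {G G' G'' K M M' M'' N : Type} [Group G] [Group G'] [Group G''] [Group K]
  [AddCommGroup M] [AddCommGroup M'] [AddCommGroup M''] [AddCommGroup N]

theorem rp_mul (ρ : Rp G M) (g h : G) (m : M) : ρ (g * h) m = ρ g (ρ h m) := ρ.act_mul g h m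

theorem rp_one (ρ : Rp G M) (m : M) : ρ 1 m = m := ρ.act_one m

theorem rp_inv_self (ρ : Rp G M) (g : G) (m : M) : ρ g⁻¹ (ρ g m) = m := by
  rw [← rp_mul, inv_mul_cancel, rp_one]

theorem rp_self_inv (ρ : Rp G M) (g : G) (m : M) : ρ g (ρ g⁻¹ m) = m := by
  rw [← rp_mul, mul_inv_cancel, rp_one]

noncomputable def dd (ρ : Rp G M) (n : ℕ) : Ch G M (n+1) →+ Ch G M n :=
  Finsupp.liftAddHom fun g => (Finsupp.singleAddHom (fun i => g i.succ)).comp (ρ (g 0)⁻¹) +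
    ∑ j : Fin (n+1), ((Finsupp.singleAddHom (Fin.contractNth j (· * ·) g)).comp
      (zsmulAddGroupHom ((-1:ℤ)^((j:ℕ)+1))) : M →+ Ch G M n)

theorem dd_single (ρ : Rp G M) (n : ℕ) (g : Fin (n+1) → G) (m : M) :
    dd ρ n (Finsupp.single g m) = Finsupp.single (fun i => g i.succ) (ρ (g 0)⁻¹ m) +
      ∑ j : Fin (n+1), Finsupp.single (Fin.contractNth j (· * ·) g) (((-1:ℤ)^((j:ℕ)+1)) • m) := by
  simp [dd]

/-- the linear version of an action -/
def toRepn (ρ : Rp G M) : Representation ℤ G M :=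
  { toFun := fun g => (ρ g).toIntLinearMap
    map_one' := by ext m; exact rp_one ρ m
    map_mul' := fun g h => by ext m; exact rp_mul ρ g h m }

/-- restriction -/
def Rp.comp (ρ : Rp G M) (f : K →* G) : Rp K M where
  act g := ρ (f g)
  act_one m := by rw [map_one, rp_one]
  act_mul g h m := by rw [map_mul, rp_mul]

@[simp] theorem Rp.comp_act (ρ : Rp G M) (f : K →* G) (k : K) : ρ.comp f k = ρ (f k) := rfl

/-- trivial action -/
def triv (G M : Type) [Group G] [AddCommGroup M] : Rp G M where
  act _ := AddMonoidHom.id M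
  act_one _ := rfl
  act_mul _ _ _ := rfl

@[simp] theorem triv_act (g : G) (m : M) : triv G M g m = m := rfl

theorem dd_eq (ρ : Rp G M) (n : ℕ) (z : Ch G M (n+1)) :
    dd ρ n z = (groupHomology.inhomogeneousChains.d (Rep.of (toRepn ρ)) n).hom z := by
  induction z using Finsupp.induction_linear with
  | zero => simp
  | add x y hx hy => rw [map_add, hx, hy]; exact (map_add (groupHomology.inhomogeneousChains.d (Rep.of (toRepn ρ)) n).hom x y).symm
  | single g m =>
    rw [dd_single]
    refine Eq.trans ?_ (groupHomology.inhomogeneousChains.d_single (A := Rep.of (toRepn ρ)) n g m).symm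
    congr 1
    refine Finset.sum_congr rfl fun j _ => ?_
    exact (Finsupp.smul_single _ _ _).symm

theorem dd_dd (ρ : Rp G M) (n : ℕ) (z : Ch G M (n+2)) : dd ρ n (dd ρ (n+1) z) = 0 := by
  rw [dd_eq, dd_eq]
  have := groupHomology.inhomogeneousChains.d_comp_d (A:=Rep.of (toRepn ρ)) (n:=n)
  exact congrArg (fun f => f.hom z) this

/-- cycles -/
noncomputable def Zn (ρ : Rp G M) : (n : ℕ) → AddSubgroup (Ch G M n)
  | 0 => ⊤
  | n+1 => (dd ρ n).ker

/-- boundaries -/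
noncomputable def Bn (ρ : Rp G M) (n : ℕ) : AddSubgroup (Ch G M n) := (dd ρ n).range

theorem mem_Zn_succ {ρ : Rp G M} {n : ℕ} {z : Ch G M (n+1)} : z ∈ Zn ρ (n+1) ↔ dd ρ n z = 0 :=
  Iff.rfl

theorem mem_Zn_zero {ρ : Rp G M} {z : Ch G M 0} : z ∈ Zn ρ 0 := trivial

theorem mem_Bn {ρ : Rp G M} {n : ℕ} {z : Ch G M n} : z ∈ Bn ρ n ↔ ∃ w, dd ρ n w = z := Iff.rfl

theorem dd_mem (ρ : Rp G M) (n : ℕ) (w) : dd ρ n w ∈ Bn ρ n := ⟨w, rfl⟩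

theorem Bn_le (ρ : Rp G M) (n : ℕ) : Bn ρ n ≤ Zn ρ n := by
  rintro _ ⟨w, rfl⟩
  cases n with
  | zero => trivial
  | succ n => exact dd_dd ρ n w

/-- vanishing homology -/
def HZ (ρ : Rp G M) (n : ℕ) : Prop := ∀ z ∈ Zn ρ n, z ∈ Bn ρ n

/-- the homology group -/
abbrev Hom (ρ : Rp G M) (n : ℕ) := Zn ρ n ⧸ (Bn ρ n).addSubgroupOf (Zn ρ n)

/-- induced maps on chains -/
noncomputable def cm (f : G →* G') (φ : M →+ M') (n : ℕ) : Ch G M n →+ Ch G' M' n :=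
  Finsupp.liftAddHom fun g => (Finsupp.singleAddHom (fun i => f (g i))).comp φ

@[simp] theorem cm_single (f : G →* G') (φ : M →+ M') (n : ℕ) (g : Fin n → G) (m : M) :
    cm f φ n (Finsupp.single g m) = Finsupp.single (fun i => f (g i)) (φ m) := by
  simp [cm]

theorem ch_ext {n : ℕ} {f f' : Ch G M n →+ N}
    (h : ∀ g m, f (Finsupp.single g m) = f' (Finsupp.single g m)) : f = f' :=
  Finsupp.addHom_ext h

theorem cm_cm (f : G →* G') (φ : M →+ M') (f' : G' →* G'') (φ' : M' →+ M'') (n : ℕ) (z) :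
    cm f' φ' n (cm f φ n z) = cm (f'.comp f) (φ'.comp φ) n z := by
  rw [← AddMonoidHom.comp_apply]; congr 1
  exact ch_ext fun g m => by simp

theorem cm_id (n : ℕ) (z : Ch G M n) :
    cm (MonoidHom.id G) (AddMonoidHom.id M) n z = z := by
  conv_rhs => rw [← AddMonoidHom.id_apply _ z]
  congr 1
  exact ch_ext fun g m => by simp

/-- compatibility of a map with actions -/
def Eqv (ρ : Rp G M) (ρ' : Rp G' M') (f : G →* G') (φ : M →+ M') : Prop :=
  ∀ g m, φ (ρ g m) = ρ' (f g) (φ m)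

theorem cm_dd {ρ : Rp G M} {ρ' : Rp G' M'} {f : G →* G'} {φ : M →+ M'} (h : Eqv ρ ρ' f φ) (n : ℕ)
    (z) : cm f φ n (dd ρ n z) = dd ρ' n (cm f φ (n+1) z) := by
  rw [← AddMonoidHom.comp_apply, ← AddMonoidHom.comp_apply]; congr 1
  refine ch_ext fun g m => ?_
  simp only [AddMonoidHom.comp_apply, dd_single, cm_single, map_add, map_sum]
  congr 1
  · rw [h, map_inv]
  · refine Finset.sum_congr rfl fun j _ => ?_
    rw [map_zsmul]
    congr 1
    exact Fin.comp_contractNth _ _ (map_mul f) j g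

theorem cm_mem_Z {ρ : Rp G M} {ρ' : Rp G' M'} {f : G →* G'} {φ : M →+ M'} (h : Eqv ρ ρ' f φ)
    {n : ℕ} {z} (hz : z ∈ Zn ρ n) : cm f φ n z ∈ Zn ρ' n := by
  cases n with
  | zero => trivial
  | succ n =>
    rw [mem_Zn_succ] at *
    rw [← cm_dd h, hz, map_zero]

theorem cm_mem_B {ρ : Rp G M} {ρ' : Rp G' M'} {f : G →* G'} {φ : M →+ M'} (h : Eqv ρ ρ' f φ)
    {n : ℕ} {z} (hz : z ∈ Bn ρ n) : cm f φ n z ∈ Bn ρ' n := by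
  obtain ⟨w, rfl⟩ := hz
  exact ⟨_, (cm_dd h n w).symm⟩

theorem cm_inj {f : G →* G'} {φ : M →+ M'} (hf : Function.Injective f) (hφ : Function.Injective φ)
    (n : ℕ) : Function.Injective (cm f φ n) := by
  have h : ∀ z, cm f φ n z = Finsupp.mapRange φ (map_zero φ) (Finsupp.mapDomain (fun g i => f (g i)) z) := by
    intro z
    induction z using Finsupp.induction_linear with
    | zero => simp
    | add x y hx hy => rw [map_add, hx, hy, Finsupp.mapDomain_add, Finsupp.mapRange_add (map_add φ)]
    | single g m => simp
  intro x y hxy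
  rw [h, h] at hxy
  refine Finsupp.mapDomain_injective ?_ (Finsupp.mapRange_injective φ (map_zero φ) hφ hxy)
  intro g g' hg
  funext i
  exact hf (congrFun hg i)

theorem cm_surj {φ : M →+ M'} (hφ : Function.Surjective φ)
    (n : ℕ) : Function.Surjective (cm (MonoidHom.id G) φ n) := by
  intro z
  induction z using Finsupp.induction_linear with
  | zero => exact ⟨0, map_zero _⟩
  | add x y hx hy =>
    obtain ⟨x, rfl⟩ := hx; obtain ⟨y, rfl⟩ := hy
    exact ⟨x + y, map_add _ _ _⟩
  | single g m =>
    obtain ⟨m, rfl⟩ := hφ m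
    exact ⟨Finsupp.single g m, by simp⟩

theorem cm_apply_id (φ : M →+ M') (n : ℕ) (z : Ch G M n) (g) :
    cm (MonoidHom.id G) φ n z g = φ (z g) := by
  induction z using Finsupp.induction_linear with
  | zero => simp
  | add x y hx hy => simp [hx, hy]
  | single g' m =>
    classical
    simp only [cm_single, MonoidHom.id_apply, Finsupp.single_apply]
    split_ifs <;> simp

/-- lifting a chain along a group hom. -/
theorem cm_lift (f : G →* G') (n : ℕ) (z : Ch G' M n)
    (h : ∀ g ∈ z.support, ∀ i, g i ∈ Set.range f) :
    ∃ z', cm f (AddMonoidHom.id M) n z' = z := by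
  choose! s hs using h
  refine ⟨z.sum fun g m => Finsupp.single (fun i => s g i) m, ?_⟩
  conv_rhs => rw [← Finsupp.sum_single z]
  rw [Finsupp.sum, map_sum, Finsupp.sum]
  refine Finset.sum_congr rfl fun g hg => ?_
  rw [cm_single]
  congr 1
  funext i
  exact hs g hg i

/-- Short exact sequences -/
structure SES {K I M : Type} [AddCommGroup K] [AddCommGroup I] [AddCommGroup M]
    (ρK : Rp G K) (ρI : Rp G I) (ρM : Rp G M) (i : K →+ I) (p : I →+ M) : Prop where
  ci : Eqv ρK ρI (MonoidHom.id G) i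
  cp : Eqv ρI ρM (MonoidHom.id G) p
  inj : Function.Injective i
  surj : Function.Surjective p
  pi : ∀ k, p (i k) = 0
  ex : ∀ x, p x = 0 → ∃ k, i k = x

section ses
variable {K I M : Type} [AddCommGroup K] [AddCommGroup I] [AddCommGroup M]
    {ρK : Rp G K} {ρI : Rp G I} {ρM : Rp G M} {i : K →+ I} {p : I →+ M}

/-- connecting relation -/
def dRel (ρI : Rp G I) (i : K →+ I) (p : I →+ M) (n : ℕ) (z : Ch G M (n+1)) (x : Ch G K n) : Prop :=
  ∃ y : Ch G I (n+1), cm (MonoidHom.id G) p (n+1) y = z ∧ dd ρI n y = cm (MonoidHom.id G) i n x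

theorem SES.ch_pi (S : SES ρK ρI ρM i p) (n : ℕ) (x) :
    cm (MonoidHom.id G) p n (cm (MonoidHom.id G) i n x) = 0 := by
  ext g; simp [cm_apply_id, S.pi]

theorem SES.ch_ex (S : SES ρK ρI ρM i p) (n : ℕ) (y) (h : cm (MonoidHom.id G) p n y = 0) :
    ∃ x, cm (MonoidHom.id G) i n x = y := by
  have : ∀ g, ∃ k, i k = y g := fun g => S.ex _ (by rw [← cm_apply_id, h]; rfl)
  choose s hs using this
  refine ⟨Finsupp.onFinset y.support s ?_, ?_⟩
  · intro g hg
    rw [Finsupp.mem_support_iff]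
    intro h0
    apply hg
    apply S.inj
    rw [hs, h0, map_zero]
  · ext g
    rw [cm_apply_id]
    simp [hs]

theorem dRel.sub {n : ℕ} {z z' : Ch G M (n+1)} {x x' : Ch G K n} (h : dRel ρI i p n z x)
    (h' : dRel ρI i p n z' x') : dRel ρI i p n (z - z') (x - x') := by
  obtain ⟨y, rfl, h2⟩ := h
  obtain ⟨y', rfl, h2'⟩ := h'
  exact ⟨y - y', by simp, by simp [h2, h2']⟩

theorem dRel.add {n : ℕ} {z z' : Ch G M (n+1)} {x x' : Ch G K n} (h : dRel ρI i p n z x)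
    (h' : dRel ρI i p n z' x') : dRel ρI i p n (z + z') (x + x') := by
  obtain ⟨y, rfl, h2⟩ := h
  obtain ⟨y', rfl, h2'⟩ := h'
  exact ⟨y + y', by simp, by simp [h2, h2']⟩

theorem dRel.zero {n : ℕ} : dRel ρI i p n (0 : Ch G M (n+1)) (0 : Ch G K n) :=
  ⟨0, by simp, by simp⟩

theorem SES.rel_Z_right (S : SES ρK ρI ρM i p) {n : ℕ} {z x} (h : dRel ρI i p n z x) :
    x ∈ Zn ρK n := by
  cases n with
  | zero => trivial
  | succ n =>
    obtain ⟨y, -, h2⟩ := h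
    rw [mem_Zn_succ]
    apply cm_inj (f := MonoidHom.id G) Function.injective_id S.inj
    rw [cm_dd S.ci, ← h2, dd_dd, map_zero]

theorem SES.rel_Z_left (S : SES ρK ρI ρM i p) {n : ℕ} {z x} (h : dRel ρI i p n z x) :
    z ∈ Zn ρM (n+1) := by
  obtain ⟨y, rfl, h2⟩ := h
  rw [mem_Zn_succ, ← cm_dd S.cp, h2, S.ch_pi]

theorem SES.rel_ex (S : SES ρK ρI ρM i p) {n : ℕ} {z} (h : z ∈ Zn ρM (n+1)) :
    ∃ x ∈ Zn ρK n, dRel ρI i p n z x := by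
  obtain ⟨y, rfl⟩ := cm_surj S.surj (n+1) z
  obtain ⟨x, hx⟩ := S.ch_ex n (dd ρI n y) (by rw [cm_dd S.cp]; exact h)
  have : dRel ρI i p n (cm (MonoidHom.id G) p (n+1) y) x := ⟨y, rfl, hx.symm⟩
  exact ⟨x, S.rel_Z_right this, this⟩

/-- if `x` is a boundary then `z` comes from a cycle of the middle term -/
theorem SES.rel_lift (S : SES ρK ρI ρM i p) {n : ℕ} {z x} (h : dRel ρI i p n z x)
    (hx : x ∈ Bn ρK n) : ∃ y ∈ Zn ρI (n+1), cm (MonoidHom.id G) p (n+1) y = z := by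
  obtain ⟨y, rfl, h2⟩ := h
  obtain ⟨w, rfl⟩ := hx
  refine ⟨y - cm (MonoidHom.id G) i _ w, ?_, ?_⟩
  · rw [mem_Zn_succ, map_sub, ← cm_dd S.ci, h2, sub_self]
  · rw [map_sub, S.ch_pi, sub_zero]

theorem SES.rel_B_left (S : SES ρK ρI ρM i p) {n : ℕ} (hI : HZ ρI (n+1)) {z x}
    (h : dRel ρI i p n z x) (hx : x ∈ Bn ρK n) : z ∈ Bn ρM (n+1) := by
  obtain ⟨y, hy, rfl⟩ := S.rel_lift h hx
  exact cm_mem_B S.cp (hI y hy)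

theorem SES.rel_B_right (S : SES ρK ρI ρM i p) {n : ℕ} {z x}
    (h : dRel ρI i p n z x) (hz : z ∈ Bn ρM (n+1)) : x ∈ Bn ρK n := by
  obtain ⟨y, rfl, h2⟩ := h
  obtain ⟨w, hw⟩ := hz
  obtain ⟨v, rfl⟩ := cm_surj S.surj _ w
  obtain ⟨k, hk⟩ := S.ch_ex (n+1) (y - dd ρI (n+1) v) (by rw [map_sub, cm_dd S.cp, hw, sub_self])
  refine ⟨k, ?_⟩
  apply cm_inj (f := MonoidHom.id G) Function.injective_id S.inj
  rw [cm_dd S.ci, hk, map_sub, dd_dd, sub_zero, h2]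

theorem SES.rel_ex' (S : SES ρK ρI ρM i p) {n : ℕ} {x}
    (hx : cm (MonoidHom.id G) i n x ∈ Bn ρI n) : ∃ z ∈ Zn ρM (n+1), dRel ρI i p n z x := by
  obtain ⟨y, hy⟩ := hx
  have : dRel ρI i p n (cm (MonoidHom.id G) p (n+1) y) x := ⟨y, rfl, hy⟩
  exact ⟨_, S.rel_Z_left this, this⟩

theorem SES.rel_B_mid (_S : SES ρK ρI ρM i p) {n : ℕ} {z x} (h : dRel ρI i p n z x) :
    cm (MonoidHom.id G) i n x ∈ Bn ρI n := by
  obtain ⟨y, -, hy⟩ := h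
  exact ⟨y, hy⟩

/-- split criterion -/
theorem SES.ofSplit (ci : Eqv ρK ρI (MonoidHom.id G) i) (cp : Eqv ρI ρM (MonoidHom.id G) p)
    (s : I →+ K) (t : M →+ I) (hsi : ∀ k, s (i k) = k) (hpt : ∀ m, p (t m) = m)
    (hpi : ∀ k, p (i k) = 0) (his : ∀ x, i (s x) = x - t (p x)) : SES ρK ρI ρM i p where
  ci := ci
  cp := cp
  inj := Function.LeftInverse.injective hsi
  surj := Function.RightInverse.surjective hpt
  pi := hpi
  ex x hx := ⟨s x, by rw [his, hx, map_zero, sub_zero]⟩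

end ses

/-- naturality of the connecting relation -/
theorem dRel.map {K I M K' I' M' : Type} [AddCommGroup K] [AddCommGroup I] [AddCommGroup M]
    [AddCommGroup K'] [AddCommGroup I'] [AddCommGroup M']
    {ρI : Rp G I} {i : K →+ I} {p : I →+ M}
    {ρI' : Rp G' I'} {i' : K' →+ I'} {p' : I' →+ M'}
    {f : G →* G'} (a : K →+ K') (b : I →+ I') (c : M →+ M')
    (hb : Eqv ρI ρI' f b) (hi : ∀ k, b (i k) = i' (a k)) (hp : ∀ x, c (p x) = p' (b x))
    {n : ℕ} {z x} (h : dRel ρI i p n z x) : dRel ρI' i' p' n (cm f c _ z) (cm f a _ x) := by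
  obtain ⟨y, rfl, h2⟩ := h
  refine ⟨cm f b _ y, ?_, ?_⟩
  · rw [cm_cm, cm_cm]
    congr 2
    ext x; exact (hp x).symm
  · rw [← cm_dd hb, h2, cm_cm, cm_cm]
    congr 2
    ext x; exact hi x

end basic
end RH

namespace RH

section ind
variable {G G' K X M M' N : Type} [Group G] [Group G'] [Group K]
  [AddCommGroup M] [AddCommGroup M'] [AddCommGroup N]

noncomputable def indRep (a : G →* Equiv.Perm X) (ρ : Rp G M) : Rp G (X →₀ M) where
  act g := Finsupp.liftAddHom fun x => (Finsupp.singleAddHom (a g x)).comp (ρ g)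
  act_one m := by
    induction m using Finsupp.induction_linear with
    | zero => simp only [map_zero]
    | add x y hx hy => simp only [map_add, hx, hy]
    | single x m => simp [rp_one]
  act_mul g h m := by
    induction m using Finsupp.induction_linear with
    | zero => simp only [map_zero]
    | add x y hx hy => simp only [map_add, hx, hy]
    | single x m => simp [rp_mul]

@[simp] theorem indRep_single (a : G →* Equiv.Perm X) (ρ : Rp G M) (g : G) (x : X) (m : M) :
    indRep a ρ g (Finsupp.single x m) = Finsupp.single (a g x) (ρ g m) := by
  simp [indRep]

/-- sum of coefficients -/
noncomputable def sm (X M : Type) [AddCommGroup M] : (X →₀ M) →+ M :=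
  Finsupp.liftAddHom fun _ => AddMonoidHom.id M

@[simp] theorem sm_single (x : X) (m : M) : sm X M (Finsupp.single x m) = m := by
  simp [sm]

/-- left multiplication -/
def lmul (G : Type) [Group G] : G →* Equiv.Perm G := MulAction.toPermHom G G

@[simp] theorem lmul_apply (g x : G) : lmul G g x = g * x := rfl

theorem eqv_sm (a : G →* Equiv.Perm X) (ρ : Rp G M) :
    Eqv (indRep a ρ) ρ (MonoidHom.id G) (sm X M) := by
  intro g v
  change ((sm X M).comp (indRep a ρ g)) v = ((ρ g).comp (sm X M)) v
  congr 1
  refine Finsupp.addHom_ext fun x m => ?_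
  simp

/-- contracting homotopy -/
noncomputable def hot (σ : Rp G N) (n : ℕ) : Ch G (G →₀ N) n →+ Ch G (G →₀ N) (n+1) :=
  Finsupp.liftAddHom fun g => Finsupp.liftAddHom fun x =>
    (Finsupp.singleAddHom (Fin.cons x⁻¹ g)).comp ((Finsupp.singleAddHom 1).comp (σ x⁻¹))

@[simp] theorem hot_single (σ : Rp G N) (n : ℕ) (g : Fin n → G) (x : G) (m : N) :
    hot σ n (Finsupp.single g (Finsupp.single x m)) =
      Finsupp.single (Fin.cons x⁻¹ g) (Finsupp.single 1 (σ x⁻¹ m)) := by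
  unfold hot; rw [Finsupp.liftAddHom_apply_single, Finsupp.liftAddHom_apply_single]; rfl

theorem contract_cons_zero (n : ℕ) (h : G) (g : Fin (n+1) → G) :
    Fin.contractNth 0 (· * ·) (Fin.cons h g : Fin (n+2) → G) =
      Fin.cons (h * g 0) (fun i => g i.succ) := by
  funext k
  refine Fin.cases ?_ (fun k => ?_) k
  · simp [Fin.contractNth]
  · simp [Fin.contractNth]

theorem contract_cons_succ (n : ℕ) (h : G) (g : Fin (n+1) → G) (j : Fin (n+1)) :
    Fin.contractNth j.succ (· * ·) (Fin.cons h g : Fin (n+2) → G) =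
      Fin.cons h (Fin.contractNth j (· * ·) g) := by
  funext k
  refine Fin.cases ?_ (fun k => ?_) k
  · simp [Fin.contractNth]
  · simp [Fin.contractNth]

theorem hot_dd (σ : Rp G N) (n : ℕ) (z : Ch G (G →₀ N) (n+1)) :
    dd (indRep (lmul G) σ) (n+1) (hot σ (n+1) z) + hot σ n (dd (indRep (lmul G) σ) n z) = z := by
  have : (dd (indRep (lmul G) σ) (n+1)).comp (hot σ (n+1)) +
      (hot σ n).comp (dd (indRep (lmul G) σ) n) = AddMonoidHom.id _ := by
    refine ch_ext fun g v => ?_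
    induction v using Finsupp.induction_linear with
    | zero => simp only [Finsupp.single_zero, map_zero]
    | add x y hx hy => simp only [Finsupp.single_add, map_add, hx, hy]
    | single x m =>
      simp only [AddMonoidHom.add_apply, AddMonoidHom.comp_apply, hot_single, dd_single,
        AddMonoidHom.id_apply, map_add, map_sum, indRep_single]
      rw [Fin.sum_univ_succ]
      simp only [Fin.cons_succ, Fin.cons_zero, contract_cons_zero, contract_cons_succ,
        Finsupp.smul_single, hot_single, map_zsmul, lmul_apply, inv_inv, mul_one, rp_self_inv]
      rw [mul_inv_rev, inv_inv, ← rp_mul]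
      simp only [mul_assoc, mul_inv_cancel, mul_one]
      have : ∀ j : Fin (n+1), ((-1:ℤ)^((j.succ:ℕ)+1)) • σ x⁻¹ m = - (((-1:ℤ)^((j:ℕ)+1)) • σ x⁻¹ m) := by
        intro j
        rw [Fin.val_succ, pow_succ _ ((j:ℕ)+1), mul_neg_one, neg_smul]
      simp only [this, Finsupp.single_neg, Finset.sum_neg_distrib]
      simp only [Fin.coe_ofNat_eq_mod, Nat.zero_mod, zero_add, pow_one, neg_smul, one_smul, Finsupp.single_neg]
      abel
  exact congrArg (fun f => f z) this

theorem HZ_ind (σ : Rp G N) (n : ℕ) : HZ (indRep (lmul G) σ) (n+1) := by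
  intro z hz
  refine ⟨hot σ (n+1) z, ?_⟩
  have := hot_dd σ n z
  rwa [mem_Zn_succ.1 hz, map_zero, add_zero] at this

/-- relatively projective -/
def RPj (σ : Rp G N) : Prop := ∃ q : N →+ (G →₀ N),
  Eqv σ (indRep (lmul G) σ) (MonoidHom.id G) q ∧ ∀ x, sm G N (q x) = x

/-- transfer along retracts -/
theorem HZ.retract {σ : Rp G N} {ρ : Rp G M} {n : ℕ} (h : HZ ρ n) (q : N →+ M) (r : M →+ N)
    (hq : Eqv σ ρ (MonoidHom.id G) q) (hr : Eqv ρ σ (MonoidHom.id G) r) (hrq : ∀ x, r (q x) = x) :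
    HZ σ n := by
  intro z hz
  have := cm_mem_B hr (h _ (cm_mem_Z hq hz))
  rw [cm_cm] at this
  convert this
  rw [show r.comp q = AddMonoidHom.id N by ext x; exact hrq x]
  exact (cm_id n z).symm

theorem RPj.HZ {σ : Rp G N} (h : RPj σ) (n : ℕ) : HZ σ (n+1) := by
  obtain ⟨q, h1, h2⟩ := h
  exact (HZ_ind σ n).retract q (sm G N) h1 (eqv_sm _ _) h2

/-- relative projectivity for free actions -/
theorem RPj_free (a : G →* Equiv.Perm X) (ρ : Rp G M) (c : X → G)
    (hc : ∀ g x, c (a g x) = g * c x) : RPj (indRep a ρ) := by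
  refine ⟨Finsupp.liftAddHom fun x =>
    (Finsupp.singleAddHom (c x)).comp (Finsupp.singleAddHom x), ?_, ?_⟩
  · intro g v
    induction v using Finsupp.induction_linear with
    | zero => simp only [map_zero]
    | add x y hx hy => simp only [map_add, hx, hy]
    | single x m => simp [hc]
  · intro v
    induction v using Finsupp.induction_linear with
    | zero => simp only [map_zero]
    | add x y hx hy => simp only [map_add, hx, hy]
    | single x m => simp

theorem RPj_ind (ρ : Rp G M) : RPj (indRep (lmul G) ρ) := RPj_free _ _ id fun _ _ => rfl

/-- relative projectivity passes to `X →₀ I`. -/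
theorem RPj.ind {ρ : Rp G M} (h : RPj ρ) (a : G →* Equiv.Perm X) : RPj (indRep a ρ) := by
  obtain ⟨q, h1, h2⟩ := h
  let θ : X → (G →₀ M) →+ (G →₀ (X →₀ M)) := fun x => Finsupp.liftAddHom fun g =>
    (Finsupp.singleAddHom g).comp (Finsupp.singleAddHom x)
  have hθ : ∀ x g m, θ x (Finsupp.single g m) = Finsupp.single g (Finsupp.single x m) := by
    intro x g m; simp [θ]
  refine ⟨Finsupp.liftAddHom fun x => (θ x).comp q, ?_, ?_⟩
  · intro g v
    induction v using Finsupp.induction_linear with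
    | zero => simp only [map_zero]
    | add x y hx hy => simp only [map_add, hx, hy]
    | single x m =>
      simp only [indRep_single, Finsupp.liftAddHom_apply_single, AddMonoidHom.comp_apply, h1 g m,
        MonoidHom.id_apply]
      generalize q m = w
      induction w using Finsupp.induction_linear with
      | zero => simp only [map_zero]
      | add x y hx hy => simp only [map_add, hx, hy]
      | single y m => simp [hθ]
  · intro v
    induction v using Finsupp.induction_linear with
    | zero => simp only [map_zero]
    | add x y hx hy => simp only [map_add, hx, hy]
    | single x m =>
      simp only [Finsupp.liftAddHom_apply_single, AddMonoidHom.comp_apply]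
      conv_rhs => rw [← h2 m]
      generalize q m = w
      induction w using Finsupp.induction_linear with
      | zero => simp only [map_zero, Finsupp.single_zero]
      | add x y hx hy => simp only [map_add, hx, hy, Finsupp.single_add]
      | single y m => simp [hθ]

/-- action on a kernel -/
def kerRep {I : Type} [AddCommGroup I] {ρI : Rp G I} {ρ : Rp G M} {p : I →+ M}
    (hp : Eqv ρI ρ (MonoidHom.id G) p) : Rp G p.ker where
  act g := ((ρI g).comp p.ker.subtype).codRestrict p.ker fun x => by
    change p (ρI g x.1) = 0
    rw [hp, x.2, map_zero]
  act_one x := Subtype.ext (rp_one ρI x.1)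
  act_mul g h x := Subtype.ext (rp_mul ρI g h x.1)

theorem SES_ker {I : Type} [AddCommGroup I] {ρI : Rp G I} {ρ : Rp G M} {p : I →+ M}
    (hp : Eqv ρI ρ (MonoidHom.id G) p) (hs : Function.Surjective p) :
    SES (kerRep hp) ρI ρ p.ker.subtype p where
  ci _ _ := rfl
  cp := hp
  inj := Subtype.val_injective
  surj := hs
  pi k := k.2
  ex x hx := ⟨⟨x, hx⟩, rfl⟩

theorem sm_surj [Nonempty X] : Function.Surjective (sm X M) := fun m =>
  ⟨Finsupp.single (Classical.arbitrary X) m, by simp⟩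

/-- canonical dimension shifting sequence -/
theorem SES_can (ρ : Rp G M) : SES (kerRep (eqv_sm (lmul G) ρ)) (indRep (lmul G) ρ) ρ
    (sm G M).ker.subtype (sm G M) := SES_ker _ sm_surj

theorem dd_zero_single (ρ : Rp G M) (g : Fin 1 → G) (m : M) (e e' : Fin 0 → G) :
    dd ρ 0 (Finsupp.single g m) = Finsupp.single e (ρ (g 0)⁻¹ m) - Finsupp.single e' m := by
  rw [dd_single]
  rw [Fin.sum_univ_succ, Fin.sum_univ_zero, add_zero]
  rw [sub_eq_add_neg, ← Finsupp.single_neg]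
  congr 1
  · congr 1; exact Subsingleton.elim _ _
  · congr 1
    · exact Subsingleton.elim _ _
    · simp

/-- conjugation acts trivially -/
theorem conj_inv (u : G) (n : ℕ) : ∀ {M : Type} [AddCommGroup M] (ρ : Rp G M), ∀ z ∈ Zn ρ n,
    cm (MulAut.conj u).toMonoidHom (ρ u) n z - z ∈ Bn ρ n := by
  induction n with
  | zero =>
    intro M _ ρ z _
    induction z using Finsupp.induction_linear with
    | zero => simp
    | add x y hx hy =>
      rw [map_add, add_sub_add_comm]
      exact add_mem (hx trivial) (hy trivial)
    | single g m =>
      rw [cm_single]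
      refine ⟨Finsupp.single (fun _ => u⁻¹) m, ?_⟩
      rw [dd_zero_single _ _ _ (fun i => (MulAut.conj u).toMonoidHom (g i)) g, inv_inv]
  | succ n ih =>
    intro M _ ρ z hz
    have S := SES_can ρ
    obtain ⟨x, hx, hr⟩ := S.rel_ex hz
    have h2 := hr.map (f := (MulAut.conj u).toMonoidHom) (ρI' := indRep (lmul G) ρ)
      (i' := (sm G M).ker.subtype) (p' := sm G M)
      (kerRep (eqv_sm (lmul G) ρ) u) (indRep (lmul G) ρ u) (ρ u) (by
        intro g m
        rw [← rp_mul, ← rp_mul]; simp) (fun k => rfl) (fun k => (eqv_sm _ _ _ _).symm)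
    exact S.rel_B_left (HZ_ind _ _) (h2.sub hr) (ih _ x hx)

end ind
end RH

namespace RH

section shapiro
variable {G G' K X M M' N : Type} [Group G] [Group G'] [Group K]
  [AddCommGroup M] [AddCommGroup M'] [AddCommGroup N]

theorem exists_c (j : K →* G) (hj : Function.Injective j) :
    ∃ c : G → K, ∀ k g, c (j k * g) = k * c g := by
  let q : G → Quotient (QuotientGroup.rightRel j.range) := Quotient.mk _
  have h : ∀ g, ∃ k, j k = g * (q g).out⁻¹ := by
    intro g
    have := Quotient.exact (Quotient.out_eq (q g))
    have := (QuotientGroup.rightRel_apply).1 this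
    exact this
  choose c hc using h
  refine ⟨c, fun k g => hj ?_⟩
  have : q (j k * g) = q g := by
    apply Quotient.sound
    apply (QuotientGroup.rightRel_apply).2
    refine ⟨k⁻¹, by simp⟩
  rw [hc, this, map_mul, hc, mul_assoc]

theorem RPj_res (ρ : Rp G M) (j : K →* G) (hj : Function.Injective j) :
    RPj ((indRep (lmul G) ρ).comp j) := by
  obtain ⟨c, hc⟩ := exists_c j hj
  exact RPj_free ((lmul G).comp j) (ρ.comp j) c hc

theorem SES.comp {K' I M : Type} [AddCommGroup K'] [AddCommGroup I] [AddCommGroup M]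
    {ρK : Rp G K'} {ρI : Rp G I} {ρM : Rp G M} {i : K' →+ I} {p : I →+ M}
    (S : SES ρK ρI ρM i p) (j : K →* G) : SES (ρK.comp j) (ρI.comp j) (ρM.comp j) i p where
  ci k m := S.ci (j k) m
  cp k m := S.cp (j k) m
  inj := S.inj
  surj := S.surj
  pi := S.pi
  ex := S.ex

theorem eqv_mapRange {ρ : Rp G M} {ρ' : Rp G M'} (a : G →* Equiv.Perm X) {φ : M →+ M'}
    (h : Eqv ρ ρ' (MonoidHom.id G) φ) :
    Eqv (indRep a ρ) (indRep a ρ') (MonoidHom.id G) (Finsupp.mapRange.addMonoidHom φ) := by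
  intro g v
  induction v using Finsupp.induction_linear with
  | zero => simp only [map_zero]
  | add x y hx hy => simp only [map_add, hx, hy]
  | single x m => simp [h g m]

theorem SES.ind {K' I M : Type} [AddCommGroup K'] [AddCommGroup I] [AddCommGroup M]
    {ρK : Rp G K'} {ρI : Rp G I} {ρM : Rp G M} {i : K' →+ I} {p : I →+ M}
    (S : SES ρK ρI ρM i p) (a : G →* Equiv.Perm X) :
    SES (indRep a ρK) (indRep a ρI) (indRep a ρM) (Finsupp.mapRange.addMonoidHom i)
      (Finsupp.mapRange.addMonoidHom p) where
  ci := eqv_mapRange a S.ci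
  cp := eqv_mapRange a S.cp
  inj := Finsupp.mapRange_injective i (map_zero i) S.inj
  surj := Finsupp.mapRange_surjective p (map_zero p) S.surj
  pi x := by ext y; simp [S.pi]
  ex y hy := by
    have : ∀ g, ∃ k, i k = y g := fun g => S.ex _ (by
      have := DFunLike.congr_fun hy g
      simpa using this)
    choose s hs using this
    refine ⟨Finsupp.onFinset y.support s ?_, ?_⟩
    · intro g hg
      rw [Finsupp.mem_support_iff]
      intro h0
      apply hg
      apply S.inj
      rw [hs, h0, map_zero]
    · ext g
      simp [hs]

/-- data for Shapiro's lemma -/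
structure Shap (a : G →* Equiv.Perm X) (x0 : X) (j : K →* G) : Prop where
  tr : ∀ x, ∃ g, a g x0 = x
  inj : Function.Injective j
  st : ∀ g, a g x0 = x0 ↔ ∃ k, j k = g

theorem Shap.eqv {a : G →* Equiv.Perm X} {x0 : X} {j : K →* G} (H : Shap a x0 j) (ρ : Rp G M) :
    Eqv (ρ.comp j) (indRep a ρ) j (Finsupp.singleAddHom x0) := by
  intro k m
  simp [(H.st (j k)).2 ⟨k, rfl⟩]

theorem shap_zero_inj {a : G →* Equiv.Perm X} {x0 : X} {j : K →* G} (H : Shap a x0 j)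
    (ρ : Rp G M) (z : Ch K M 0)
    (hz : cm j (Finsupp.singleAddHom x0) 0 z ∈ Bn (indRep a ρ) 0) : z ∈ Bn (ρ.comp j) 0 := by
  obtain ⟨t, ht⟩ : ∃ t : X → G, (∀ x, a (t x) x0 = x) := ⟨_, fun x => (H.tr x).choose_spec⟩
  let e : Fin 0 → K := Fin.elim0
  let L0 : (X →₀ M) →+ Ch K M 0 := Finsupp.liftAddHom fun x =>
    (Finsupp.singleAddHom e).comp (ρ (t x)⁻¹)
  let L : Ch G (X →₀ M) 0 →+ Ch K M 0 := Finsupp.liftAddHom fun _ => L0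
  have key : ∀ (k : K) (m : M), Finsupp.single e (ρ (j k) m) - Finsupp.single e m ∈ Bn (ρ.comp j) 0 := by
    intro k m
    refine ⟨Finsupp.single (fun _ => k⁻¹) m, ?_⟩
    rw [dd_zero_single _ _ _ e e]
    simp
  have key2 : ∀ (g : G) (x : X) (m : M), L0 (Finsupp.single (a g x) (ρ g m)) - L0 (Finsupp.single x m)
      ∈ Bn (ρ.comp j) 0 := by
    intro g x m
    simp only [L0, Finsupp.liftAddHom_apply_single, AddMonoidHom.comp_apply,
      Finsupp.singleAddHom_apply]
    obtain ⟨k, hk⟩ := (H.st ((t (a g x))⁻¹ * g * t x)).1 (by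
      simp only [map_mul, Equiv.Perm.mul_apply, ht, map_inv]
      rw [Equiv.Perm.inv_eq_iff_eq, ht])
    have := key k (ρ (t x)⁻¹ m)
    rw [hk, ← rp_mul] at this
    rw [← rp_mul]
    simpa [mul_assoc] using this
  have key3 : ∀ w, L (dd (indRep a ρ) 0 w) ∈ Bn (ρ.comp j) 0 := by
    intro w
    induction w using Finsupp.induction_linear with
    | zero => simp only [map_zero]; exact zero_mem _
    | add x y hx hy => simp only [map_add]; exact add_mem hx hy
    | single g v =>
      rw [dd_zero_single _ _ _ Fin.elim0 Fin.elim0]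
      simp only [map_sub, L, Finsupp.liftAddHom_apply_single]
      induction v using Finsupp.induction_linear with
      | zero => simp only [map_zero, sub_zero]; exact zero_mem _
      | add x y hx hy => simp only [map_add, add_sub_add_comm]; exact add_mem hx hy
      | single x m => rw [indRep_single]; exact key2 _ _ _
  have key4 : ∀ z, z - L (cm j (Finsupp.singleAddHom x0) 0 z) ∈ Bn (ρ.comp j) 0 := by
    intro z
    induction z using Finsupp.induction_linear with
    | zero => simp only [map_zero, sub_zero]; exact zero_mem _
    | add x y hx hy =>
      simp only [map_add, add_sub_add_comm]
      exact add_mem hx hy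
    | single g m =>
      rw [cm_single]
      simp only [L, L0, Finsupp.liftAddHom_apply_single, Finsupp.singleAddHom_apply,
        AddMonoidHom.comp_apply]
      obtain ⟨k, hk⟩ := (H.st (t x0)).1 (ht x0)
      have := key k (ρ (t x0)⁻¹ m)
      rw [hk, rp_self_inv] at this
      rwa [Subsingleton.elim g e]
  obtain ⟨w, hw⟩ := hz
  have key4 := key4 z
  rw [← hw] at key4
  have := add_mem key4 (key3 w)
  rwa [sub_add_cancel] at this

theorem shap_zero_surj {a : G →* Equiv.Perm X} {x0 : X} {j : K →* G} (H : Shap a x0 j)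
    (ρ : Rp G M) (w : Ch G (X →₀ M) 0) :
    ∃ z : Ch K M 0, w - cm j (Finsupp.singleAddHom x0) 0 z ∈ Bn (indRep a ρ) 0 := by
  induction w using Finsupp.induction_linear with
  | zero => exact ⟨0, by simp only [map_zero, sub_zero]; exact zero_mem _⟩
  | add x y hx hy =>
    obtain ⟨z, hz⟩ := hx
    obtain ⟨z', hz'⟩ := hy
    exact ⟨z + z', by simp only [map_add, add_sub_add_comm]; exact add_mem hz hz'⟩
  | single e v =>
    induction v using Finsupp.induction_linear with
    | zero => exact ⟨0, by simp only [Finsupp.single_zero, map_zero, sub_zero]; exact zero_mem _⟩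
    | add x y hx hy =>
      obtain ⟨z, hz⟩ := hx
      obtain ⟨z', hz'⟩ := hy
      exact ⟨z + z', by simp only [Finsupp.single_add, map_add, add_sub_add_comm]; exact add_mem hz hz'⟩
    | single x m =>
      obtain ⟨g, rfl⟩ := H.tr x
      refine ⟨Finsupp.single Fin.elim0 (ρ g⁻¹ m), Finsupp.single (fun _ => g⁻¹) (Finsupp.single x0 (ρ g⁻¹ m)), ?_⟩
      rw [dd_zero_single _ _ _ e e]
      simp only [inv_inv, indRep_single, rp_self_inv, cm_single, Finsupp.singleAddHom_apply]
      rw [Subsingleton.elim e (fun i : Fin 0 => j (Fin.elim0 i))]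

theorem shapiro {a : G →* Equiv.Perm X} {x0 : X} {j : K →* G} (H : Shap a x0 j) (n : ℕ) :
    ∀ {M : Type} [AddCommGroup M] (ρ : Rp G M),
    (∀ z ∈ Zn (ρ.comp j) n, cm j (Finsupp.singleAddHom x0) n z ∈ Bn (indRep a ρ) n →
      z ∈ Bn (ρ.comp j) n) ∧
    (∀ w ∈ Zn (indRep a ρ) n, ∃ z ∈ Zn (ρ.comp j) n,
      w - cm j (Finsupp.singleAddHom x0) n z ∈ Bn (indRep a ρ) n) := by
  induction n with
  | zero =>
    intro M _ ρ
    refine ⟨fun z _ hz => shap_zero_inj H ρ z hz, fun w _ => ?_⟩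
    obtain ⟨z, hz⟩ := shap_zero_surj H ρ w
    exact ⟨z, trivial, hz⟩
  | succ n ih =>
    intro M _ ρ
    have S := SES_can ρ
    have SK := S.comp j
    have SX := S.ind a
    have IK := (RPj_res ρ j H.inj).HZ n
    have IX := ((RPj_ind ρ).ind a).HZ n
    have nat : ∀ z x, dRel ((indRep (lmul G) ρ).comp j) (sm G M).ker.subtype (sm G M) n z x →
        dRel (indRep a (indRep (lmul G) ρ)) (Finsupp.mapRange.addMonoidHom (sm G M).ker.subtype)
          (Finsupp.mapRange.addMonoidHom (sm G M)) n (cm j (Finsupp.singleAddHom x0) _ z)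
          (cm j (Finsupp.singleAddHom x0) _ x) := by
      intro z x h
      exact h.map _ (Finsupp.singleAddHom x0) _ (H.eqv _) (fun k => by simp) (fun k => by simp)
    constructor
    · intro z hz hB
      obtain ⟨x, hx, hr⟩ := SK.rel_ex hz
      exact SK.rel_B_left IK hr ((ih _).1 x hx (SX.rel_B_right (nat _ _ hr) hB))
    · intro w hw
      obtain ⟨x, hx, hr⟩ := SX.rel_ex hw
      obtain ⟨x', hx', hd⟩ := (ih _).2 x hx
      obtain ⟨z, hz, hr'⟩ := SK.rel_ex' (x := x') (by
        refine (ih _).1 _ (cm_mem_Z SK.ci hx') ?_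
        have h1 := cm_mem_B SX.ci hd
        rw [map_sub] at h1
        have h2 := SX.rel_B_mid hr
        have h3 := sub_mem h2 h1
        rw [sub_sub_cancel] at h3
        convert h3 using 1
        rw [cm_cm, cm_cm]
        congr 2
        ext k; simp)
      exact ⟨z, hz, SX.rel_B_left IX (hr.sub (nat _ _ hr')) hd⟩

theorem Shap.HZ {a : G →* Equiv.Perm X} {x0 : X} {j : K →* G} (H : Shap a x0 j) {n : ℕ}
    {ρ : Rp G M} (h : HZ (ρ.comp j) n) : HZ (indRep a ρ) n := by
  intro w hw
  obtain ⟨z, hz, hd⟩ := (shapiro H n ρ).2 w hw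
  have := add_mem hd (cm_mem_B (H.eqv ρ) (h z hz))
  rwa [sub_add_cancel] at this

end shapiro
end RH

namespace RH

section kunneth
variable {E P X M M' N : Type} [Group E] [Group P]
  [AddCommGroup M] [AddCommGroup M'] [AddCommGroup N]

theorem eqv_triv {G G' : Type} [Group G] [Group G'] (f : G →* G') (φ : M →+ M') :
    Eqv (triv G M) (triv G' M') f φ := fun _ _ => rfl

theorem HZ_triv_finsupp {n : ℕ} (h : HZ (triv E M) n) : HZ (triv E (X →₀ M)) n := by
  classical
  intro z hz
  have h1 : ∀ x, ∃ w, dd (triv E M) n w =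
      cm (MonoidHom.id E) (Finsupp.applyAddHom x : (X →₀ M) →+ M) n z := fun x =>
    h _ (cm_mem_Z (eqv_triv _ _) hz)
  choose w hw using h1
  refine ⟨∑ x ∈ z.support.biUnion (fun g => (z g).support),
    cm (MonoidHom.id E) (Finsupp.singleAddHom x) _ (w x), ?_⟩
  rw [map_sum]
  simp only [← cm_dd (eqv_triv (M := M) (M' := X →₀ M) (MonoidHom.id E) _), hw]
  ext g : 1
  rw [Finsupp.finsetSum_apply]
  simp only [cm_apply_id, Finsupp.applyAddHom_apply, Finsupp.singleAddHom_apply]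
  by_cases hg : z g = 0
  · simp [hg]
  · conv_rhs => rw [← Finsupp.sum_single (z g)]
    rw [Finsupp.sum]
    symm
    apply Finset.sum_subset
    · exact Finset.subset_biUnion_of_mem (fun g => (z g).support) (Finsupp.mem_support_iff.2 hg)
    · intro x _ hx
      rw [Finsupp.notMem_support_iff.1 hx, Finsupp.single_zero]

theorem HZ_triv_ker {n : ℕ} (h : HZ (triv E M) n) : HZ (triv E (sm P M).ker) n := by
  refine (HZ_triv_finsupp (X := P) h).retract (sm P M).ker.subtype
    ((AddMonoidHom.id _ - (Finsupp.singleAddHom 1).comp (sm P M)).codRestrict (sm P M).ker ?_)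
    (eqv_triv _ _) (eqv_triv _ _) ?_
  · rintro ⟨x, hx⟩
    apply Subtype.ext
    simp [AddMonoidHom.mem_ker.1 hx]
  · intro x
    simp [AddMonoidHom.mem_ker]

theorem comp_inl (σ : Rp P M) : (σ.comp (MonoidHom.snd E P)).comp (MonoidHom.inl E P) = triv E M := by
  ext e m; simp [rp_one]

theorem shap_prod : Shap ((lmul P).comp (MonoidHom.snd E P)) 1 (MonoidHom.inl E P) where
  tr x := ⟨(1, x), by simp⟩
  inj a b h := congrArg Prod.fst h
  st g := by
    constructor
    · intro h
      refine ⟨g.1, Prod.ext rfl ?_⟩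
      simpa using h.symm
    · rintro ⟨k, rfl⟩; simp

theorem kunneth_aux {n : ℕ} (σ : Rp P M) {z x}
    (hr : dRel ((indRep (lmul P) σ).comp (MonoidHom.snd E P)) (sm P M).ker.subtype (sm P M) n z x)
    (hx : x ∈ Bn ((kerRep (eqv_sm (lmul P) σ)).comp (MonoidHom.snd E P)) n) :
    ∃ e ∈ Zn (triv E M) (n+1), z - cm (MonoidHom.inl E P) (AddMonoidHom.id M) (n+1) e ∈
      Bn (σ.comp (MonoidHom.snd E P)) (n+1) := by
  have S := (SES_can σ).comp (MonoidHom.snd E P)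
  obtain ⟨y, hy, rfl⟩ := S.rel_lift hr hx
  obtain ⟨e, he, hd⟩ := (shapiro (shap_prod (E := E) (P := P)) (n+1) (σ.comp (MonoidHom.snd E P))).2 y hy
  rw [comp_inl] at he
  refine ⟨e, he, ?_⟩
  have h2 := cm_mem_B S.cp hd
  rw [map_sub, cm_cm] at h2
  convert h2 using 4
  · rfl
  · ext m; simp

theorem kunneth (n : ℕ) : ∀ {M : Type} [AddCommGroup M] (σ : Rp P M),
    (∀ k, 1 ≤ k → k < n → HZ (triv E M) k) → ∀ z ∈ Zn (σ.comp (MonoidHom.snd E P)) n,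
    cm (MonoidHom.snd E P) (AddMonoidHom.id M) n z ∈ Bn σ n →
    ∃ e ∈ Zn (triv E M) n, z - cm (MonoidHom.inl E P) (AddMonoidHom.id M) n e ∈
      Bn (σ.comp (MonoidHom.snd E P)) n := by
  have zero : ∀ {M : Type} [AddCommGroup M] (σ : Rp P M), ∀ z ∈ Zn (σ.comp (MonoidHom.snd E P)) 0,
    cm (MonoidHom.snd E P) (AddMonoidHom.id M) 0 z ∈ Bn σ 0 →
      z ∈ Bn (σ.comp (MonoidHom.snd E P)) 0 := by
    intro M _ σ z hz hB
    have := cm_mem_B (f := MonoidHom.inr E P) (ρ' := σ.comp (MonoidHom.snd E P))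
      (φ := AddMonoidHom.id M) (fun _ _ => rfl) hB
    rw [cm_cm] at this
    convert this
    conv_lhs => rw [← cm_id _ z]
    rw [← AddMonoidHom.comp_id (AddMonoidHom.id M)]
    generalize AddMonoidHom.comp (AddMonoidHom.id M) (AddMonoidHom.id M) = φ
    congr 1
    refine ch_ext fun g m => ?_
    simp only [cm_single]
    congr 1
    exact Subsingleton.elim _ _
  induction n with
  | zero =>
    intro M _ σ _ z hz hB
    refine ⟨0, zero_mem _, ?_⟩
    rw [map_zero, sub_zero]
    exact zero σ z hz hB
  | succ n ih =>
    intro M _ σ hE z hz hB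
    have S := (SES_can σ).comp (MonoidHom.snd E P)
    obtain ⟨x, hx, hr⟩ := S.rel_ex hz
    have hr' := hr.map (f := MonoidHom.snd E P) (ρI' := indRep (lmul P) σ)
      (i' := (sm P M).ker.subtype) (p' := sm P M) (AddMonoidHom.id _) (AddMonoidHom.id _)
      (AddMonoidHom.id _) (fun _ _ => rfl) (fun _ => rfl) (fun _ => rfl)
    have hxB := (SES_can σ).rel_B_right hr' hB
    refine kunneth_aux σ hr ?_
    rcases Nat.eq_zero_or_pos n with rfl | hn
    · exact zero _ x hx hxB
    · obtain ⟨e, he, hd⟩ := ih _ (fun k h1 h2 => HZ_triv_ker (hE k h1 (by omega))) x hx hxB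
      have heB := HZ_triv_ker (P := P) (hE n hn (by omega)) e he
      have h3 := cm_mem_B (f := MonoidHom.inl E P) (φ := AddMonoidHom.id _)
        (ρ' := (kerRep (eqv_sm (lmul P) σ)).comp (MonoidHom.snd E P)) (by
          intro e m
          simp [rp_one]) heB
      have := add_mem hd h3
      rwa [sub_add_cancel] at this

end kunneth

section cons
variable {E P G G' M : Type} [Group E] [Group P] [Group G] [Group G'] [AddCommGroup M]

/-- induced map on trivial coefficients -/
noncomputable abbrev tm (f : G →* G') (n : ℕ) : Ch G ℤ n →+ Ch G' ℤ n := cm f (AddMonoidHom.id ℤ) n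

abbrev tZ (G : Type) [Group G] := triv G ℤ

theorem tm_Z (f : G →* G') {n z} (h : z ∈ Zn (tZ G) n) : tm f n z ∈ Zn (tZ G') n :=
  cm_mem_Z (eqv_triv _ _) h

theorem tm_B (f : G →* G') {n z} (h : z ∈ Bn (tZ G) n) : tm f n z ∈ Bn (tZ G') n :=
  cm_mem_B (eqv_triv _ _) h

theorem tm_tm {G'' : Type} [Group G''] (f : G →* G') (f' : G' →* G'') (n z) :
    tm f' n (tm f n z) = tm (f'.comp f) n z := cm_cm _ _ _ _ _ _

theorem tm_id (n) (z : Ch G ℤ n) : tm (MonoidHom.id G) n z = z := cm_id n z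

/-- the acyclic factor can be dropped (injectivity) -/
theorem kunneth_B (hE : ∀ n, HZ (tZ E) (n+1)) {n : ℕ} {z} (hz : z ∈ Zn (tZ (E × P)) (n+1))
    (hB : tm (MonoidHom.snd E P) (n+1) z ∈ Bn (tZ P) (n+1)) : z ∈ Bn (tZ (E × P)) (n+1) := by
  obtain ⟨e, he, hd⟩ := kunneth (E := E) (n+1) (tZ P)
    (fun k h1 h2 => by obtain ⟨k, rfl⟩ : ∃ m, k = m+1 := ⟨k-1, by omega⟩; exact hE k) z hz hB
  have := add_mem hd (tm_B (MonoidHom.inl E P) (hE n e he))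
  rwa [sub_add_cancel] at this

theorem triv_hom_B {n : ℕ} {z} (hz : z ∈ Zn (tZ G) (n+1)) : tm (1 : G →* G') (n+1) z ∈ Bn (tZ G') (n+1) := by
  have h : RPj (tZ Unit) := ⟨Finsupp.singleAddHom 1, fun g m => by simp [Subsingleton.elim g 1],
    fun x => by simp⟩
  have h1 := tm_B (1 : Unit →* G') (h.HZ n _ (tm_Z (1 : G →* Unit) hz))
  rw [tm_tm] at h1
  exact h1

theorem diag_B {n : ℕ} (hG : ∀ k, 1 ≤ k → k < n+1 → HZ (tZ G) k) {z} (hz : z ∈ Zn (tZ G) (n+1)) :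
    tm ((MonoidHom.id G).prod (MonoidHom.id G)) (n+1) z - tm (MonoidHom.inl G G) (n+1) z
      - tm (MonoidHom.inr G G) (n+1) z ∈ Bn (tZ (G × G)) (n+1) := by
  have hZ : tm ((MonoidHom.id G).prod (MonoidHom.id G)) (n+1) z - tm (MonoidHom.inl G G) (n+1) z
      - tm (MonoidHom.inr G G) (n+1) z ∈ Zn (tZ (G × G)) (n+1) :=
    sub_mem (sub_mem (tm_Z _ hz) (tm_Z _ hz)) (tm_Z _ hz)
  have p2 : tm (MonoidHom.snd G G) (n+1) (tm ((MonoidHom.id G).prod (MonoidHom.id G)) (n+1) z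
      - tm (MonoidHom.inl G G) (n+1) z - tm (MonoidHom.inr G G) (n+1) z) ∈ Bn (tZ G) (n+1) := by
    rw [map_sub, map_sub, tm_tm, tm_tm, tm_tm, MonoidHom.snd_comp_prod, MonoidHom.snd_comp_inl,
      MonoidHom.snd_comp_inr, sub_right_comm, sub_self, zero_sub]
    exact neg_mem (triv_hom_B hz)
  have p1 : tm (MonoidHom.fst G G) (n+1) (tm ((MonoidHom.id G).prod (MonoidHom.id G)) (n+1) z
      - tm (MonoidHom.inl G G) (n+1) z - tm (MonoidHom.inr G G) (n+1) z) ∈ Bn (tZ G) (n+1) := by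
    rw [map_sub, map_sub, tm_tm, tm_tm, tm_tm, MonoidHom.fst_comp_prod, MonoidHom.fst_comp_inl,
      MonoidHom.fst_comp_inr, sub_self, zero_sub]
    exact neg_mem (triv_hom_B hz)
  generalize (tm ((MonoidHom.id G).prod (MonoidHom.id G)) (n+1) z
      - tm (MonoidHom.inl G G) (n+1) z - tm (MonoidHom.inr G G) (n+1) z) = d at *
  obtain ⟨e, he, hd⟩ := kunneth (E := G) (n+1) (tZ G) hG d hZ p2
  have h1 := tm_B (MonoidHom.fst G G) hd
  rw [map_sub] at h1
  have h2 := sub_mem p1 h1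
  rw [sub_sub_cancel] at h2
  change tm (MonoidHom.fst G G) (n+1) (tm (MonoidHom.inl G G) (n+1) e) ∈ _ at h2
  rw [tm_tm, MonoidHom.fst_comp_inl, tm_id] at h2
  have := add_mem hd (tm_B (MonoidHom.inl G G) h2)
  rwa [sub_add_cancel] at this

theorem conj_hom_B {H : Type} [Group H] (f f' : H →* G) (u : G) (h : ∀ x, u * f x * u⁻¹ = f' x)
    {n z} (hz : z ∈ Zn (tZ H) n) : tm f' n z - tm f n z ∈ Bn (tZ G) n := by
  have := conj_inv u n (tZ G) (tm f n z) (tm_Z f hz)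
  rw [cm_cm] at this
  convert this
  · ext x; exact (h x).symm
  · rfl

/-- Binate lemma -/
theorem binate (H : ℕ → Type) [∀ i, Group (H i)] (c : ∀ i, H i →* G)
    (hc : ∀ i, Function.Injective (c i)) (mono : ∀ i, (c i).range ≤ (c (i+1)).range)
    (ex : ∀ g, ∃ i, g ∈ (c i).range) (φ : ∀ i, H i →* G)
    (comm : ∀ i h h', Commute (c i h) (φ i h')) (u : ℕ → G)
    (hu : ∀ i h, u i * φ i h * (u i)⁻¹ = c i h * φ i h) (n : ℕ) : HZ (tZ G) (n+1) := by
  classical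
  have mono' : Monotone fun i => (c i).range := monotone_nat_of_le_succ mono
  have fin : ∀ s : Finset G, ∃ i, ∀ k, i ≤ k → ∀ g ∈ s, g ∈ (c k).range := by
    intro s
    induction s using Finset.induction_on with
    | empty => exact ⟨0, by simp⟩
    | insert a s _ ih =>
      obtain ⟨i, hi⟩ := ih
      obtain ⟨j, hj⟩ := ex a
      refine ⟨max i j, fun k hk g hg => ?_⟩
      rcases Finset.mem_insert.1 hg with rfl | hg
      · exact mono' (le_trans (le_max_right _ _) hk) hj
      · exact hi k (le_trans (le_max_left _ _) hk) g hg
  induction n using Nat.strong_induction_on with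
  | _ n ih =>
    intro z hz
    obtain ⟨w, hw⟩ := diag_B (n := n) (fun k h1 h2 => by
      obtain ⟨k, rfl⟩ : ∃ m, k = m+1 := ⟨k-1, by omega⟩
      exact ih k (by omega)) hz
    obtain ⟨i, hi⟩ := fin (z.support.biUnion fun g => Finset.univ.image g)
    obtain ⟨j, hj⟩ := fin (w.support.biUnion fun g => Finset.univ.image fun i => (g i).1)
    obtain ⟨j', hj'⟩ := fin (w.support.biUnion fun g => Finset.univ.image fun i => (g i).2)
    obtain ⟨k, hk1, hk2, hk3⟩ : ∃ k, i ≤ k ∧ j ≤ k ∧ j' ≤ k :=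
      ⟨max i (max j j'), by simp, by simp, by simp⟩
    obtain ⟨z', hz'⟩ := cm_lift (c k) (n+1) z (fun g hg t => hi k hk1 _ (by
      simp only [Finset.mem_biUnion]; exact ⟨g, hg, by simp⟩))
    obtain ⟨w', hw'⟩ := cm_lift ((c k).prodMap (c k)) (n+2) w (fun g hg t => by
      obtain ⟨a, ha⟩ := hj k hk2 (g t).1 (by
        simp only [Finset.mem_biUnion]; exact ⟨g, hg, by simp⟩)
      obtain ⟨b, hb⟩ := hj' k hk3 (g t).2 (by
        simp only [Finset.mem_biUnion]; exact ⟨g, hg, by simp⟩)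
      exact ⟨(a, b), Prod.ext ha hb⟩)
    have hinj : Function.Injective (tm ((c k).prodMap (c k)) (n+1)) :=
      cm_inj (fun a b h => Prod.ext (hc k (congrArg Prod.fst h)) (hc k (congrArg Prod.snd h)))
        Function.injective_id _
    have hz'Z : z' ∈ Zn (tZ (H k)) (n+1) := by
      rw [mem_Zn_succ]
      apply cm_inj (hc k) (φ := AddMonoidHom.id ℤ) Function.injective_id
      rw [cm_dd (eqv_triv _ _), hz', map_zero]
      exact hz
    have e1 : dd (tZ (H k × H k)) (n+1) w' =
        tm ((MonoidHom.id _).prod (MonoidHom.id _)) (n+1) z' - tm (MonoidHom.inl _ _) (n+1) z'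
      - tm (MonoidHom.inr _ _) (n+1) z' := by
      apply hinj
      rw [cm_dd (eqv_triv _ _), hw', hw, map_sub, map_sub, tm_tm, tm_tm, tm_tm, ← hz', ]
      change tm _ _ (tm _ _ _) - tm _ _ (tm _ _ _) - tm _ _ (tm _ _ _) = _
      rw [tm_tm, tm_tm, tm_tm]
      have a1 : ((MonoidHom.id G).prod (MonoidHom.id G)).comp (c k) =
        ((c k).prodMap (c k)).comp ((MonoidHom.id _).prod (MonoidHom.id _)) := rfl
      have a2 : (MonoidHom.inl G G).comp (c k) = ((c k).prodMap (c k)).comp (MonoidHom.inl _ _) := by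
        ext x <;> simp
      have a3 : (MonoidHom.inr G G).comp (c k) = ((c k).prodMap (c k)).comp (MonoidHom.inr _ _) := by
        ext x <;> simp
      rw [a1, a2, a3]
    let ψ : H k × H k →* G := (c k).noncommCoprod (φ k) (comm k)
    have e2 := tm_B ψ ⟨w', e1⟩
    rw [map_sub, map_sub, tm_tm, tm_tm, tm_tm, MonoidHom.noncommCoprod_comp_inl,
      MonoidHom.noncommCoprod_comp_inr] at e2
    have e3 := conj_hom_B (φ k) (ψ.comp ((MonoidHom.id (H k)).prod (MonoidHom.id (H k)))) (u k)
      (fun x => by rw [hu]; rfl) hz'Z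
    have e4 := sub_mem e3 e2
    rw [← hz']
    convert e4 using 1
    change tm _ _ _ = _
    abel

/-- evaluation of a 1-chain under a character -/
noncomputable def ev {D : Type} [AddCommGroup D] (χ : G → D) : Ch G ℤ 1 →+ D :=
  Finsupp.liftAddHom fun g => (zmultiplesHom D) (χ (g 0))

@[simp] theorem ev_single {D : Type} [AddCommGroup D] (χ : G → D) (g : Fin 1 → G) (m : ℤ) :
    ev χ (Finsupp.single g m) = m • χ (g 0) := by simp [ev]

theorem ev_tm {D : Type} [AddCommGroup D] (χ : G' → D) (f : G →* G') (z) :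
    ev χ (tm f 1 z) = ev (fun g => χ (f g)) z := by
  rw [← AddMonoidHom.comp_apply]; congr 1
  exact ch_ext fun g m => by simp

theorem Z1_all (z : Ch G ℤ 1) : z ∈ Zn (tZ G) 1 := by
  rw [mem_Zn_succ]
  induction z using Finsupp.induction_linear with
  | zero => simp only [map_zero]
  | add x y hx hy => rw [map_add, hx, hy, add_zero]
  | single g m =>
    rw [dd_zero_single _ _ _ Fin.elim0 Fin.elim0, triv_act, sub_self]

theorem dd_one_single (g h : G) (m : ℤ) : dd (tZ G) 1 (Finsupp.single ![g, h] m) =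
    Finsupp.single ![h] m - Finsupp.single ![g * h] m + Finsupp.single ![g] m := by
  rw [dd_single, Fin.sum_univ_two]
  have h1 : (fun i : Fin 1 => (![g, h] : Fin 2 → G) i.succ) = ![h] := by
    funext i; fin_cases i; rfl
  have h2 : Fin.contractNth (0 : Fin 2) (· * ·) ![g, h] = ![g * h] := by
    funext i; fin_cases i; rfl
  have h3 : Fin.contractNth (1 : Fin 2) (· * ·) ![g, h] = ![g] := by
    funext i; fin_cases i; rfl
  rw [h1, h2, h3]
  simp [sub_eq_add_neg, add_assoc]

theorem B1_iff (z : Ch G ℤ 1) : z ∈ Bn (tZ G) 1 ↔ ∀ (D : Type) (_ : AddCommGroup D) (χ : G → D),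
    (∀ g h, χ (g * h) = χ g + χ h) → ev χ z = 0 := by
  constructor
  · rintro ⟨w, rfl⟩ D _ χ hχ
    induction w using Finsupp.induction_linear with
    | zero => simp only [map_zero]
    | add x y hx hy => rw [map_add, map_add, hx, hy, add_zero]
    | single g m =>
      have : g = ![g 0, g 1] := by funext i; fin_cases i <;> rfl
      rw [this, dd_one_single]
      simp [hχ]
  · intro h
    have := h (Ch G ℤ 1 ⧸ Bn (tZ G) 1) inferInstance
      (fun g => QuotientAddGroup.mk (Finsupp.single ![g] 1)) (by
        intro g h
        rw [← QuotientAddGroup.mk_add]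
        apply (QuotientAddGroup.eq).2
        refine ⟨Finsupp.single ![g, h] 1, ?_⟩
        rw [dd_one_single]; abel)
    rw [← QuotientAddGroup.eq_zero_iff, ← this]
    change QuotientAddGroup.mk' _ z = _
    congr 1
    refine ch_ext fun g m => ?_
    rw [ev_single, ← QuotientAddGroup.mk_zsmul]
    simp only [QuotientAddGroup.mk'_apply]
    congr 1
    rw [Finsupp.smul_single]
    simp only [smul_eq_mul, mul_one]
    congr 1
    funext i; fin_cases i; rfl

/-- perfect groups -/
def Perf (G : Type) [Group G] : Prop := ∀ (D : Type) (_ : AddCommGroup D) (χ : G → D),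
    (∀ g h, χ (g * h) = χ g + χ h) → ∀ g, χ g = 0

theorem Perf.HZ1 (h : Perf G) : HZ (tZ G) 1 := by
  intro z _
  rw [B1_iff]
  intro D _ χ hχ
  have : χ = fun _ => 0 := funext fun g => h D _ χ hχ g
  subst this
  have : ev (fun _ : G => (0 : D)) = 0 := ch_ext fun g m => by simp
  rw [this]; rfl

theorem HZ1.perf (h : HZ (tZ G) 1) : Perf G := by
  intro D _ χ hχ g
  have := (B1_iff _).1 (h (Finsupp.single ![g] 1) (Z1_all _)) D _ χ hχ
  simpa using this

end cons
end RH

namespace RH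

section crossed
variable {G M M' : Type} [Group G] [AddCommGroup M] [AddCommGroup M']

def Crossed (ρ : Rp G M) (D : G → M) : Prop := ∀ g h, D (g * h) = D g + ρ g (D h)

theorem Crossed.one {ρ : Rp G M} {D : G → M} (h : Crossed ρ D) : D 1 = 0 := by
  have := h 1 1
  rw [rp_one, mul_one] at this
  simpa using this

theorem Crossed.inv {ρ : Rp G M} {D : G → M} (h : Crossed ρ D) (g : G) : D g⁻¹ = - ρ g⁻¹ (D g) := by
  have := h g⁻¹ g
  rw [inv_mul_cancel, h.one] at this
  exact eq_neg_of_add_eq_zero_left this.symm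

/-- equalizer of crossed homs -/
def eqSub {ρ : Rp G M} {D D' : G → M} (h : Crossed ρ D) (h' : Crossed ρ D') : Subgroup G where
  carrier := {g | D g = D' g}
  one_mem' := by simp [h.one, h'.one]
  mul_mem' := by
    intro a b ha hb
    simp only [Set.mem_setOf_eq] at *
    rw [h, h', ha, hb]
  inv_mem' := by
    intro a ha
    simp only [Set.mem_setOf_eq] at *
    rw [h.inv, h'.inv, ha]

theorem crossed_princ (ρ : Rp G M) (v : M) : Crossed ρ (fun g => ρ g v - v) := by
  intro g h
  simp only [rp_mul, map_sub]; abel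

theorem Crossed.map {ρ : Rp G M} {ρ' : Rp G M'} {D : G → M} (h : Crossed ρ D) {φ : M →+ M'}
    (hφ : Eqv ρ ρ' (MonoidHom.id G) φ) : Crossed ρ' (fun g => φ (D g)) := by
  intro g k
  simp only [h g k, map_add, hφ g, MonoidHom.id_apply]

/-- affine permutations -/
def affPerm (ρ : Rp G M) (g : G) (v : M) : Equiv.Perm M where
  toFun m := ρ g m + v
  invFun m := ρ g⁻¹ (m - v)
  left_inv m := by simp [rp_inv_self]
  right_inv m := by simp [rp_self_inv]

/-- the subgroup of pairs -/
theorem crossed_of_hom (ρ : Rp G M) (Θ : G →* Equiv.Perm M) (S : Subgroup G) (hS : S = ⊤)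
    (h : ∀ g ∈ S, ∀ m m', Θ g m - Θ g m' = ρ g (m - m')) : Crossed ρ (fun g => Θ g 0) := by
  intro g k
  have := h g (by simp [hS]) (Θ k 0) 0
  simp only [map_mul, Equiv.Perm.mul_apply]
  rw [sub_zero] at this
  rw [← this]; abel

/-- set of elements where a hom is affine over `ρ` -/
def affSub (ρ : Rp G M) (Θ : G →* Equiv.Perm M) : Subgroup G where
  carrier := {g | ∀ m m', Θ g m - Θ g m' = ρ g (m - m')}
  one_mem' := by intro m m'; simp [rp_one]
  mul_mem' := by
    intro a b ha hb m m'
    rw [map_mul, Equiv.Perm.mul_apply, Equiv.Perm.mul_apply, ha, hb, rp_mul]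
  inv_mem' := by
    intro a ha m m'
    have := ha (Θ a⁻¹ m) (Θ a⁻¹ m')
    rw [← Equiv.Perm.mul_apply, ← Equiv.Perm.mul_apply, ← map_mul, mul_inv_cancel, map_one] at this
    simp only [Equiv.Perm.one_apply] at this
    rw [this, rp_inv_self]

theorem crossed_of_affSub (ρ : Rp G M) (Θ : G →* Equiv.Perm M) (h : affSub ρ Θ = ⊤) :
    Crossed ρ (fun g => Θ g 0) := crossed_of_hom ρ Θ _ h (fun _ hg => hg)

end crossed

section free
variable {X : Type}

/-- action on `X × F` -/
def xAct (X F : Type) [Group F] : F →* Equiv.Perm (X × F) where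
  toFun g := (Equiv.refl X).prodCongr (lmul F g)
  map_one' := by ext x <;> simp
  map_mul' g h := by ext x <;> simp [mul_assoc]

@[simp] theorem xAct_apply {F : Type} [Group F] (g : F) (x : X) (f : F) :
    xAct X F g (x, f) = (x, g * f) := rfl

theorem free_gen (S : Subgroup (FreeGroup X)) (h : ∀ x, FreeGroup.of x ∈ S) : S = ⊤ := by
  rw [eq_top_iff, ← FreeGroup.closure_range_of, Subgroup.closure_le]
  rintro _ ⟨x, rfl⟩; exact h x

theorem fox (X : Type) : ∃ D : FreeGroup X → (X × FreeGroup X →₀ ℤ),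
    Crossed (indRep (xAct X (FreeGroup X)) (tZ _)) D ∧
      ∀ x, D (FreeGroup.of x) = Finsupp.single (x, 1) 1 := by
  let ρ := indRep (xAct X (FreeGroup X)) (tZ (FreeGroup X))
  let Θ : FreeGroup X →* Equiv.Perm (X × FreeGroup X →₀ ℤ) :=
    FreeGroup.lift fun x => affPerm ρ (FreeGroup.of x) (Finsupp.single (x, 1) 1)
  refine ⟨fun g => Θ g 0, crossed_of_affSub ρ Θ (free_gen _ fun x m m' => ?_), fun x => ?_⟩
  · simp [Θ, affPerm]
  · simp [Θ, affPerm]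

theorem HZ_free (X : Type) : HZ (tZ (FreeGroup X)) 2 := by
  obtain ⟨D, hD, hx⟩ := fox X
  let i : (X × FreeGroup X →₀ ℤ) →+ (FreeGroup X →₀ ℤ) := Finsupp.liftAddHom fun p =>
    Finsupp.singleAddHom (p.2 * FreeGroup.of p.1) - Finsupp.singleAddHom p.2
  have hi : ∀ x f m, i (Finsupp.single (x, f) m) = Finsupp.single (f * FreeGroup.of x) m -
      Finsupp.single f m := by intro x f m; simp [i]
  let s : (FreeGroup X →₀ ℤ) →+ (X × FreeGroup X →₀ ℤ) := Finsupp.liftAddHom fun f =>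
    zmultiplesHom _ (D f)
  have hs : ∀ f m, s (Finsupp.single f m) = m • D f := by intro f m; simp [s]
  have ci : Eqv (indRep (xAct X (FreeGroup X)) (tZ _)) (indRep (lmul (FreeGroup X)) (tZ _))
      (MonoidHom.id _) i := by
    intro g v
    induction v using Finsupp.induction_linear with
    | zero => simp only [map_zero]
    | add x y hx hy => simp only [map_add, hx, hy]
    | single x m => obtain ⟨x, f⟩ := x; simp [hi, mul_assoc]
  have iD : ∀ f, i (D f) = Finsupp.single f 1 - Finsupp.single 1 1 := by
    intro f
    have h1 := hD.map ci
    have h2 := crossed_princ (indRep (lmul (FreeGroup X)) (tZ _)) (Finsupp.single 1 1)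
    have : eqSub h1 h2 = ⊤ := free_gen _ fun x => by
      change i (D _) = _ - _
      rw [hx, hi]; simp
    have h3 : f ∈ eqSub h1 h2 := by rw [this]; trivial
    change i (D _) = _ - _ at h3
    rw [h3]; simp
  have S : SES (indRep (xAct X (FreeGroup X)) (tZ _)) (indRep (lmul (FreeGroup X)) (tZ _)) (tZ _)
      i (sm (FreeGroup X) ℤ) := by
    refine SES.ofSplit ci (eqv_sm _ _) s (Finsupp.singleAddHom 1) ?_ ?_ ?_ ?_
    · intro v
      induction v using Finsupp.induction_linear with
      | zero => simp only [map_zero]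
      | add x y hx hy => simp only [map_add, hx, hy]
      | single x m =>
        obtain ⟨x, f⟩ := x
        rw [hi, map_sub, hs, hs, hD, hx]
        simp
    · simp
    · intro v
      induction v using Finsupp.induction_linear with
      | zero => simp only [map_zero]
      | add x y hx hy => simp only [map_add, hx, hy, add_zero]
      | single x m => obtain ⟨x, f⟩ := x; simp [hi]
    · intro v
      induction v using Finsupp.induction_linear with
      | zero => simp only [map_zero, sub_zero]
      | add x y hx hy => simp only [map_add, hx, hy]; abel
      | single f m => rw [hs, map_zsmul, iD]; simp [smul_sub]
  intro z hz
  obtain ⟨x, hx, hr⟩ := S.rel_ex hz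
  exact S.rel_B_left (HZ_ind _ _) hr
    ((RPj_free (xAct X (FreeGroup X)) (tZ _) (fun p => p.2) (fun g p => rfl)).HZ 0 x hx)

end free

section amal
variable {H G1 G2 G : Type} [Group H] [Group G1] [Group G2] [Group G]

/-- amalgamated products, characterized -/
structure Amal (f1 : H →* G1) (f2 : H →* G2) (j1 : G1 →* G) (j2 : G2 →* G) : Prop where
  inj1 : Function.Injective j1
  inj2 : Function.Injective j2
  comm : ∀ h, j1 (f1 h) = j2 (f2 h)
  lift : ∀ (K : Type) [Group K] (a : G1 →* K) (b : G2 →* K), (∀ h, a (f1 h) = b (f2 h)) →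
    ∃ c : G →* K, (∀ x, c (j1 x) = a x) ∧ ∀ x, c (j2 x) = b x
  gen : ∀ S : Subgroup G, (∀ x, j1 x ∈ S) → (∀ x, j2 x ∈ S) → S = ⊤

/-- two-element family of groups -/
def BF (G1 G2 : Type) : Bool → Type
  | false => G1
  | true => G2

instance BFgroup (G1 G2 : Type) [i1 : Group G1] [i2 : Group G2] : ∀ b, Group (BF G1 G2 b)
  | false => i1
  | true => i2

/-- homs into a two-element family -/
def BFhom (f1 : H →* G1) (f2 : H →* G2) : ∀ b, H →* BF G1 G2 b
  | false => f1
  | true => f2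

/-- homs from a two-element family -/
def BFhom' {K : Type} [Group K] (a : G1 →* K) (b : G2 →* K) : ∀ i, BF G1 G2 i →* K
  | false => a
  | true => b

theorem exists_amalgam (f1 : H →* G1) (f2 : H →* G2) (h1 : Function.Injective f1)
    (h2 : Function.Injective f2) : ∃ (G : Type) (_ : Group G) (j1 : G1 →* G) (j2 : G2 →* G),
      Amal f1 f2 j1 j2 := by
  let φ := BFhom f1 f2
  have hφ : ∀ b, Function.Injective (φ b) := fun b => match b with
    | false => h1
    | true => h2
  refine ⟨Monoid.PushoutI φ, inferInstance, Monoid.PushoutI.of (φ := φ) false,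
    Monoid.PushoutI.of (φ := φ) true, ?_, ?_, ?_, ?_, ?_⟩
  · exact Monoid.PushoutI.of_injective hφ false
  · exact Monoid.PushoutI.of_injective hφ true
  · intro h
    exact (Monoid.PushoutI.of_apply_eq_base φ false h).trans
      (Monoid.PushoutI.of_apply_eq_base φ true h).symm
  · intro K _ a b hab
    let ψ := BFhom' a b
    have hψ : ∀ i, (ψ i).comp (φ i) = a.comp f1 := by
      intro i
      cases i
      · rfl
      · ext h; exact (hab h).symm
    refine ⟨Monoid.PushoutI.lift ψ _ hψ, fun x => ?_, fun x => ?_⟩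
    · exact Monoid.PushoutI.lift_of (φ := φ) (i := false) ψ _ hψ x
    · exact Monoid.PushoutI.lift_of (φ := φ) (i := true) ψ _ hψ x
  · intro S s1 s2
    rw [eq_top_iff]
    rintro x -
    induction x using Monoid.PushoutI.induction_on with
    | of i g =>
      cases i
      · exact s1 g
      · exact s2 g
    | base h =>
      rw [← Monoid.PushoutI.of_apply_eq_base φ false h]
      exact s1 _
    | mul x y hx hy => exact S.mul_mem hx hy

/-- action on cosets -/
def cosetAct (S : Subgroup G) : G →* Equiv.Perm (G ⧸ S) := MulAction.toPermHom G (G ⧸ S)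

@[simp] theorem cosetAct_mk (S : Subgroup G) (g x : G) :
    cosetAct S g (x : G ⧸ S) = ((g * x : G) : G ⧸ S) := rfl

theorem shap_coset (j : H →* G) (hj : Function.Injective j) :
    Shap (cosetAct j.range) ((1 : G) : G ⧸ j.range) j where
  tr x := by
    obtain ⟨g, rfl⟩ := QuotientGroup.mk_surjective x
    exact ⟨g, by simp⟩
  inj := hj
  st g := by
    rw [cosetAct_mk, mul_one, eq_comm, QuotientGroup.eq]
    simp

/-- product action -/
def prodRep {M M' : Type} [AddCommGroup M] [AddCommGroup M'] (ρ : Rp G M) (ρ' : Rp G M') :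
    Rp G (M × M') where
  act g := (ρ g).prodMap (ρ' g)
  act_one m := Prod.ext (rp_one _ _) (rp_one _ _)
  act_mul g h m := Prod.ext (rp_mul _ _ _ _) (rp_mul _ _ _ _)

theorem prod_B {M M' : Type} [AddCommGroup M] [AddCommGroup M'] (ρ : Rp G M) (ρ' : Rp G M')
    {n : ℕ} {z} : z ∈ Bn (prodRep ρ ρ') n ↔
      cm (MonoidHom.id G) (AddMonoidHom.fst M M') n z ∈ Bn ρ n ∧
      cm (MonoidHom.id G) (AddMonoidHom.snd M M') n z ∈ Bn ρ' n := by
  constructor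
  · intro h
    exact ⟨cm_mem_B (fun _ _ => rfl) h, cm_mem_B (fun _ _ => rfl) h⟩
  · rintro ⟨h1, h2⟩
    have h1 := cm_mem_B (ρ' := prodRep ρ ρ') (f := MonoidHom.id G) (φ := AddMonoidHom.inl M M')
      (fun g m => by simp [prodRep]) h1
    have h2 := cm_mem_B (ρ' := prodRep ρ ρ') (f := MonoidHom.id G) (φ := AddMonoidHom.inr M M')
      (fun g m => by simp [prodRep]) h2
    convert add_mem h1 h2
    ext g : 1
    simp [cm_apply_id]

theorem prod_HZ {M M' : Type} [AddCommGroup M] [AddCommGroup M'] {ρ : Rp G M} {ρ' : Rp G M'}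
    {n : ℕ} (h : HZ ρ n) (h' : HZ ρ' n) : HZ (prodRep ρ ρ') n := by
  intro z hz
  rw [prod_B]
  exact ⟨h _ (cm_mem_Z (fun _ _ => rfl) hz), h' _ (cm_mem_Z (fun _ _ => rfl) hz)⟩

/-- projection between coset modules -/
noncomputable def pr (S T : Subgroup G) : (G ⧸ S →₀ ℤ) →+ (G ⧸ T →₀ ℤ) :=
  Finsupp.liftAddHom fun q => Finsupp.singleAddHom ((q.out : G) : G ⧸ T)

theorem pr_single (S T : Subgroup G) (hST : S ≤ T) (g : G) (m : ℤ) :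
    pr S T (Finsupp.single (g : G ⧸ S) m) = Finsupp.single (g : G ⧸ T) m := by
  simp only [pr, Finsupp.liftAddHom_apply_single, Finsupp.singleAddHom_apply]
  congr 1
  obtain ⟨h, hh⟩ := QuotientGroup.mk_out_eq_mul S g
  rw [hh, eq_comm, QuotientGroup.eq]
  simpa using hST h.2

theorem coset_induction {S : Subgroup G} {p : (G ⧸ S →₀ ℤ) → Prop} (v : G ⧸ S →₀ ℤ)
    (zero : p 0) (add : ∀ x y, p x → p y → p (x + y))
    (single : ∀ (g : G) (m : ℤ), p (Finsupp.single (g : G ⧸ S) m)) : p v := by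
  induction v using Finsupp.induction_linear with
  | zero => exact zero
  | add x y hx hy => exact add x y hx hy
  | single q m =>
    obtain ⟨g, rfl⟩ := QuotientGroup.mk_surjective q
    exact single g m

theorem eqv_pr (S T : Subgroup G) (hST : S ≤ T) :
    Eqv (indRep (cosetAct S) (tZ G)) (indRep (cosetAct T) (tZ G)) (MonoidHom.id G) (pr S T) := by
  intro g v
  induction v using coset_induction with
  | zero => simp only [map_zero]
  | add x y hx hy => simp only [map_add, hx, hy]
  | single x m => simp [pr_single _ _ hST]

variable {f1 : H →* G1} {f2 : H →* G2} {j1 : G1 →* G} {j2 : G2 →* G}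

theorem Amal.le1 (_A : Amal f1 f2 j1 j2) : (j1.comp f1).range ≤ j1.range := by
  rintro _ ⟨x, rfl⟩; exact ⟨f1 x, rfl⟩

theorem Amal.le2 (A : Amal f1 f2 j1 j2) : (j1.comp f1).range ≤ j2.range := by
  rintro _ ⟨x, rfl⟩; exact ⟨f2 x, (A.comm x).symm⟩

theorem Amal.exD (A : Amal f1 f2 j1 j2) : ∃ D : G → (G ⧸ (j1.comp f1).range →₀ ℤ),
    Crossed (indRep (cosetAct _) (tZ G)) D ∧ (∀ x, D (j1 x) = 0) ∧
    (∀ x, D (j2 x) = Finsupp.single ((j2 x : G) : G ⧸ (j1.comp f1).range) 1 -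
      Finsupp.single ((1 : G) : G ⧸ (j1.comp f1).range) 1) := by
  let ρ := indRep (cosetAct (j1.comp f1).range) (tZ G)
  let e : (G ⧸ (j1.comp f1).range →₀ ℤ) := Finsupp.single ((1 : G) : G ⧸ (j1.comp f1).range) 1
  have he : ∀ g, ρ g e = Finsupp.single ((g : G) : G ⧸ (j1.comp f1).range) 1 := by
    intro g; simp [ρ, e]
  let a : G1 →* Equiv.Perm (G ⧸ (j1.comp f1).range →₀ ℤ) :=
    { toFun := fun g => affPerm ρ (j1 g) 0
      map_one' := by ext1 m; simp [affPerm, rp_one]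
      map_mul' := fun g h => by ext1 m; simp [affPerm, rp_mul] }
  let b : G2 →* Equiv.Perm (G ⧸ (j1.comp f1).range →₀ ℤ) :=
    { toFun := fun g => affPerm ρ (j2 g) (ρ (j2 g) e - e)
      map_one' := by ext1 m; simp [affPerm, rp_one]
      map_mul' := fun g h => by ext1 m; simp [affPerm, rp_mul]; abel }
  obtain ⟨Θ, h1, h2⟩ := A.lift _ a b (by
    intro h
    ext1 m
    simp only [a, b, affPerm, MonoidHom.coe_mk, OneHom.coe_mk, Equiv.coe_fn_mk, A.comm]
    congr 1
    rw [he, ← A.comm, eq_comm, sub_eq_zero]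
    simp only [e]
    congr 1
    rw [eq_comm, QuotientGroup.eq]
    exact ⟨h, by simp⟩)
  refine ⟨fun g => Θ g 0, crossed_of_affSub ρ Θ (A.gen _ (fun x m m' => ?_) (fun x m m' => ?_)),
    fun x => ?_, fun x => ?_⟩
  · rw [h1]; simp [a, affPerm]
  · rw [h2]; simp [b, affPerm]
  · simp only [h1]; simp [a, affPerm]
  · simp only [h2]; simp [b, affPerm, he, e]

/-- the Mayer-Vietoris coefficient sequence -/
theorem Amal.ses (A : Amal f1 f2 j1 j2) :
    SES (indRep (cosetAct (j1.comp f1).range) (tZ G))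
      (prodRep (indRep (cosetAct j1.range) (tZ G)) (indRep (cosetAct j2.range) (tZ G))) (tZ G)
      ((pr (j1.comp f1).range j1.range).prod (pr (j1.comp f1).range j2.range))
      ((sm _ ℤ).comp (AddMonoidHom.fst _ _) - (sm _ ℤ).comp (AddMonoidHom.snd _ _)) ∧
    ∃ D : G → (G ⧸ (j1.comp f1).range →₀ ℤ), Crossed (indRep (cosetAct _) (tZ G)) D ∧
      (∀ x, D (j1 x) = 0) ∧
      (∀ g, pr (j1.comp f1).range j1.range (D g) =
        Finsupp.single (g : G ⧸ j1.range) 1 - Finsupp.single ((1 : G) : G ⧸ j1.range) 1) := by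
  obtain ⟨D, hD, hD1, hD2⟩ := A.exD
  let i := ((pr (j1.comp f1).range j1.range).prod (pr (j1.comp f1).range j2.range))
  have hi : ∀ (g : G) m, i (Finsupp.single (g : G ⧸ (j1.comp f1).range) m) =
      (Finsupp.single (g : G ⧸ j1.range) m, Finsupp.single (g : G ⧸ j2.range) m) := by
    intro g m
    simp [i, pr_single _ _ A.le1, pr_single _ _ A.le2]
  have ci : Eqv (indRep (cosetAct (j1.comp f1).range) (tZ G))
      (prodRep (indRep (cosetAct j1.range) (tZ G)) (indRep (cosetAct j2.range) (tZ G)))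
      (MonoidHom.id G) i := fun g m => Prod.ext (eqv_pr _ _ A.le1 g m) (eqv_pr _ _ A.le2 g m)
  have iD : ∀ g, i (D g) = (Finsupp.single (g : G ⧸ j1.range) 1 -
      Finsupp.single ((1 : G) : G ⧸ j1.range) 1, 0) := by
    intro g
    have h1 := hD.map ci
    have h2 := crossed_princ (prodRep (indRep (cosetAct j1.range) (tZ G))
      (indRep (cosetAct j2.range) (tZ G))) (Finsupp.single ((1 : G) : G ⧸ j1.range) 1, 0)
    have : eqSub h1 h2 = ⊤ := by
      refine A.gen _ (fun x => ?_) (fun x => ?_)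
      · change i (D _) = _ - _
        rw [hD1]
        have : ((j1 x : G) : G ⧸ j1.range) = ((1 : G) : G ⧸ j1.range) := by
          rw [eq_comm, QuotientGroup.eq]; simp
        simp [prodRep, this]
      · change i (D _) = _ - _
        rw [hD2, map_sub, hi, hi]
        have : ((j2 x : G) : G ⧸ j2.range) = ((1 : G) : G ⧸ j2.range) := by
          rw [eq_comm, QuotientGroup.eq]; simp
        simp [prodRep, this]
    have h3 : g ∈ eqSub h1 h2 := by rw [this]; trivial
    change i (D _) = _ - _ at h3
    rw [h3]; simp [prodRep]
  refine ⟨?_, D, hD, hD1, fun g => congrArg Prod.fst (iD g)⟩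
  let s1 : (G ⧸ j1.range →₀ ℤ) →+ (G ⧸ (j1.comp f1).range →₀ ℤ) := Finsupp.liftAddHom fun q =>
    zmultiplesHom _ (D q.out)
  have hs1 : ∀ (g : G) m, s1 (Finsupp.single (g : G ⧸ j1.range) m) = m • D g := by
    intro g m
    simp only [s1, Finsupp.liftAddHom_apply_single, zmultiplesHom_apply]
    obtain ⟨⟨_, x, rfl⟩, hh⟩ := QuotientGroup.mk_out_eq_mul j1.range g
    rw [hh, hD, hD1]; simp
  let s2 : (G ⧸ j2.range →₀ ℤ) →+ (G ⧸ (j1.comp f1).range →₀ ℤ) := Finsupp.liftAddHom fun q =>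
    zmultiplesHom _ (Finsupp.single ((q.out : G) : G ⧸ (j1.comp f1).range) 1 - D q.out)
  have hs2 : ∀ (g : G) m, s2 (Finsupp.single (g : G ⧸ j2.range) m) =
      m • (Finsupp.single (g : G ⧸ (j1.comp f1).range) 1 - D g) := by
    intro g m
    simp only [s2, Finsupp.liftAddHom_apply_single, zmultiplesHom_apply]
    obtain ⟨⟨_, x, rfl⟩, hh⟩ := QuotientGroup.mk_out_eq_mul j2.range g
    rw [hh, hD, hD2]
    congr 1
    simp only [map_sub, indRep_single, cosetAct_mk, mul_one, triv_act]
    abel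
  refine SES.ofSplit ci ?_ (s1.comp (AddMonoidHom.fst _ _) + s2.comp (AddMonoidHom.snd _ _))
    ((AddMonoidHom.inl _ _).comp (Finsupp.singleAddHom ((1 : G) : G ⧸ j1.range))) ?_ ?_ ?_ ?_
  · rintro g ⟨x, y⟩
    have e1 := eqv_sm (cosetAct j1.range) (tZ G) g x
    have e2 := eqv_sm (cosetAct j2.range) (tZ G) g y
    simp only [triv_act] at e1 e2
    simp [prodRep, e1, e2]
  · intro v
    induction v using coset_induction with
    | zero => simp only [map_zero]
    | add x y hx hy => simp only [map_add, hx, hy]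
    | single g m =>
      rw [hi]
      simp only [AddMonoidHom.add_apply, AddMonoidHom.comp_apply, AddMonoidHom.coe_fst,
        AddMonoidHom.coe_snd, hs1, hs2, smul_sub]
      simp
  · intro m; simp
  · intro v
    induction v using coset_induction with
    | zero => simp only [map_zero]
    | add x y hx hy => simp only [map_add, hx, hy, add_zero]
    | single g m =>
      rw [hi]; simp
  · rintro ⟨v, w⟩
    have h1 : ∀ v, i (s1 v) = (v - Finsupp.single ((1 : G) : G ⧸ j1.range) (sm _ ℤ v), 0) := by
      intro v
      induction v using coset_induction with
      | zero => simp only [map_zero, sub_zero, Finsupp.single_zero]; rfl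
      | add x y hx hy => 
        simp only [map_add, hx, hy, Finsupp.single_add, Prod.mk_add_mk, add_zero]; congr 1; abel
      | single g m =>
        rw [hs1, map_zsmul, iD]
        simp [smul_sub]
    have h2 : ∀ w, i (s2 w) = (Finsupp.single ((1 : G) : G ⧸ j1.range) (sm _ ℤ w), w) := by
      intro w
      induction w using coset_induction with
      | zero => simp only [map_zero, Finsupp.single_zero]; rfl
      | add x y hx hy => simp only [map_add, hx, hy, Finsupp.single_add, Prod.mk_add_mk]
      | single g m =>
        rw [hs2, map_zsmul, map_sub, hi, iD]
        simp
    change i (s1 v + s2 w) = _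
    rw [map_add, h1, h2]
    simp only [AddMonoidHom.sub_apply, AddMonoidHom.comp_apply, AddMonoidHom.coe_fst,
        AddMonoidHom.coe_snd, Finsupp.singleAddHom_apply, Finsupp.single_sub, map_sub]
    ext x <;> simp
    abel

end amal
end RH

namespace RH

theorem rel_iso {V Q : Type} [AddCommGroup V] [AddCommGroup Q] (Z B : AddSubgroup V)
    (R : V → Q → Prop) (sub : ∀ {z z' q q'}, R z q → R z' q' → R (z - z') (q - q'))
    (tot : ∀ z ∈ Z, ∃ q, R z q) (sur : ∀ q, ∃ z ∈ Z, R z q)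
    (ker : ∀ z ∈ Z, ∀ q, R z q → (z ∈ B ↔ q = 0)) :
    Nonempty (Z ⧸ B.addSubgroupOf Z ≃+ Q) := by
  choose f hf using tot
  let F : Z →+ Q := AddMonoidHom.mk' (fun z => f z z.2) (by
    intro a b
    have h := sub (sub (hf _ (a + b).2) (hf _ a.2)) (hf _ b.2)
    have h0 : ((a + b : Z) : V) - a - b = 0 := by simp
    rw [h0] at h
    have := (ker _ (zero_mem _) _ h).1 (zero_mem _)
    rw [sub_sub, sub_eq_zero] at this
    exact this)
  have hF : Function.Surjective F := by
    intro q
    obtain ⟨z, hz, hr⟩ := sur q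
    refine ⟨⟨z, hz⟩, ?_⟩
    have h := sub (hf z hz) hr
    rw [sub_self] at h
    have := (ker _ (zero_mem _) _ h).1 (zero_mem _)
    exact sub_eq_zero.1 this
  have hK : F.ker = B.addSubgroupOf Z := by
    ext z
    rw [AddMonoidHom.mem_ker, AddSubgroup.mem_addSubgroupOf]
    exact (ker _ z.2 _ (hf _ z.2)).symm
  exact ⟨(QuotientAddGroup.quotientAddEquivOfEq hK.symm).trans
    (QuotientAddGroup.quotientKerEquivOfSurjective F hF)⟩

theorem dRel.adjust {G K I M : Type} [Group G] [AddCommGroup K] [AddCommGroup I] [AddCommGroup M]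
    {ρK : Rp G K} {ρI : Rp G I} {ρM : Rp G M} {i : K →+ I} {p : I →+ M}
    (S : SES ρK ρI ρM i p) {n : ℕ} {z x x'} (h : dRel ρI i p n z x)
    (hx : x - x' ∈ Bn ρK n) : dRel ρI i p n z x' := by
  obtain ⟨k, hk⟩ := hx
  obtain ⟨y, h1, h2⟩ := h
  refine ⟨y - cm (MonoidHom.id G) i _ k, ?_, ?_⟩
  · rw [map_sub, S.ch_pi, sub_zero, h1]
  · rw [map_sub, ← cm_dd S.ci, h2, hk, map_sub, sub_sub_cancel]

section mv
variable {H G1 G2 G : Type} [Group H] [Group G1] [Group G2] [Group G]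
  {f1 : H →* G1} {f2 : H →* G2} {j1 : G1 →* G} {j2 : G2 →* G}

theorem Amal.mv (A : Amal f1 f2 j1 j2) (hf1 : Function.Injective f1) {m : ℕ}
    (h1 : HZ (tZ G1) (m+1)) (h2 : HZ (tZ G2) (m+1)) {Q : Type} [AddCommGroup Q]
    (α : Zn (tZ H) m →+ Q)
    (hs : ∀ q, ∃ x : Zn (tZ H) m, tm f1 m x ∈ Bn (tZ G1) m ∧ tm f2 m x ∈ Bn (tZ G2) m ∧ α x = q)
    (hk : ∀ x : Zn (tZ H) m, tm f1 m x ∈ Bn (tZ G1) m → tm f2 m x ∈ Bn (tZ G2) m →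
      (α x = 0 ↔ (x : Ch H ℤ m) ∈ Bn (tZ H) m)) :
    Nonempty (Hom (tZ G) (m+1) ≃+ Q) := by
  have S := A.ses.1
  have s0 := shap_coset (j1.comp f1) (A.inj1.comp hf1)
  have s1 := shap_coset j1 A.inj1
  have s2 := shap_coset j2 A.inj2
  have hI : HZ (prodRep (indRep (cosetAct j1.range) (tZ G))
      (indRep (cosetAct j2.range) (tZ G))) (m+1) := prod_HZ (s1.HZ h1) (s2.HZ h2)
  let e0 : ℤ →+ (G ⧸ (j1.comp f1).range →₀ ℤ) :=
    Finsupp.singleAddHom ((1 : G) : G ⧸ (j1.comp f1).range)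
  let F := cm (j1.comp f1) e0 m
  have hF : ∀ x, cm (MonoidHom.id G) ((pr (j1.comp f1).range j1.range).prod
      (pr (j1.comp f1).range j2.range)) m (F x) ∈ Bn (prodRep (indRep (cosetAct j1.range) (tZ G))
      (indRep (cosetAct j2.range) (tZ G))) m ↔
      cm j1 (Finsupp.singleAddHom ((1 : G) : G ⧸ j1.range)) m (tm f1 m x) ∈
        Bn (indRep (cosetAct j1.range) (tZ G)) m ∧
      cm j2 (Finsupp.singleAddHom ((1 : G) : G ⧸ j2.range)) m (tm f2 m x) ∈
        Bn (indRep (cosetAct j2.range) (tZ G)) m := by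
    intro x
    rw [prod_B]
    have e1 : cm (MonoidHom.id G) (AddMonoidHom.fst _ _) m (cm (MonoidHom.id G)
        ((pr (j1.comp f1).range j1.range).prod (pr (j1.comp f1).range j2.range)) m (F x)) =
        cm j1 (Finsupp.singleAddHom ((1 : G) : G ⧸ j1.range)) m (tm f1 m x) := by
      simp only [F, cm_cm]
      congr 2
      ext
      simp [e0, pr_single _ _ A.le1]
    have e2 : cm (MonoidHom.id G) (AddMonoidHom.snd _ _) m (cm (MonoidHom.id G)
        ((pr (j1.comp f1).range j1.range).prod (pr (j1.comp f1).range j2.range)) m (F x)) =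
        cm j2 (Finsupp.singleAddHom ((1 : G) : G ⧸ j2.range)) m (tm f2 m x) := by
      simp only [F, cm_cm]
      congr 2
      · ext h; exact A.comm h
      · ext
        simp [e0, pr_single _ _ A.le2]
    rw [e1, e2]
  refine rel_iso _ _ (fun z q => ∃ x : Zn (tZ H) m, dRel (prodRep
      (indRep (cosetAct j1.range) (tZ G)) (indRep (cosetAct j2.range) (tZ G)))
      ((pr (j1.comp f1).range j1.range).prod (pr (j1.comp f1).range j2.range))
      ((sm _ ℤ).comp (AddMonoidHom.fst _ _) - (sm _ ℤ).comp (AddMonoidHom.snd _ _)) m z (F x) ∧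
      α x = q) ?_ ?_ ?_ ?_
  · rintro z z' q q' ⟨x, hx, rfl⟩ ⟨x', hx', rfl⟩
    refine ⟨x - x', ?_, map_sub _ _ _⟩
    have := hx.sub hx'
    rwa [← map_sub] at this
  · intro z hz
    obtain ⟨w, hw, hr⟩ := S.rel_ex hz
    obtain ⟨x, hx, hd⟩ := (shapiro s0 m (tZ G)).2 w hw
    exact ⟨_, ⟨x, hx⟩, hr.adjust S hd, rfl⟩
  · intro q
    obtain ⟨x, hx1, hx2, rfl⟩ := hs q
    obtain ⟨z, hz, hr⟩ := S.rel_ex' ((hF x).2 ⟨cm_mem_B (s1.eqv (tZ G)) hx1,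
      cm_mem_B (s2.eqv (tZ G)) hx2⟩)
    exact ⟨z, hz, x, hr, rfl⟩
  · rintro z hz q ⟨x, hr, rfl⟩
    have hb := (hF x).1 (S.rel_B_mid hr)
    have hb1 := (shapiro s1 m (tZ G)).1 _ (tm_Z f1 x.2) hb.1
    have hb2 := (shapiro s2 m (tZ G)).1 _ (tm_Z f2 x.2) hb.2
    rw [hk x hb1 hb2]
    constructor
    · intro h
      exact (shapiro s0 m (tZ G)).1 _ x.2 (S.rel_B_right hr h)
    · intro h
      exact S.rel_B_left hI hr (cm_mem_B (s0.eqv (tZ G)) h)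

/-- amalgams of acyclic groups are suspensions -/
theorem Amal.susp (A : Amal f1 f2 j1 j2) (hf1 : Function.Injective f1)
    (h1 : ∀ n, HZ (tZ G1) (n+1)) (h2 : ∀ n, HZ (tZ G2) (n+1)) (m : ℕ) :
    Nonempty (Hom (tZ G) (m+2) ≃+ Hom (tZ H) (m+1)) := by
  refine A.mv hf1 (h1 _) (h2 _) (QuotientAddGroup.mk' _) ?_ ?_
  · intro q
    obtain ⟨x, rfl⟩ := QuotientAddGroup.mk'_surjective _ q
    exact ⟨x, h1 _ _ (tm_Z _ x.2), h2 _ _ (tm_Z _ x.2), rfl⟩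
  · intro x _ _
    rw [QuotientAddGroup.mk'_apply, QuotientAddGroup.eq_zero_iff, AddSubgroup.mem_addSubgroupOf]

theorem Amal.perf (A : Amal f1 f2 j1 j2) (h1 : Perf G1) (h2 : Perf G2) : Perf G := by
  intro D _ χ hχ g
  let c : G →* Multiplicative D := MonoidHom.mk' (fun g => Multiplicative.ofAdd (χ g))
    (fun a b => by rw [hχ]; rfl)
  have : c.ker = ⊤ := by
    refine A.gen _ (fun x => ?_) (fun x => ?_)
    · rw [MonoidHom.mem_ker]
      exact h1 D _ (fun x => χ (j1 x)) (fun a b => by rw [map_mul, hχ]) x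
    · rw [MonoidHom.mem_ker]
      exact h2 D _ (fun x => χ (j2 x)) (fun a b => by rw [map_mul, hχ]) x
  have h3 : g ∈ c.ker := by rw [this]; trivial
  exact h3

end mv
end RH

namespace RH

/-- subgroups of free abelian groups are free -/
theorem free_sub (X : Type) (K : AddSubgroup (X →₀ ℤ)) :
    ∃ (Y : Type) (T : (Y →₀ ℤ) →+ (X →₀ ℤ)), Function.Injective T ∧ T.range = K := by
  classical
  let _ : LinearOrder X := linearOrderOfSTO (WellOrderingRel (α := X))
  have wf : WellFounded (fun a b : X => a < b) := (WellOrderingRel.isWellOrder (α := X)).wf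
  let Kx : X → AddSubgroup (X →₀ ℤ) := fun x =>
    { carrier := {f | f ∈ K ∧ ∀ y, x < y → f y = 0}
      zero_mem' := ⟨zero_mem _, fun _ _ => rfl⟩
      add_mem' := fun {f g} hf hg => ⟨add_mem hf.1 hg.1, fun y hy => by
        rw [Finsupp.add_apply, hf.2 y hy, hg.2 y hy, add_zero]⟩
      neg_mem' := fun {f} hf => ⟨neg_mem hf.1, fun y hy => by
        rw [Finsupp.neg_apply, hf.2 y hy, neg_zero]⟩ }
  have hd : ∀ x, ∃ d : ℤ, (Kx x).map (Finsupp.applyAddHom x : (X →₀ ℤ) →+ ℤ) =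
      AddSubgroup.zmultiples d := by
    intro x
    obtain ⟨d, hd⟩ := Int.subgroup_cyclic ((Kx x).map (Finsupp.applyAddHom x : (X →₀ ℤ) →+ ℤ))
    exact ⟨d, by rw [hd, AddSubgroup.zmultiples_eq_closure]⟩
  choose d hd using hd
  have hb : ∀ x, ∃ b, b ∈ Kx x ∧ b x = d x := by
    intro x
    have : d x ∈ (Kx x).map (Finsupp.applyAddHom x : (X →₀ ℤ) →+ ℤ) := by
      rw [hd]; exact AddSubgroup.mem_zmultiples _
    exact this
  choose b hbK hbd using hb
  let Y := {x : X // d x ≠ 0}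
  let T : (Y →₀ ℤ) →+ (X →₀ ℤ) := Finsupp.liftAddHom fun y => zmultiplesHom _ (b y.1)
  have hT : ∀ l : Y →₀ ℤ, T l = l.sum fun y n => n • b y.1 := by
    intro l; rfl
  refine ⟨Y, T, ?_, ?_⟩
  · rw [injective_iff_map_eq_zero]
    intro l hl
    by_contra hne
    have hs : l.support.Nonempty := Finsupp.support_nonempty_iff.2 hne
    obtain ⟨y, hy, hmax⟩ := l.support.exists_max_image (fun y => y.1) hs
    have h0 : T l y.1 = l y * d y.1 := by
      rw [hT, Finsupp.sum, Finsupp.finsetSum_apply, Finset.sum_eq_single y]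
      · simp [hbd]
      · intro z hz hzy
        have : z.1 < y.1 := lt_of_le_of_ne (hmax z hz) (fun h => hzy (Subtype.ext h))
        simp [(hbK z.1).2 _ this]
      · intro h; exact absurd hy h
    rw [hl] at h0
    have := mul_ne_zero (Finsupp.mem_support_iff.1 hy) y.2
    exact this h0.symm
  · apply le_antisymm
    · rintro _ ⟨l, rfl⟩
      rw [hT]
      exact AddSubgroup.sum_mem _ fun y _ => AddSubgroup.zsmul_mem _ (hbK y.1).1 _
    · have key : ∀ x, ∀ f ∈ Kx x, f ∈ T.range := by
        intro x
        induction x using wf.induction with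
        | _ x ih =>
          intro f hf
          have hfx : f x ∈ (Kx x).map (Finsupp.applyAddHom x : (X →₀ ℤ) →+ ℤ) := ⟨f, hf, rfl⟩
          rw [hd, AddSubgroup.mem_zmultiples_iff] at hfx
          obtain ⟨c, hc⟩ := hfx
          have hlt : ∀ g ∈ Kx x, g x = 0 → g ∈ T.range := by
            intro g hg hgx
            by_cases h0 : g = 0
            · subst h0; exact zero_mem _
            obtain ⟨y, hy, hmax⟩ := g.support.exists_max_image id (Finsupp.support_nonempty_iff.2 h0)
            have hy0 := Finsupp.mem_support_iff.1 hy
            have hyx : y < x := by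
              rcases lt_trichotomy y x with h | h | h
              · exact h
              · exact absurd (h ▸ hgx) hy0
              · exact absurd (hg.2 y h) hy0
            refine ih y hyx g ⟨hg.1, fun z hz => ?_⟩
            by_contra hne
            exact absurd (hmax z (Finsupp.mem_support_iff.2 hne)) (not_le.2 hz)
          by_cases h0 : d x = 0
          · exact hlt f hf (by rw [← hc, h0, smul_zero])
          · have h1 : c • b x ∈ T.range := by
              have : b x ∈ T.range := ⟨Finsupp.single (⟨x, h0⟩ : Y) 1, by simp [T]⟩
              exact AddSubgroup.zsmul_mem _ this _
            have h2 := hlt (f - c • b x) (sub_mem hf (AddSubgroup.zsmul_mem _ (hbK x) _)) (by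
              simp [hbd, ← hc])
            have := add_mem h2 h1
            rwa [sub_add_cancel] at this
      intro f hf
      by_cases h0 : f = 0
      · subst h0; exact zero_mem _
      obtain ⟨x, hx, hmax⟩ := f.support.exists_max_image id (Finsupp.support_nonempty_iff.2 h0)
      refine key x f ⟨hf, fun y hy => ?_⟩
      by_contra hne
      exact absurd (hmax y (Finsupp.mem_support_iff.2 hne)) (not_le.2 hy)

end RH

namespace RH

section seq
variable (H : ℕ → Type) [∀ i, Group (H i)] (j : ∀ i, H i →* H (i+1))

/-- transition maps -/
def trans (i k : ℕ) (h : i ≤ k) : H i →* H k :=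
  Nat.leRecOn (C := fun k => H i →* H k) h (fun {k} g => (j k).comp g) (MonoidHom.id _)

theorem trans_self (i : ℕ) : trans H j i i le_rfl = MonoidHom.id _ := Nat.leRecOn_self _

theorem trans_succ (i k : ℕ) (h : i ≤ k) :
    trans H j i (k+1) (h.trans (Nat.le_succ k)) = (j k).comp (trans H j i k h) :=
  Nat.leRecOn_succ h _

theorem trans_trans (i k l : ℕ) (h : i ≤ k) (h' : k ≤ l) (x : H i) :
    trans H j k l h' (trans H j i k h x) = trans H j i l (h.trans h') x := by
  induction l, h' using Nat.le_induction with
  | base => rw [trans_self]; rfl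
  | succ l hl ih =>
    rw [trans_succ _ _ _ _ hl, trans_succ _ _ _ _ (h.trans hl)]
    exact congrArg (j l) ih

theorem trans_inj (hj : ∀ i, Function.Injective (j i)) (i k : ℕ) (h : i ≤ k) :
    Function.Injective (trans H j i k h) := by
  induction k, h using Nat.le_induction with
  | base => rw [trans_self]; exact Function.injective_id
  | succ l hl ih =>
    rw [trans_succ _ _ _ _ hl]
    exact (hj l).comp ih

theorem exists_seqlim (hj : ∀ i, Function.Injective (j i)) :
    ∃ (E : Type) (_ : Group E) (c : ∀ i, H i →* E), (∀ i, Function.Injective (c i)) ∧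
      (∀ i h, c (i+1) (j i h) = c i h) ∧ ∀ g, ∃ i h, c i h = g := by
  let f := trans H j
  have : DirectedSystem H (f · · ·) := ⟨fun i x => by
      change trans H j i i _ x = x
      rw [trans_self]; rfl,
    fun {k i l} hij hjk x => trans_trans H j _ _ _ hij hjk x⟩
  refine ⟨DirectLimit H f, inferInstance, fun i => MonoidHom.mk' (fun x => ⟦⟨i, x⟩⟧)
    (fun x y => (DirectLimit.mul_def (f := f) i x y).symm), ?_, ?_, ?_⟩
  · intro i
    exact DirectLimit.mk_injective f (trans_inj H j hj) i
  · intro i h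
    change (⟦⟨i+1, j i h⟩⟧ : DirectLimit H f) = ⟦⟨i, h⟩⟧
    have := DirectLimit.mk_apply (f := f) i (i+1) h (Nat.le_succ i)
    rw [← this]
    have h2 : f i (i+1) (Nat.le_succ i) h = j i h := by
      have := trans_succ H j i i le_rfl
      rw [trans_self] at this
      exact congrArg (fun g => g h) this
    rw [h2]
  · intro g
    obtain ⟨i, x, rfl⟩ := DirectLimit.exists_eq_mk f g
    exact ⟨i, x, rfl⟩

end seq
end RH

namespace RH

/-- the set acted upon at the next stage -/
abbrev Om (H : Type) := H × H × List (H × ℤ) × Bool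

section step
variable {A H : Type} [CommGroup A] [Group H] (ι : A →* H)

/-- translation -/
def Tr (a : A) (ω : Om H) : Om H := (ι a * ω.1, ω.2)

/-- equivariant permutations -/
def Nx : Subgroup (Equiv.Perm (Om H)) where
  carrier := {σ | ∀ a ω, σ (Tr ι a ω) = Tr ι a (σ ω)}
  one_mem' := fun _ _ => rfl
  mul_mem' := fun {σ τ} hσ hτ a ω => by
    rw [Equiv.Perm.mul_apply, hτ, hσ, Equiv.Perm.mul_apply]
  inv_mem' := fun {σ} hσ a ω => by
    apply σ.injective
    rw [hσ]; simp

theorem mem_Nx {σ : Equiv.Perm (Om H)} : σ ∈ Nx ι ↔ ∀ a ω, σ (Tr ι a ω) = Tr ι a (σ ω) := Iff.rfl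

/-- left multiplication on the first coordinate -/
def jP : H →* Equiv.Perm (Om H) where
  toFun h := Equiv.prodCongr (Equiv.mulLeft h) (Equiv.refl _)
  map_one' := by ext1 ω; simp
  map_mul' g h := by ext1 ω; simp [mul_assoc, Prod.map]

theorem jP_apply (h : H) (ω : Om H) : jP h ω = (h * ω.1, ω.2) := rfl

/-- left multiplication on the second coordinate -/
def phP : H →* Equiv.Perm (Om H) where
  toFun h := Equiv.prodCongr (Equiv.refl _) (Equiv.prodCongr (Equiv.mulLeft h) (Equiv.refl _))
  map_one' := by ext1 ω; simp
  map_mul' g h := by ext1 ω; simp [mul_assoc, Prod.map]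

theorem phP_apply (h : H) (ω : Om H) : phP h ω = (ω.1, h * ω.2.1, ω.2.2) := rfl

/-- the intertwiner -/
def uP : Equiv.Perm (Om H) where
  toFun ω := (ω.2.1 * ω.1, ω.2)
  invFun ω := (ω.2.1⁻¹ * ω.1, ω.2)
  left_inv ω := by simp
  right_inv ω := by simp


theorem jP_mem (hc : ∀ a h, ι a * h = h * ι a) (h : H) : jP h ∈ Nx ι := fun a ω => by
  simp [jP_apply, Tr, ← mul_assoc, hc]

theorem phP_mem (hc : ∀ a h, ι a * h = h * ι a) (h : H) : phP h ∈ Nx ι := fun _ _ => rfl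

theorem uP_mem (hc : ∀ a h, ι a * h = h * ι a) : uP ∈ Nx ι := fun a ω => by
  simp [uP, Tr, ← mul_assoc, hc]

/-- embedding into the next stage -/
def jN (hc : ∀ a h, ι a * h = h * ι a) : H →* Nx ι := jP.codRestrict (Nx ι) (jP_mem ι hc)

/-- second embedding into the next stage -/
def phN (hc : ∀ a h, ι a * h = h * ι a) : H →* Nx ι := phP.codRestrict (Nx ι) (phP_mem ι hc)

/-- the intertwiner -/
def uN (hc : ∀ a h, ι a * h = h * ι a) : Nx ι := ⟨uP, uP_mem ι hc⟩

theorem jN_inj (hc : ∀ a h, ι a * h = h * ι a) : Function.Injective (jN ι hc) := by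
  intro g h e
  have := congrArg (fun σ : Nx ι => (σ.1 (1, 1, [], true)).1) e
  simpa [jN, jP_apply] using this

theorem jN_comm (hc : ∀ a h, ι a * h = h * ι a) (g h : H) : Commute (jN ι hc g) (phN ι hc h) := by
  apply Subtype.ext
  ext1 ω
  rfl

theorem uN_conj (hc : ∀ a h, ι a * h = h * ι a) (h : H) : uN ι hc * phN ι hc h * (uN ι hc)⁻¹ = jN ι hc h * phN ι hc h := by
  rw [mul_inv_eq_iff_eq_mul]
  apply Subtype.ext
  ext1 ω
  change (h * ω.2.1 * ω.1, h * ω.2.1, ω.2.2) = (h * (ω.2.1 * ω.1), h * ω.2.1, ω.2.2)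
  rw [mul_assoc]

theorem jN_cen (hc : ∀ a h, ι a * h = h * ι a) (a : A) (σ : Nx ι) : jN ι hc (ι a) * σ = σ * jN ι hc (ι a) := by
  apply Subtype.ext
  ext1 ω
  exact (σ.2 a ω).symm

theorem jN_center (hc : ∀ a h, ι a * h = h * ι a) (z : H) (hz : ∀ σ, jN ι hc z * σ = σ * jN ι hc z) : z ∈ ι.range := by
  classical
  have hr : ∀ a (x : H), ι a * x ∈ ι.range ↔ x ∈ ι.range := fun a x =>
    Subgroup.mul_mem_cancel_left _ ⟨a, rfl⟩
  let t : Equiv.Perm (Om H) := Function.Involutive.toPerm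
    (fun ω => (ω.1, ω.2.1, ω.2.2.1, xor ω.2.2.2 (decide (ω.1 ∈ ι.range)))) (fun ω => by simp)
  have ht : t ∈ Nx ι := fun a ω => by
    change (ι a * ω.1, ω.2.1, ω.2.2.1, xor ω.2.2.2 (decide (ι a * ω.1 ∈ ι.range))) =
      (ι a * ω.1, ω.2.1, ω.2.2.1, xor ω.2.2.2 (decide (ω.1 ∈ ι.range)))
    simp only [hr]
  have := congrArg (fun σ : Nx ι => (σ.1 (1, 1, [], false)).2.2.2) (hz ⟨t, ht⟩)
  change xor false (decide ((1 : H) ∈ ι.range)) = xor false (decide (z * 1 ∈ ι.range)) at this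
  rw [mul_one, decide_eq_true (one_mem _)] at this
  simpa using this

theorem comm_mem (hc : ∀ a h, ι a * h = h * ι a) {N : Subgroup (Nx ι)} [N.Normal] {g : H} (hg : g ∉ ι.range)
    (hN : jN ι hc g ∈ N) (κ v : Nx ι)
    (hκ : ∀ ω, (ω.1 ∈ ι.range → ω.2.2.2 = true) → κ.1 ω = ω)
    (hv : ∀ ω, (ω.1 ∈ ι.range → ω.2.2.2 = true) → v.1 ω = ω) : κ * v * κ⁻¹ * v⁻¹ ∈ N := by
  set y := jN ι hc g with hy
  have hcomm : Commute κ (y * v⁻¹ * y⁻¹) := by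
    have : Equiv.Perm.Disjoint κ.1 (y * v⁻¹ * y⁻¹ : Nx ι).1 := by
      intro ω
      by_cases h : ω.1 ∈ ι.range → ω.2.2.2 = true
      · exact Or.inl (hκ ω h)
      · right
        push Not at h
        change y.1 (v.1⁻¹ ((y.1)⁻¹ ω)) = ω
        have h1 : (y.1)⁻¹ ω = (g⁻¹ * ω.1, ω.2) := by
          rw [Equiv.Perm.inv_eq_iff_eq]
          simp [hy, jN, jP_apply]
        have h2 : v.1⁻¹ (g⁻¹ * ω.1, ω.2) = (g⁻¹ * ω.1, ω.2) := by
          rw [Equiv.Perm.inv_eq_iff_eq, hv]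
          intro h3
          exfalso
          apply hg
          have := (Subgroup.mul_mem_cancel_right _ h.1).1 h3
          simpa using this
        rw [h1, h2]
        simp [hy, jN, jP_apply]
    exact Subtype.ext this.commute.eq
  have hw : v * (y * v⁻¹ * y⁻¹) ∈ N := by
    have h1 := N.mul_mem (‹N.Normal›.conj_mem _ hN v) (N.inv_mem hN)
    simpa [mul_assoc] using h1
  have h2 := N.mul_mem (‹N.Normal›.conj_mem _ hw κ) (N.inv_mem hw)
  convert h2 using 1
  have h3 : (y * v⁻¹ * y⁻¹) * κ⁻¹ = κ⁻¹ * (y * v⁻¹ * y⁻¹) := hcomm.symm.inv_right.eq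
  rw [mul_inv_rev]
  calc κ * v * κ⁻¹ * v⁻¹ = κ * v * (κ⁻¹ * (y * v⁻¹ * y⁻¹)) * ((y * v⁻¹ * y⁻¹)⁻¹ * v⁻¹) := by group
    _ = _ := by rw [← h3]; simp only [mul_assoc]

end step
end RH

namespace RH

section step2
variable {A H : Type} [CommGroup A] [Group H] (ι : A →* H)

/-- the parameter space -/
abbrev Om0 (H : Type) := (H × H × List (H × ℤ)) × Option ℤ

/-- coset representative -/
noncomputable def sec (x : H) : H := Quotient.out (x : H ⧸ ι.range)

theorem sec_mem (x : H) : (sec ι x)⁻¹ * x ∈ ι.range := by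
  rw [← QuotientGroup.eq]
  exact Quotient.out_eq _

/-- the embedding used for commutators -/
noncomputable def psi : Om0 H → Om H
  | (w, some n) => ((sec ι w.1)⁻¹ * w.1, w.2.1, (sec ι w.1, n) :: w.2.2, false)
  | (w, none) => (w.1, w.2.1, w.2.2, true)

theorem psi_inj : Function.Injective (psi ι) := by
  rintro ⟨⟨x, y, l⟩, o⟩ ⟨⟨x', y', l'⟩, o'⟩ h
  cases o <;> cases o' <;> simp [psi] at h ⊢
  · exact h
  · obtain ⟨h1, h2, ⟨h3, h4⟩, h5⟩ := h
    rw [h3] at h1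
    exact ⟨⟨mul_left_cancel h1, h2, h5⟩, h4⟩

/-- translation on parameters -/
def Tr0 (a : A) (p : Om0 H) : Om0 H := ((ι a * p.1.1, p.1.2), p.2)

/-- transport of permutations -/
noncomputable def lft : Equiv.Perm (Om0 H) →* Equiv.Perm (Om H) :=
  Equiv.Perm.viaEmbeddingHom ⟨psi ι, psi_inj ι⟩

theorem lft_psi (π : Equiv.Perm (Om0 H)) (p) : lft ι π (psi ι p) = psi ι (π p) :=
  Equiv.Perm.viaEmbedding_apply π ⟨psi ι, psi_inj ι⟩ p

theorem lft_not (π : Equiv.Perm (Om0 H)) (ω) (h : ∀ p, psi ι p ≠ ω) : lft ι π ω = ω :=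
  Equiv.Perm.viaEmbedding_apply_of_notMem π ⟨psi ι, psi_inj ι⟩ ω (by rintro ⟨p, hp⟩; exact h p hp)

/-- fibrewise permutations -/
def fib (σ : Option ℤ → Equiv.Perm (H × H × List (H × ℤ))) : Equiv.Perm (Om0 H) where
  toFun p := (σ p.2 p.1, p.2)
  invFun p := ((σ p.2)⁻¹ p.1, p.2)
  left_inv p := by simp
  right_inv p := by simp

/-- the intertwiner on the parameter space -/
def k0 : Equiv.Perm (H × H × List (H × ℤ)) where
  toFun ω := (ω.2.1 * ω.1, ω.2)
  invFun ω := (ω.2.1⁻¹ * ω.1, ω.2)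
  left_inv ω := by simp
  right_inv ω := by simp

theorem k0_tr (hc : ∀ a h, ι a * h = h * ι a) (a : A) (w : H × H × List (H × ℤ)) :
    (k0 (ι a * w.1, w.2) : H × H × List (H × ℤ)) = (ι a * (k0 w).1, (k0 w).2) := by
  simp [k0, ← mul_assoc, hc]

/-- half-infinite repetition of the intertwiner -/
def kap : Equiv.Perm (Om0 H) := fib fun o => match o with
  | none => 1
  | some n => if 0 ≤ n then k0 else 1

/-- shift -/
def shf : Equiv.Perm (Om0 H) :=
  Equiv.prodCongr (Equiv.refl _) (Equiv.optionCongr (Equiv.addRight 1))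

/-- swap -/
def tau : Equiv.Perm (Om0 H) := Equiv.prodCongr (Equiv.refl _) (Equiv.swap none (some 0))

/-- the intertwiner on a single fibre -/
def pi1 : Equiv.Perm (Om0 H) := fib fun o => match o with
  | none => k0
  | some _ => 1

theorem tau_comm : tau * (kap * shf * kap⁻¹ * shf⁻¹) * tau⁻¹ = (pi1 : Equiv.Perm (Om0 H)) := by
  have h : tau * kap * shf = (pi1 * tau * shf * kap : Equiv.Perm (Om0 H)) := by
    ext1 p
    rcases p with ⟨w, _ | n⟩
    · simp [tau, kap, shf, pi1, fib]
    · have h1 : (shf (w, some n) : Om0 H) = (w, some (n+1)) := rfl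
      simp only [Equiv.Perm.mul_apply, h1]
      by_cases h0 : 0 ≤ n
      · have h2 : ¬ (n + 1 = 0) := by omega
        have h3 : 0 ≤ n + 1 := by omega
        simp [tau, kap, shf, pi1, fib, h0, h3, Equiv.swap_apply_def, h2]
      · by_cases h2 : n + 1 = 0
        · simp [tau, kap, shf, pi1, fib, h0, h2]
        · have h3 : ¬ (0 ≤ n + 1) := by omega
          simp [tau, kap, shf, pi1, fib, h0, h3, Equiv.swap_apply_def, h2]
  rw [mul_inv_eq_iff_eq_mul, ← mul_assoc, mul_inv_eq_iff_eq_mul, ← mul_assoc,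
    mul_inv_eq_iff_eq_mul, ← mul_assoc, h]


theorem sec_tr (hc : ∀ a h, ι a * h = h * ι a) (a : A) (x : H) : sec ι (ι a * x) = sec ι x := by
  unfold sec
  congr 1
  rw [hc, eq_comm, QuotientGroup.eq]
  simp

theorem psi_tr (hc : ∀ a h, ι a * h = h * ι a) (a : A) (p : Om0 H) : psi ι (Tr0 ι a p) = Tr ι a (psi ι p) := by
  rcases p with ⟨⟨x, y, l⟩, _ | n⟩
  · rfl
  · simp only [psi, Tr0, Tr, sec_tr ι hc]
    rw [← mul_assoc, ← hc, mul_assoc]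

theorem lft_mem (hc : ∀ a h, ι a * h = h * ι a) (π : Equiv.Perm (Om0 H)) (hπ : ∀ a p, π (Tr0 ι a p) = Tr0 ι a (π p)) :
    lft ι π ∈ Nx ι := by
  intro a ω
  by_cases h : ∃ p, psi ι p = ω
  · obtain ⟨p, rfl⟩ := h
    rw [← psi_tr ι hc, lft_psi, lft_psi, hπ, psi_tr ι hc]
  · push Not at h
    rw [lft_not _ _ _ h, lft_not]
    intro p hp
    apply h (Tr0 ι a⁻¹ p)
    rw [psi_tr ι hc, hp]
    simp [Tr]

theorem lft_supp (hc : ∀ a h, ι a * h = h * ι a) (π : Equiv.Perm (Om0 H)) (hπ : ∀ w, π (w, none) = (w, none)) (ω : Om H)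
    (hω : ω.1 ∈ ι.range → ω.2.2.2 = true) : lft ι π ω = ω := by
  by_cases h : ∃ p, psi ι p = ω
  · obtain ⟨⟨w, _ | n⟩, rfl⟩ := h
    · rw [lft_psi, hπ]
    · exact absurd (hω (sec_mem ι _)) (by simp [psi])
  · push Not at h
    exact lft_not _ _ _ h


theorem jN_normal (hc : ∀ a h, ι a * h = h * ι a) {N : Subgroup (Nx ι)} [hN' : N.Normal] {g : H} (hg : g ∉ ι.range)
    (hN : jN ι hc g ∈ N) (h : H) : jN ι hc h ∈ N := by
  have e1 : ∀ a p, (kap (Tr0 ι a p) : Om0 H) = Tr0 ι a (kap p) := by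
    rintro a ⟨w, _ | n⟩
    · rfl
    · by_cases h0 : 0 ≤ n
      · have := k0_tr ι hc a w
        simp only [kap, fib, Tr0, Equiv.coe_fn_mk, h0, if_true, this]
      · simp [kap, fib, Tr0, h0]
  have e2 : ∀ a p, (shf (Tr0 ι a p) : Om0 H) = Tr0 ι a (shf p) := fun a p => rfl
  have e3 : ∀ a p, (tau (Tr0 ι a p) : Om0 H) = Tr0 ι a (tau p) := fun a p => rfl
  let K : Nx ι := ⟨lft ι kap, lft_mem ι hc _ e1⟩
  let V : Nx ι := ⟨lft ι shf, lft_mem ι hc _ e2⟩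
  let Θ : Nx ι := ⟨lft ι tau, lft_mem ι hc _ e3⟩
  have hK := comm_mem ι hc hg hN K V (lft_supp ι hc _ fun _ => rfl) (lft_supp ι hc _ fun _ => rfl)
  obtain ⟨U1, hU1, hU1v⟩ : ∃ U1 ∈ N, U1.1 = lft ι pi1 := by
    refine ⟨_, hN'.conj_mem _ hK Θ, ?_⟩
    have h2 := congrArg (lft ι) (tau_comm (H := H))
    simp only [map_mul, map_inv] at h2
    exact h2
  let nt : Equiv.Perm (Om H) := Function.Involutive.toPerm
    (fun ω => (ω.1, ω.2.1, ω.2.2.1, !ω.2.2.2)) (fun ω => by simp)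
  let ν : Nx ι := ⟨nt, fun _ _ => rfl⟩
  have hu : uN ι hc = U1 * (ν * U1 * ν⁻¹) := by
    have hν : ν⁻¹ = ν := by
      rw [inv_eq_iff_mul_eq_one]
      apply Subtype.ext
      ext1 ω
      change ((ω.1, ω.2.1, ω.2.2.1, !!ω.2.2.2) : Om H) = ω
      simp
    have ht : ∀ x y l, U1.1 (x, y, l, true) = (y * x, y, l, true) := fun x y l => by
      rw [hU1v]
      exact lft_psi ι pi1 ((x, y, l), none)
    have hf : ∀ x y l, U1.1 (x, y, l, false) = (x, y, l, false) := fun x y l => by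
      rw [hU1v]
      by_cases h : ∃ p, psi ι p = (x, y, l, false)
      · obtain ⟨⟨w, _ | n⟩, hp⟩ := h
        · simp [psi] at hp
        · rw [← hp, lft_psi]; rfl
      · push Not at h
        exact lft_not _ _ _ h
    rw [hν]
    apply Subtype.ext
    ext1 ⟨x, y, l, b⟩
    change ((y * x, y, l, b) : Om H) = U1.1 (nt (U1.1 (x, y, l, !b)))
    cases b
    · change _ = U1.1 (nt (U1.1 (x, y, l, true)))
      rw [ht]
      exact (hf _ _ _).symm
    · change _ = U1.1 (nt (U1.1 (x, y, l, false)))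
      rw [hf]
      exact (ht _ _ _).symm
  have huN : uN ι hc ∈ N := by
    rw [hu]
    exact N.mul_mem hU1 (hN'.conj_mem _ hU1 _)
  have h1 := uN_conj ι hc h
  have h2 : jN ι hc h = uN ι hc * (phN ι hc h * (uN ι hc)⁻¹ * (phN ι hc h)⁻¹) := by
    rw [← mul_assoc, ← mul_assoc, h1]; group
  rw [h2]
  exact N.mul_mem huN (hN'.conj_mem _ (N.inv_mem huN) _)

end step2
end RH

namespace RH

/-- stages -/
structure Stg (A : Type) [CommGroup A] where
  H : Type
  grp : Group H
  ι : A →* H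
  inj : Function.Injective ι
  cen : ∀ a h, ι a * h = h * ι a

instance {A : Type} [CommGroup A] (S : Stg A) : Group S.H := S.grp

/-- next stage -/
def Stg.next {A : Type} [CommGroup A] (S : Stg A) : Stg A where
  H := Nx S.ι
  grp := inferInstance
  ι := (jN S.ι S.cen).comp S.ι
  inj := (jN_inj S.ι S.cen).comp S.inj
  cen := jN_cen S.ι S.cen

/-- iterated stages -/
def Stg.iter {A : Type} [CommGroup A] (S : Stg A) : ℕ → Stg A
  | 0 => S
  | n+1 => (S.iter n).next

theorem exists_E0 {A : Type} [CommGroup A] (S : Stg A) :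
    ∃ (E : Type) (_ : Group E) (c : S.H →* E), Function.Injective c ∧
      (∀ n, HZ (tZ E) (n+1)) ∧ (∀ g, g ∈ Subgroup.center E ↔ ∃ a, c (S.ι a) = g) ∧
      ∀ g, g ∉ Subgroup.center E → Subgroup.normalClosure {g} = ⊤ := by
  let j : ∀ i, (S.iter i).H →* (S.iter (i+1)).H := fun i => jN (S.iter i).ι (S.iter i).cen
  obtain ⟨E, _, c, hc, hcj, hex⟩ := exists_seqlim (fun i => (S.iter i).H) j
    (fun i => jN_inj _ _)
  obtain ⟨c', hc', hcj', hca⟩ : ∃ c' : ∀ i, Nx (S.iter i).ι →* E,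
      (∀ i, Function.Injective (c' i)) ∧
      (∀ i h, c' i (jN (S.iter i).ι (S.iter i).cen h) = c i h) ∧
      (∀ i a, c (i+1) ((S.iter (i+1)).ι a) =
        c' i (jN (S.iter i).ι (S.iter i).cen ((S.iter i).ι a))) :=
    ⟨fun i => c (i+1), fun i => hc (i+1), hcj, fun i a => rfl⟩
  have mono1 : ∀ i, (c i).range ≤ (c (i+1)).range := by
    rintro i _ ⟨h, rfl⟩
    exact ⟨_, hcj i h⟩
  have mono : Monotone fun i => (c i).range := monotone_nat_of_le_succ mono1
  have hι : ∀ i a, c i ((S.iter i).ι a) = c 0 (S.ι a) := by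
    intro i a
    induction i with
    | zero => rfl
    | succ i ih => rw [← ih, hca, hcj']
  have hcen : ∀ g, g ∈ Subgroup.center E ↔ ∃ a, c 0 (S.ι a) = g := by
    intro g
    rw [Subgroup.mem_center_iff]
    constructor
    · intro hg
      obtain ⟨i, h, rfl⟩ := hex g
      obtain ⟨a, ha⟩ := jN_center (S.iter i).ι (S.iter i).cen h (by
        intro σ
        apply hc' i
        rw [map_mul, map_mul, hcj']
        exact (hg (c' i σ)).symm)
      exact ⟨a, by rw [← hι i, ha]⟩
    · rintro ⟨a, rfl⟩ x
      obtain ⟨i, h, rfl⟩ := hex x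
      rw [← hι i, ← map_mul, ← map_mul, (S.iter i).cen]
  refine ⟨E, inferInstance, c 0, hc 0, fun n => ?_, hcen, fun g hg => ?_⟩
  · refine binate _ c hc mono1 (fun g => ?_)
      (fun i => (c' i).comp (phN (S.iter i).ι (S.iter i).cen)) (fun i h h' => ?_)
      (fun i => c' i (uN (S.iter i).ι (S.iter i).cen)) (fun i h => ?_) n
    · obtain ⟨i, h, rfl⟩ := hex g
      exact ⟨i, h, rfl⟩
    · rw [← hcj']
      exact (jN_comm (S.iter i).ι (S.iter i).cen h h').map (c' i)
    · rw [← hcj']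
      have := congrArg (c' i) (uN_conj (S.iter i).ι (S.iter i).cen h)
      rw [map_mul, map_mul, map_mul, map_inv] at this
      exact this
  · rw [eq_top_iff]
    rintro x -
    obtain ⟨i, h, hi⟩ := hex g
    obtain ⟨k, h', hk⟩ := hex x
    obtain ⟨p, hp⟩ := mono (le_max_left i k) ⟨h, hi⟩
    obtain ⟨q, hq⟩ := mono (le_max_right i k) ⟨h', hk⟩
    generalize max i k = m at p q hp hq
    have hpn : p ∉ (S.iter m).ι.range := by
      rintro ⟨a, rfl⟩
      exact hg ((hcen g).2 ⟨a, by rw [← hp, hι]⟩)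
    have h1 := jN_normal (S.iter m).ι (S.iter m).cen
      (N := (Subgroup.normalClosure {g}).comap (c' m)) hpn (by
        rw [Subgroup.mem_comap, hcj', hp]
        exact Subgroup.subset_normalClosure rfl) q
    rwa [Subgroup.mem_comap, hcj', hq] at h1

/-- a group with elements of all orders -/
abbrev Qg := ∀ n : ℕ, Multiplicative (ZMod n)

theorem Qg_order (n : ℕ) : ∃ q : Qg, orderOf q = n := by
  refine ⟨Pi.mulSingle n (Multiplicative.ofAdd 1), ?_⟩
  have h := orderOf_injective (MonoidHom.mulSingle (fun n => Multiplicative (ZMod n)) n)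
    (Pi.mulSingle_injective (M := fun n => Multiplicative (ZMod n)) n) (Multiplicative.ofAdd 1)
  rw [MonoidHom.mulSingle_apply] at h
  rw [h]
  rw [orderOf_ofAdd_eq_addOrderOf, ZMod.addOrderOf_one]

theorem exists_E (A P : Type) [CommGroup A] [Group P] :
    ∃ (E : Type) (_ : Group E) (c : A × P × Qg →* E), Function.Injective c ∧
      (∀ n, HZ (tZ E) (n+1)) ∧ (∀ g, g ∈ Subgroup.center E ↔ ∃ a, c (a, 1) = g) ∧
      ∀ g, g ∉ Subgroup.center E → Subgroup.normalClosure {g} = ⊤ :=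
  exists_E0 ⟨A × P × Qg, inferInstance, MonoidHom.inl A (P × Qg), fun _ _ h => congrArg Prod.fst h,
    fun a h => Prod.ext (mul_comm _ _) (by simp)⟩

/-- the simple acyclic case -/
structure Sa (P W : Type) [Group P] [Group W] (c : P →* W) : Prop where
  inj : Function.Injective c
  acy : ∀ n, HZ (tZ W) (n+1)
  cen : Subgroup.center W = ⊥
  nor : ∀ g : W, g ≠ 1 → Subgroup.normalClosure {g} = ⊤
  ord : ∀ n : ℕ, 2 ≤ n → ∃ g : W, orderOf g = n
  ne : ∃ w, w ∉ c.range
  inf : Infinite W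

theorem exists_W (P : Type) [Group P] : ∃ (W : Type) (_ : Group W) (c : P →* W), Sa P W c := by
  obtain ⟨E, _, c, hc, hacy, hcen, hnor⟩ := exists_E Unit P
  have hcb : Subgroup.center E = ⊥ := by
    rw [eq_bot_iff]
    intro g hg
    obtain ⟨a, rfl⟩ := (hcen g).1 hg
    exact map_one c
  let i : P →* Unit × P × Qg := (MonoidHom.inr _ _).comp (MonoidHom.inl _ _)
  let k : Qg →* E := c.comp ((MonoidHom.inr _ _).comp (MonoidHom.inr _ _))
  have hk : Function.Injective k := fun x y h => congrArg (fun p => p.2.2) (hc h)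
  refine ⟨E, inferInstance, c.comp i, ?_, hacy, hcb, ?_, ?_, ?_, ?_⟩
  · exact fun x y h => congrArg (fun p => p.2.1) (hc h)
  · intro g hg
    exact hnor g (by rwa [hcb, Subgroup.mem_bot])
  · intro n _
    obtain ⟨q, hq⟩ := Qg_order n
    exact ⟨k q, by rw [orderOf_injective k hk, hq]⟩
  · obtain ⟨q, hq⟩ := Qg_order 2
    refine ⟨k q, ?_⟩
    rintro ⟨p, hp⟩
    have : (1 : Qg) = q := congrArg (fun p => p.2.2) (hc hp)
    rw [← this, orderOf_one] at hq
    omega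
  · obtain ⟨q, hq⟩ := Qg_order 0
    have : Infinite (Subgroup.zpowers q) :=
      (infinite_zpowers.2 (orderOf_eq_zero_iff.1 hq)).to_subtype
    exact Infinite.of_injective (fun x : Subgroup.zpowers q => k x.1)
      (fun x y h => Subtype.ext (hk h))

end RH

namespace RH

theorem indRep_apply {G X : Type} [Group G] (a : G →* Equiv.Perm X) (g : G) (v : X →₀ ℤ) (x : X) :
    indRep a (tZ G) g v (a g x) = v x := by
  classical
  induction v using Finsupp.induction_linear with
  | zero => simp
  | add v w hv hw => simp only [map_add, Finsupp.add_apply, hv, hw]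
  | single y m => simp [Finsupp.single_apply]

theorem normal_top {G W : Type} [Group G] [Group W]
    (nor : ∀ g : W, g ≠ 1 → Subgroup.normalClosure {g} = ⊤) (j : W →* G) (N : Subgroup G) [N.Normal]
    {w : W} (hw : w ≠ 1) (h : j w ∈ N) (x : W) : j x ∈ N := by
  have h1 : Subgroup.normalClosure {w} ≤ N.comap j := by
    apply Subgroup.normalClosure_le_normal
    rintro _ rfl
    exact h
  rw [nor w hw] at h1
  exact h1 (show x ∈ ⊤ from trivial)

/-- simple infinite groups have no nontrivial finite orbits -/
theorem fixed_of_finite {W X : Type} [Group W] [Infinite W]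
    (nor : ∀ g : W, g ≠ 1 → Subgroup.normalClosure {g} = ⊤) (σ : W →* Equiv.Perm X)
    (s : Finset X) (hs : ∀ w x, x ∈ s → σ w x ∈ s) (w : W) (x : X) (hx : x ∈ s) : σ w x = x := by
  have hs' : ∀ w x, σ w x ∈ s ↔ x ∈ s := by
    intro w x
    refine ⟨fun h => ?_, hs w x⟩
    have := hs w⁻¹ _ h
    simpa using this
  let τ : W →* Equiv.Perm {x // x ∈ s} := MonoidHom.mk' (fun w => (σ w).subtypePerm (hs' w)) (by
    intro a b
    ext1 x
    apply Subtype.ext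
    change σ (a * b) x = σ a (σ b x)
    rw [map_mul]
    rfl)
  have hni : ¬ Function.Injective τ := by
    intro h
    exact not_finite_iff_infinite.2 ‹Infinite W› (Finite.of_injective τ h)
  have : ∃ k, τ k = 1 ∧ k ≠ 1 := by
    by_contra hcon
    push Not at hcon
    exact hni ((injective_iff_map_eq_one τ).2 hcon)
  obtain ⟨k, hk, hk1⟩ := this
  have h1 := normal_top nor τ ⊥ hk1 (by rw [hk]; exact one_mem _) w
  rw [Subgroup.mem_bot] at h1
  exact congrArg (fun π : Equiv.Perm {x // x ∈ s} => (π ⟨x, hx⟩).1) h1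

theorem susp_center {P W G : Type} [Group P] [Group W] [Group G] {c : P →* W} (S : Sa P W c)
    {j1 j2 : W →* G} (A : Amal c c j1 j2) : Subgroup.center G = ⊥ := by
  rw [eq_bot_iff]
  intro z hz
  rw [Subgroup.mem_center_iff] at hz
  obtain ⟨-, D, hD, hD1, hDp⟩ := A.ses
  have hinv : ∀ x, indRep (cosetAct (j1.comp c).range) (tZ G) (j1 x) (D z) = D z := by
    intro x
    have h1 := hD (j1 x) z
    have h2 := hD z (j1 x)
    rw [hz, h2, hD1, map_zero, add_zero, zero_add] at h1
    exact h1.symm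
  have := S.inf
  have hsupp : ∀ x q, q ∈ (D z).support → cosetAct (j1.comp c).range (j1 x) q ∈ (D z).support := by
    intro x q hq
    rw [Finsupp.mem_support_iff] at hq ⊢
    rw [← hinv x, indRep_apply]
    exact hq
  obtain ⟨r, hr1, -⟩ := A.lift W (MonoidHom.id W) (MonoidHom.id W) (fun _ => rfl)
  have h0 : D z = 0 := by
    by_contra hne
    obtain ⟨q, hq⟩ := Finsupp.support_nonempty_iff.2 hne
    obtain ⟨g, rfl⟩ := QuotientGroup.mk_surjective q
    obtain ⟨w, hw⟩ := S.ne
    apply hw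
    have hfix := fixed_of_finite S.nor ((cosetAct (j1.comp c).range).comp j1) (D z).support hsupp
      (r g * w⁻¹ * (r g)⁻¹) _ hq
    change ((j1 (r g * w⁻¹ * (r g)⁻¹) * g : G) : G ⧸ (j1.comp c).range) = _ at hfix
    rw [QuotientGroup.eq] at hfix
    obtain ⟨p, hp⟩ := hfix
    refine ⟨p, ?_⟩
    have := congrArg r hp
    simp only [MonoidHom.comp_apply, hr1, map_mul, map_inv, MonoidHom.id_apply] at this
    rw [this]
    group
  have h1 := hDp z
  rw [h0, map_zero, eq_comm, sub_eq_zero] at h1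
  have h2 := Finsupp.single_left_injective (one_ne_zero) h1
  rw [eq_comm, QuotientGroup.eq] at h2
  obtain ⟨w, hw⟩ := h2
  rw [inv_one, one_mul] at hw
  have hwc : w ∈ Subgroup.center W := by
    rw [Subgroup.mem_center_iff]
    intro x
    apply A.inj1
    rw [map_mul, map_mul, hw, hz]
  rw [S.cen, Subgroup.mem_bot] at hwc
  rw [Subgroup.mem_bot, ← hw, hwc, map_one]

theorem exists_susp (P : Type) [Group P] [Nontrivial P] : ∃ (T : Type) (_ : Group T),
    Perf T ∧ (∀ m, Nonempty (Hom (tZ T) (m+2) ≃+ Hom (tZ P) (m+1))) ∧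
    StronglyTorsionGenerated T ∧ Subgroup.center T = ⊥ := by
  obtain ⟨W, _, c, S⟩ := exists_W P
  obtain ⟨T, _, j1, j2, A⟩ := exists_amalgam c c S.inj S.inj
  have hp : Perf W := HZ1.perf (S.acy 0)
  refine ⟨T, inferInstance, A.perf hp hp, A.susp S.inj S.acy S.acy, ?_, susp_center S A⟩
  intro n hn
  obtain ⟨w, hw⟩ := S.ord n hn
  refine ⟨j1 w, by rw [orderOf_injective j1 A.inj1, hw], ?_⟩
  have hw1 : w ≠ 1 := by
    rintro rfl
    rw [orderOf_one] at hw
    omega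
  have h1 := normal_top S.nor j1 (Subgroup.normalClosure {j1 w}) hw1
    (Subgroup.subset_normalClosure rfl)
  obtain ⟨p, hp⟩ := exists_ne (1 : P)
  have h2 := normal_top S.nor j2 (Subgroup.normalClosure {j1 w}) (w := c p)
    (fun h => hp (S.inj (by rw [h, map_one]))) (by rw [← A.comm]; exact h1 _)
  exact A.gen _ h1 h2

end RH

namespace RH

noncomputable def abF (X : Type) : FreeGroup X →* Multiplicative (X →₀ ℤ) :=
  FreeGroup.lift (fun x => Multiplicative.ofAdd (Finsupp.single x 1))

noncomputable def abf {X : Type} (w : FreeGroup X) : X →₀ ℤ := Multiplicative.toAdd (abF X w)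

theorem abf_mul {X : Type} (v w : FreeGroup X) : abf (v * w) = abf v + abf w := by
  simp [abf]

@[simp] theorem abf_of {X : Type} (x : X) : abf (FreeGroup.of x) = Finsupp.single x 1 := by
  simp [abf, abF]

theorem add_one' {G D : Type} [Group G] [AddCommGroup D] {χ : G → D}
    (h : ∀ a b, χ (a * b) = χ a + χ b) : χ 1 = 0 := by
  have := h 1 1
  rw [mul_one] at this
  exact left_eq_add.1 this

def toMul {G D : Type} [Group G] [AddCommGroup D] (χ : G → D)
    (h : ∀ a b, χ (a * b) = χ a + χ b) : G →* Multiplicative D :=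
  MonoidHom.mk' (fun g => Multiplicative.ofAdd (χ g)) (fun a b => by rw [h]; rfl)

theorem abf_surj {X : Type} (v : X →₀ ℤ) : ∃ w : FreeGroup X, abf w = v := by
  have : (abF X).range = ⊤ := by
    rw [eq_top_iff]
    intro v _
    induction v using Multiplicative.rec with
    | ofAdd v =>
      induction v using Finsupp.induction_linear with
      | zero => exact one_mem _
      | add v w hv hw => exact mul_mem (hv trivial) (hw trivial)
      | single y m =>
        refine ⟨(FreeGroup.of y) ^ m, ?_⟩
        rw [map_zpow, abF, FreeGroup.lift_apply_of, ← ofAdd_zsmul]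
        simp
  have h2 : Multiplicative.ofAdd v ∈ (abF X).range := by rw [this]; trivial
  obtain ⟨w, hw⟩ := h2
  exact ⟨w, by rw [abf, hw]; rfl⟩

theorem abf_char {X D : Type} [AddCommGroup D] (χ : FreeGroup X → D)
    (h : ∀ a b, χ (a * b) = χ a + χ b) : ∃ L : (X →₀ ℤ) →+ D, ∀ w, χ w = L (abf w) := by
  let L : (X →₀ ℤ) →+ D := Finsupp.liftAddHom (fun x => zmultiplesHom D (χ (FreeGroup.of x)))
  refine ⟨L, fun w => ?_⟩
  have : toMul χ h = (AddMonoidHom.toMultiplicative L).comp (abF X) := by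
    apply FreeGroup.ext_hom
    intro x
    change Multiplicative.ofAdd (χ (FreeGroup.of x)) = Multiplicative.ofAdd (L (abf (FreeGroup.of x)))
    rw [abf_of]
    simp [L]
  exact congrArg Multiplicative.toAdd (DFunLike.congr_fun this w)

theorem ev_comp {G D D' : Type} [Group G] [AddCommGroup D] [AddCommGroup D'] (L : D →+ D') (χ : G → D)
    (z : Ch G ℤ 1) : ev (fun g => L (χ g)) z = L (ev χ z) := by
  induction z using Finsupp.induction_linear with
  | zero => simp
  | add v w hv hw => simp only [map_add, hv, hw]
  | single y m => simp

theorem ev_add {G D : Type} [Group G] [AddCommGroup D] (χ χ' : G → D)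
    (z : Ch G ℤ 1) : ev (fun g => χ g + χ' g) z = ev χ z + ev χ' z := by
  induction z using Finsupp.induction_linear with
  | zero => simp
  | add v w hv hw => simp only [map_add, hv, hw]; abel
  | single y m => simp

theorem exists_P (A C : Type) [AddCommGroup A] [AddCommGroup C] :
    ∃ (P : Type) (_ : Group P), Nontrivial P ∧ Nonempty (Hom (tZ P) 1 ≃+ C) ∧
      Nonempty (Hom (tZ P) 2 ≃+ A) := by
  let π : (C →₀ ℤ) →+ C := Finsupp.liftAddHom (fun c => zmultiplesHom C c)
  have hπ : ∀ c, π (Finsupp.single c 1) = c := fun c => by simp [π]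
  obtain ⟨Y, T, hT, hTr⟩ := free_sub C π.ker
  choose u hu using fun y => abf_surj (T (Finsupp.single y 1))
  let φ : FreeGroup Y →* FreeGroup C := FreeGroup.lift u
  have hφ : ∀ w, abf (φ w) = T (abf w) := by
    intro w
    have : (abF C).comp φ = (AddMonoidHom.toMultiplicative T).comp (abF Y) := by
      apply FreeGroup.ext_hom
      intro y
      change Multiplicative.ofAdd (abf (φ (FreeGroup.of y))) =
        Multiplicative.ofAdd (T (abf (FreeGroup.of y)))
      rw [abf_of, ← hu]
      simp [φ]
    exact congrArg Multiplicative.toAdd (DFunLike.congr_fun this w)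
  obtain ⟨W, _, ι, S⟩ := exists_W (Multiplicative A × FreeGroup Y)
  have hp : Perf W := HZ1.perf (S.acy 0)
  let f1 : Multiplicative A × FreeGroup Y →* W × FreeGroup C :=
    ι.prod (φ.comp (MonoidHom.snd _ _))
  have hf1 : Function.Injective f1 := fun a b h => S.inj (congrArg Prod.fst h)
  obtain ⟨P, _, j1, j2, Am⟩ := exists_amalgam f1 ι hf1 S.inj
  have hWF : ∀ (D : Type) [AddCommGroup D] (χ : W × FreeGroup C → D),
      (∀ a b, χ (a * b) = χ a + χ b) → ∃ L : (C →₀ ℤ) →+ D, ∀ p, χ p = L (abf p.2) := by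
    intro D _ χ h
    obtain ⟨L, hL⟩ := abf_char (fun w => χ (1, w)) (fun a b => by rw [← h]; simp)
    refine ⟨L, fun p => ?_⟩
    rw [← hL]
    have h1 := hp D _ (fun w => χ (w, 1)) (fun a b => by rw [← h]; simp) p.1
    have h2 := h (p.1, 1) (1, p.2)
    simp only [Prod.mk_mul_mk, mul_one, one_mul] at h2
    rw [h2, h1, zero_add]
  refine ⟨P, inferInstance, ?_, ?_, ?_⟩
  · have := S.inf
    have : Infinite P := Infinite.of_injective j2 Am.inj2
    infer_instance
  · obtain ⟨c0, hc1, hc2⟩ := Am.lift (Multiplicative C)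
      (((AddMonoidHom.toMultiplicative π).comp (abF C)).comp (MonoidHom.snd _ _)) 1 (by
        intro h
        change Multiplicative.ofAdd (π (abf (φ h.2))) = 1
        have : T (abf h.2) ∈ π.ker := hTr ▸ ⟨_, rfl⟩
        rw [hφ, (AddMonoidHom.mem_ker).1 this]
        rfl)
    let χ0 : P → C := fun p => Multiplicative.toAdd (c0 p)
    have hχ0 : ∀ a b, χ0 (a * b) = χ0 a + χ0 b := fun a b => by simp [χ0]
    have hχ1 : ∀ p, χ0 (j1 p) = π (abf p.2) := fun p => congrArg Multiplicative.toAdd (hc1 p)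
    have hχ2 : ∀ p, χ0 (j2 p) = 0 := fun p => congrArg Multiplicative.toAdd (hc2 p)
    refine rel_iso (Zn (tZ P) 1) (Bn (tZ P) 1) (fun z q => ev χ0 z = q) ?_ (fun z _ => ⟨_, rfl⟩) ?_ ?_
    · rintro z z' q q' rfl rfl
      rw [map_sub]
    · intro q
      refine ⟨Finsupp.single ![j1 (1, FreeGroup.of q)] 1, Z1_all _, ?_⟩
      rw [ev_single, one_zsmul]
      change χ0 (j1 (1, FreeGroup.of q)) = q
      rw [hχ1, abf_of, hπ]
    · rintro z - q rfl
      rw [B1_iff]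
      refine ⟨fun h => h C _ χ0 hχ0, fun h0 D _ χ hχ => ?_⟩
      obtain ⟨M, hM⟩ := hWF D (fun p => χ (j1 p)) (fun a b => by rw [map_mul, hχ])
      have h2 : ∀ w, χ (j2 w) = 0 := hp D _ (fun p => χ (j2 p)) (fun a b => by rw [map_mul, hχ])
      have hMT : ∀ v, M (T v) = 0 := by
        intro v
        obtain ⟨w, rfl⟩ := abf_surj v
        rw [← hφ, ← hM (ι (1, w), φ w)]
        change χ (j1 (f1 (1, w))) = 0
        rw [Am.comm, h2]
      have hMK : ∀ v v', π v = π v' → M v = M v' := by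
        intro v v' h
        have : v - v' ∈ T.range := by
          rw [hTr, AddMonoidHom.mem_ker, map_sub, h, sub_self]
        obtain ⟨x, hx⟩ := this
        rw [← sub_eq_zero, ← map_sub, ← hx, hMT]
      let L : C →+ D := AddMonoidHom.mk' (fun c => M (Finsupp.single c 1)) (by
        intro a b
        rw [← map_add]
        apply hMK
        rw [map_add, hπ, hπ, hπ])
      have hL : ∀ v, L (π v) = M v := fun v => hMK _ _ (hπ _)
      have hall : χ = fun p => L (χ0 p) := by
        have hadd : ∀ a b, χ (a * b) - L (χ0 (a * b)) = (χ a - L (χ0 a)) + (χ b - L (χ0 b)) := by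
          intro a b
          rw [hχ, hχ0, map_add]
          abel
        have : (toMul (fun p => χ p - L (χ0 p)) hadd).ker = ⊤ := by
          refine Am.gen _ (fun x => ?_) (fun x => ?_)
          · rw [MonoidHom.mem_ker]
            change Multiplicative.ofAdd (χ (j1 x) - L (χ0 (j1 x))) = 1
            rw [hχ1, hL, hM x, sub_self]
            rfl
          · rw [MonoidHom.mem_ker]
            change Multiplicative.ofAdd (χ (j2 x) - L (χ0 (j2 x))) = 1
            rw [hχ2, h2, map_zero, sub_self]
            rfl
        funext p
        have hpk : p ∈ (toMul (fun p => χ p - L (χ0 p)) hadd).ker := by rw [this]; trivial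
        rw [MonoidHom.mem_ker] at hpk
        exact sub_eq_zero.1 (congrArg Multiplicative.toAdd hpk)
      rw [hall, ev_comp, h0, map_zero]
  · have hfst : ∀ a b : Multiplicative A × FreeGroup Y, Multiplicative.toAdd (a * b).1 =
        Multiplicative.toAdd a.1 + Multiplicative.toAdd b.1 := fun a b => rfl
    refine Am.mv hf1 (m := 1) ?_ (S.acy 1)
      ((ev (fun p : Multiplicative A × FreeGroup Y => Multiplicative.toAdd p.1)).comp
        (Zn (tZ (Multiplicative A × FreeGroup Y)) 1).subtype) ?_ ?_
    · intro z hz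
      exact kunneth_B S.acy hz (HZ_free C _ (tm_Z _ hz))
    · intro a
      refine ⟨⟨Finsupp.single ![(Multiplicative.ofAdd a, 1)] 1, Z1_all _⟩, ?_, ?_, ?_⟩
      · rw [B1_iff]
        intro D _ χ hχ
        obtain ⟨L, hL⟩ := hWF D χ hχ
        rw [ev_tm, ev_single, hL, one_zsmul]
        change L (abf (φ 1)) = 0
        rw [map_one]
        simp [abf]
      · exact S.acy 0 _ (Z1_all _)
      · change ev (fun p : Multiplicative A × FreeGroup Y => Multiplicative.toAdd p.1)
          (Finsupp.single ![(Multiplicative.ofAdd a, 1)] 1) = a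
        rw [ev_single, one_zsmul]
        rfl
    · rintro ⟨x, hx⟩ h1 -
      change ev (fun p : Multiplicative A × FreeGroup Y => Multiplicative.toAdd p.1) x = 0 ↔
        x ∈ Bn (tZ (Multiplicative A × FreeGroup Y)) 1
      refine ⟨fun h => ?_, fun h => (B1_iff _).1 h A _ _ hfst⟩
      have hY : ev (fun p : Multiplicative A × FreeGroup Y => abf p.2) x = 0 := by
        apply hT
        rw [map_zero, ← ev_comp]
        have h3 := (B1_iff _).1 h1 (C →₀ ℤ) _ (fun p => abf p.2) (fun a b => abf_mul _ _)
        rw [ev_tm] at h3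
        rw [← h3]
        congr 2
        funext p
        exact (hφ _).symm
      rw [B1_iff]
      intro D _ χ hχ
      obtain ⟨L, hL⟩ := abf_char (fun w => χ (1, w)) (fun a b => by rw [← hχ]; simp)
      let K : A →+ D := AddMonoidHom.mk' (fun a => χ (Multiplicative.ofAdd a, 1))
        (fun a b => by rw [← hχ]; simp)
      have : χ = fun p => K (Multiplicative.toAdd p.1) + L (abf p.2) := by
        funext p
        rw [← hL]
        change χ p = χ (p.1, 1) + χ (1, p.2)
        rw [← hχ]
        simp
      rw [this, ev_add, ev_comp K, ev_comp L, h, hY, map_zero, map_zero, add_zero]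

end RH

namespace RH

theorem hom_prod {E P : Type} [Group E] [Group P] (hE : ∀ n, HZ (tZ E) (n+1)) (n : ℕ) :
    Nonempty (Hom (tZ (E × P)) (n+1) ≃+ Hom (tZ P) (n+1)) := by
  refine rel_iso (Zn (tZ (E × P)) (n+1)) (Bn (tZ (E × P)) (n+1))
    (fun z (q : Hom (tZ P) (n+1)) => ∃ h : tm (MonoidHom.snd E P) (n+1) z ∈ Zn (tZ P) (n+1),
      QuotientAddGroup.mk' _ ⟨_, h⟩ = q) ?_ (fun z hz => ⟨_, tm_Z _ hz, rfl⟩) ?_ ?_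
  · rintro z z' _ _ ⟨h, rfl⟩ ⟨h', rfl⟩
    refine ⟨by rw [map_sub]; exact sub_mem h h', ?_⟩
    refine Eq.trans ?_ (map_sub (QuotientAddGroup.mk' _) _ _)
    congr 1
    apply Subtype.ext
    exact map_sub _ _ _
  · intro q
    obtain ⟨⟨x, hx⟩, rfl⟩ := QuotientAddGroup.mk'_surjective _ q
    have h1 : tm (MonoidHom.snd E P) (n+1) (tm (MonoidHom.inr E P) (n+1) x) = x := by
      rw [tm_tm]
      exact tm_id _ _
    refine ⟨tm (MonoidHom.inr E P) (n+1) x, tm_Z _ hx, by rw [h1]; exact hx, ?_⟩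
    congr 1
    exact Subtype.ext h1
  · rintro z hz _ ⟨h, rfl⟩
    rw [QuotientAddGroup.mk'_apply, QuotientAddGroup.eq_zero_iff, AddSubgroup.mem_addSubgroupOf]
    exact ⟨fun h => tm_B _ h, fun h => kunneth_B hE hz h⟩

theorem HZ_of_hom {G : Type} [Group G] {n : ℕ} (h : Subsingleton (Hom (tZ G) n)) : HZ (tZ G) n := by
  intro z hz
  have h1 : (QuotientAddGroup.mk' ((Bn (tZ G) n).addSubgroupOf (Zn (tZ G) n))) ⟨z, hz⟩ = 0 :=
    h.elim _ _
  rwa [QuotientAddGroup.mk'_apply, QuotientAddGroup.eq_zero_iff, AddSubgroup.mem_addSubgroupOf] at h1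

theorem hom_of_HZ {G : Type} [Group G] {n : ℕ} (h : HZ (tZ G) n) : Subsingleton (Hom (tZ G) n) := by
  refine ⟨fun a b => ?_⟩
  have : ∀ q : Hom (tZ G) n, q = 0 := by
    intro q
    obtain ⟨⟨x, hx⟩, rfl⟩ := QuotientAddGroup.mk'_surjective _ q
    rw [QuotientAddGroup.mk'_apply, QuotientAddGroup.eq_zero_iff, AddSubgroup.mem_addSubgroupOf]
    exact h x hx
  rw [this a, this b]

theorem exists_noncentral {E : Type} [Group E] (hp : Perf E) {e : E} (he : e ∉ Subgroup.center E) :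
    ∃ x, e * x * e⁻¹ * x⁻¹ ∉ Subgroup.center E := by
  by_contra hcon
  push Not at hcon
  apply he
  rw [Subgroup.mem_center_iff]
  intro x
  let _ : CommGroup (Subgroup.center E) := { (inferInstance : Group (Subgroup.center E)) with
    mul_comm := fun a b => Subtype.ext (Subgroup.mem_center_iff.1 b.2 a) }
  have h := hp (Additive (Subgroup.center E)) inferInstance
    (fun x => Additive.ofMul ⟨e * x * e⁻¹ * x⁻¹, hcon x⟩) (by
      intro a b
      rw [← ofMul_mul]
      congr 1
      apply Subtype.ext
      change e * (a * b) * e⁻¹ * (a * b)⁻¹ = (e * a * e⁻¹ * a⁻¹) * (e * b * e⁻¹ * b⁻¹)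
      have h1 := Subgroup.mem_center_iff.1 (hcon b) a⁻¹
      rw [mul_assoc (e * a * e⁻¹) a⁻¹, h1]
      group) x
  have h2 : e * x * e⁻¹ * x⁻¹ = 1 := congrArg Subtype.val (congrArg Additive.toMul h)
  rw [mul_inv_eq_one, mul_inv_eq_iff_eq_mul] at h2
  exact h2.symm

theorem exists_S (A C : Type) [AddCommGroup A] [AddCommGroup C] :
    ∃ (S : Type) (_ : Group S), StronglyTorsionGenerated S ∧
      Nonempty (Subgroup.center S ≃* Multiplicative A) ∧
      Subsingleton (Hom (tZ S) 1) ∧ Subsingleton (Hom (tZ S) 2) ∧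
      Nonempty (Hom (tZ S) 3 ≃+ C) ∧ Nonempty (Hom (tZ S) 4 ≃+ A) := by
  obtain ⟨P, _, hP, ⟨e1⟩, ⟨e2⟩⟩ := exists_P A C
  obtain ⟨R, _, hRp, hR, hRs, -⟩ := exists_susp P
  have hRn : Nontrivial R := by
    obtain ⟨g, hg, -⟩ := hRs 2 le_rfl
    refine ⟨g, 1, ?_⟩
    rintro rfl
    rw [orderOf_one] at hg
    omega
  obtain ⟨T, _, hTp, hT, hTs, hTc⟩ := exists_susp R
  obtain ⟨E, _, c, hc, hacy, hcen, hnor⟩ := exists_E (Multiplicative A) Unit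
  have hEp : Perf E := HZ1.perf (hacy 0)
  have hS := fun n => hom_prod (P := T) hacy n
  refine ⟨E × T, inferInstance, ?_, ?_, ?_, ?_, ?_, ?_⟩
  · intro n hn
    obtain ⟨t, ht, htn⟩ := hTs n hn
    obtain ⟨q, hq⟩ := Qg_order n
    have hinj : Function.Injective (c.comp ((MonoidHom.inr _ _).comp (MonoidHom.inr _ _))) := by
      intro a b h
      have := hc h
      simpa using this
    have hordE : orderOf (c (1, 1, q)) = n := by
      rw [← hq]
      exact orderOf_injective _ hinj q
    have hncen : c (1, 1, q) ∉ Subgroup.center E := by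
      rw [hcen]
      rintro ⟨a, ha⟩
      have h1 := congrArg (fun x => x.2.2) (hc ha)
      change 1 = q at h1
      rw [← h1, orderOf_one] at hq
      omega
    refine ⟨(c (1, 1, q), t), ?_, ?_⟩
    · rw [Prod.orderOf_mk, hordE, ht, Nat.lcm_self]
    · set e := c (1, 1, q)
      set N := Subgroup.normalClosure {(e, t)} with hN
      have hmem : (e, t) ∈ N := Subgroup.subset_normalClosure rfl
      obtain ⟨x, hx⟩ := exists_noncentral hEp hncen
      have hx1 : (e * x * e⁻¹ * x⁻¹, (1 : T)) ∈ N := by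
        have h1 : (x, (1 : T)) * (e, t)⁻¹ * (x, (1 : T))⁻¹ ∈ N :=
          Subgroup.normalClosure_normal.conj_mem _ (inv_mem hmem) _
        have h2 := mul_mem hmem h1
        convert h2 using 1
        ext
        · simp only [Prod.mk_mul_mk, Prod.inv_mk]; group
        · simp only [Prod.mk_mul_mk, Prod.inv_mk]; group
      have hE1 : ∀ y : E, (y, (1 : T)) ∈ N := by
        have h1 : Subgroup.normalClosure {e * x * e⁻¹ * x⁻¹} ≤ N.comap (MonoidHom.inl E T) := by
          apply Subgroup.normalClosure_le_normal
          rintro _ rfl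
          exact hx1
        rw [hnor _ hx] at h1
        exact fun y => h1 (show y ∈ ⊤ from trivial)
      have hT1 : ∀ y : T, ((1 : E), y) ∈ N := by
        have h1 : Subgroup.normalClosure {t} ≤ N.comap (MonoidHom.inr E T) := by
          apply Subgroup.normalClosure_le_normal
          rintro _ rfl
          have := mul_mem (hE1 e⁻¹) hmem
          simpa using this
        rw [htn] at h1
        exact fun y => h1 (show y ∈ ⊤ from trivial)
      rw [eq_top_iff]
      rintro ⟨y, z⟩ -
      have := mul_mem (hE1 y) (hT1 z)
      simpa using this
  · have hmem : ∀ a, (c (a, 1), (1 : T)) ∈ Subgroup.center (E × T) := by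
      intro a
      rw [Subgroup.mem_center_iff]
      rintro ⟨y, z⟩
      have h1 := (hcen _).2 ⟨a, rfl⟩
      rw [Subgroup.mem_center_iff] at h1
      simp [h1 y]
    let f : Multiplicative A →* Subgroup.center (E × T) := MonoidHom.mk'
      (fun a => ⟨(c (a, 1), 1), hmem a⟩) (by
        intro a b
        apply Subtype.ext
        change (c (a * b, 1), (1 : T)) = (c (a, 1), 1) * (c (b, 1), 1)
        rw [Prod.mk_mul_mk, ← map_mul]
        simp)
    have hf : Function.Bijective f := by
      constructor
      · intro a b h
        have h1 : c (a, 1) = c (b, 1) := congrArg (fun x => x.1.1) h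
        exact congrArg Prod.fst (hc h1)
      · rintro ⟨⟨y, z⟩, h⟩
        rw [Subgroup.mem_center_iff] at h
        have hy : y ∈ Subgroup.center E := by
          rw [Subgroup.mem_center_iff]
          intro g
          exact congrArg Prod.fst (h (g, 1))
        have hz : z ∈ Subgroup.center T := by
          rw [Subgroup.mem_center_iff]
          intro g
          exact congrArg Prod.snd (h (1, g))
        rw [hTc, Subgroup.mem_bot] at hz
        obtain ⟨a, rfl⟩ := (hcen _).1 hy
        subst hz
        exact ⟨a, rfl⟩
    exact ⟨(MulEquiv.ofBijective f hf).symm⟩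
  · have := hom_of_HZ hTp.HZ1
    obtain ⟨e⟩ := hS 0
    exact e.toEquiv.subsingleton
  · have := hom_of_HZ hRp.HZ1
    obtain ⟨e⟩ := hS 1
    obtain ⟨e'⟩ := hT 0
    exact (e.trans e').toEquiv.subsingleton
  · obtain ⟨a⟩ := hS 2
    obtain ⟨b⟩ := hT 1
    obtain ⟨d⟩ := hR 0
    exact ⟨((a.trans b).trans d).trans e1⟩
  · obtain ⟨a⟩ := hS 3
    obtain ⟨b⟩ := hT 2
    obtain ⟨d⟩ := hR 1
    exact ⟨((a.trans b).trans d).trans e2⟩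

end RH

namespace RH

section nerve
variable {G : Type} [Group G]

/-- inverse transition elements of a simplex of the nerve -/
def trn {n : ℕ} (F : ComposableArrows (SingleObj G) n) (i j : Fin (n+1)) (h : i ≤ j) : G :=
  ((show G from F.map (homOfLE h)) : G)⁻¹

theorem trn_self {n : ℕ} (F : ComposableArrows (SingleObj G) n) (i : Fin (n+1)) :
    trn F i i le_rfl = 1 := by
  rw [trn, inv_eq_one]
  exact F.map_id i

theorem trn_mul {n : ℕ} (F : ComposableArrows (SingleObj G) n) (i j k : Fin (n+1)) (h : i ≤ j)
    (h' : j ≤ k) : trn F i k (h.trans h') = trn F i j h * trn F j k h' := by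
  have h1 := F.map_comp (homOfLE h) (homOfLE h')
  change (show G from F.map (homOfLE (h.trans h'))) =
    (show G from F.map (homOfLE h')) * (show G from F.map (homOfLE h)) at h1
  rw [trn, h1, mul_inv_rev]
  rfl

def code {n : ℕ} (F : ComposableArrows (SingleObj G) n) : Fin n → G :=
  fun i => trn F i.castSucc i.succ (Fin.castSucc_le_succ i)

theorem trn_zero {n : ℕ} (F : ComposableArrows (SingleObj G) n) (j : Fin (n+1)) :
    trn F 0 j (Fin.zero_le _) = Fin.partialProd (code F) j := by
  induction j using Fin.induction with
  | zero => rw [Fin.partialProd_zero, trn_self]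
  | succ j ih =>
    rw [Fin.partialProd_succ, ← ih]
    exact trn_mul _ _ _ _ _ _

theorem trn_eq {n : ℕ} (F : ComposableArrows (SingleObj G) n) (i j : Fin (n+1)) (h : i ≤ j) :
    trn F i j h = (Fin.partialProd (code F) i)⁻¹ * Fin.partialProd (code F) j := by
  rw [← trn_zero, ← trn_zero, trn_mul F 0 i j (Fin.zero_le _) h, inv_mul_cancel_left]

theorem code_inj {n : ℕ} : Function.Injective (code (G := G) (n := n)) := by
  intro F F' h
  refine CategoryTheory.Functor.ext (fun _ => Subsingleton.elim _ _) ?_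
  intro i j f
  have h1 : trn F i j (leOfHom f) = trn F' i j (leOfHom f) := by rw [trn_eq, trn_eq, h]
  have h2 := inv_injective h1
  have h3 : f = homOfLE (leOfHom f) := Subsingleton.elim _ _
  rw [h3]
  refine h2.trans ?_
  exact ((Category.id_comp _).trans (Category.comp_id (F'.map (homOfLE (leOfHom f))))).symm

def decode {n : ℕ} (g : Fin n → G) : ComposableArrows (SingleObj G) n where
  obj _ := SingleObj.star G
  map {i j} _ := ((Fin.partialProd g j)⁻¹ * Fin.partialProd g i : G)
  map_id i := inv_mul_cancel (Fin.partialProd g i)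
  map_comp {i j k} _ _ := by
    change (Fin.partialProd g k)⁻¹ * Fin.partialProd g i =
      ((Fin.partialProd g k)⁻¹ * Fin.partialProd g j) * ((Fin.partialProd g j)⁻¹ * Fin.partialProd g i)
    group

theorem code_decode {n : ℕ} (g : Fin n → G) : code (decode g) = g := by
  funext i
  change ((Fin.partialProd g i.succ)⁻¹ * Fin.partialProd g i.castSucc)⁻¹ = g i
  rw [mul_inv_rev, inv_inv, Fin.partialProd_right_inv]

/-- faces -/
def dl {n : ℕ} (i : Fin (n+2)) (F : ComposableArrows (SingleObj G) (n+1)) :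
    ComposableArrows (SingleObj G) n := (nerve (SingleObj G)).δ i F

theorem code_delta_zero {n : ℕ} (F : ComposableArrows (SingleObj G) (n+1)) :
    code (dl 0 F) = fun i => code F i.succ := by
  funext i
  rfl

theorem code_delta_succ {n : ℕ} (F : ComposableArrows (SingleObj G) (n+1)) (j : Fin (n+1)) :
    code (dl j.succ F) = Fin.contractNth j (· * ·) (code F) := by
  funext k
  rw [← Fin.partialProd_right_inv (Fin.contractNth j (· * ·) (code F)) k, Fin.partialProd_contractNth]
  exact trn_eq F _ _ ((Fin.strictMono_succAbove j.succ).monotone (Fin.castSucc_le_succ k))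

noncomputable def codeE (n : ℕ) : ComposableArrows (SingleObj G) n ≃ (Fin n → G) :=
  Equiv.ofBijective code ⟨code_inj, fun g => ⟨decode g, code_decode g⟩⟩

noncomputable def th (n : ℕ) : (ComposableArrows (SingleObj G) n →₀ ℤ) ≃+ Ch G ℤ n :=
  Finsupp.domCongr (codeE n)

theorem th_single (n : ℕ) (F : ComposableArrows (SingleObj G) n) (m : ℤ) :
    th n (Finsupp.single F m) = Finsupp.single (code F) m := by
  simp only [th, Finsupp.domCongr_apply, Finsupp.equivMapDomain_single]
  rfl

variable (G)

/-- the differential of the frozen complex -/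
noncomputable def bd (n : ℕ) :
    (ComposableArrows (SingleObj G) (n+1) →₀ ℤ) →ₗ[ℤ] (ComposableArrows (SingleObj G) n →₀ ℤ) :=
  ((classifyingComplex G).d (n+1) n).hom

theorem sum_hom_apply {ι : Type} [Fintype ι] {X Y : ModuleCat.{0} ℤ} (c : ι → ℤ) (f : ι → (X ⟶ Y)) (x : X) :
    (∑ i, c i • f i).hom x = ∑ i, c i • (f i).hom x := by
  rw [ModuleCat.hom_sum, LinearMap.sum_apply]
  rfl

theorem bd_single (n : ℕ) (F : ComposableArrows (SingleObj G) (n+1)) (m : ℤ) :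
    bd G n (Finsupp.single F m) = ∑ i : Fin (n+2), (-1:ℤ)^(i:ℕ) • Finsupp.single (dl i F) m := by
  have key : (classifyingComplex G).d (n+1) n = AlternatingFaceMapComplex.objD
    (((SimplicialObject.whiskering (Type) (ModuleCat ℤ)).obj (ModuleCat.free ℤ)).obj
      (nerve (SingleObj G))) n := alternatingFaceMapComplex_obj_d _ n
  have h1 := congrArg (fun φ => φ.hom (Finsupp.single F m)) key
  refine h1.trans ((sum_hom_apply (fun i : Fin (n+2) => (-1:ℤ)^(i:ℕ)) _ _).trans ?_)
  refine Finset.sum_congr rfl fun i _ => ?_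
  exact congrArg (fun w => (-1:ℤ)^(i:ℕ) • w) (Finsupp.mapDomain_single (f := dl i) (a := F) (b := m))

theorem th_bd (n : ℕ) (z) : th n (bd G n z) = dd (tZ G) n (th (n+1) z) := by
  induction z using Finsupp.induction_linear with
  | zero => simp
  | add x y hx hy => simp only [map_add, hx, hy]
  | single F m =>
    rw [bd_single, th_single, dd_single, map_sum, Fin.sum_univ_succ]
    congr 1
    · rw [map_zsmul, th_single, code_delta_zero]
      simp [tZ]
    · refine Finset.sum_congr rfl fun j _ => ?_
      rw [map_zsmul, th_single, code_delta_succ, Finsupp.smul_single, Fin.val_succ]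

theorem hom_equiv (n : ℕ) : Nonempty (Hom (tZ G) (n+1) ≃+ grpHomology G (n+1)) := by
  let K := classifyingComplex G
  let S := K.sc' (n+2) (n+1) n
  let e1 : K.homology (n+1) ≅ S.homology :=
    K.homologyIsoSc' (n+2) (n+1) n (by simp) (by simp)
  let e2 : S.homology ≅ S.moduleCatLeftHomologyData.H := S.moduleCatHomologyIso
  let e3 : S.moduleCatLeftHomologyData.H ≃+ grpHomology G (n+1) :=
    (e1 ≪≫ e2).symm.toLinearEquiv.toAddEquiv
  suffices h : Nonempty (Hom (tZ G) (n+1) ≃+ S.moduleCatLeftHomologyData.H) by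
    obtain ⟨e⟩ := h
    exact ⟨e.trans e3⟩
  let S' : Type := LinearMap.ker S.g.hom ⧸ LinearMap.range S.moduleCatToCycles
  let mkq : LinearMap.ker S.g.hom → S' := (LinearMap.range S.moduleCatToCycles).mkQ
  have hker : ∀ x : ComposableArrows (SingleObj G) (n+1) →₀ ℤ,
      x ∈ LinearMap.ker S.g.hom ↔ bd G n x = 0 := fun x => Iff.rfl
  suffices h : Nonempty (Hom (tZ G) (n+1) ≃+ S') from h
  refine rel_iso (Zn (tZ G) (n+1)) (Bn (tZ G) (n+1))
    (fun z (q : S') => ∃ x : LinearMap.ker S.g.hom, th (n+1) x.1 = z ∧ mkq x = q) ?_ ?_ ?_ ?_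
  · rintro _ _ _ _ ⟨x, rfl, rfl⟩ ⟨y, rfl, rfl⟩
    exact ⟨x - y, map_sub (th (n+1)) x.1 y.1, map_sub (LinearMap.range S.moduleCatToCycles).mkQ x y⟩
  · intro z hz
    obtain ⟨x, rfl⟩ := (th (n+1)).surjective z
    rw [mem_Zn_succ, ← th_bd] at hz
    have hx := (th n).injective (hz.trans (map_zero _).symm)
    exact ⟨_, ⟨x, (hker x).2 hx⟩, rfl, rfl⟩
  · intro q
    obtain ⟨x, rfl⟩ := Submodule.mkQ_surjective _ q
    refine ⟨th (n+1) x.1, ?_, x, rfl, rfl⟩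
    rw [mem_Zn_succ]
    refine (th_bd G n x.1).symm.trans ?_
    exact (congrArg (th n) ((hker x.1).1 x.2)).trans (map_zero _)
  · rintro _ - _ ⟨x, rfl, rfl⟩
    have h0 : mkq x = 0 ↔ ∃ y, S.moduleCatToCycles y = x := by
      refine (Submodule.Quotient.mk_eq_zero _).trans ?_
      exact LinearMap.mem_range
    rw [h0]
    constructor
    · rintro ⟨w, hw⟩
      obtain ⟨y, rfl⟩ := (th (n+2)).surjective w
      rw [← th_bd] at hw
      exact ⟨y, Subtype.ext ((th (n+1)).injective hw)⟩
    · rintro ⟨y, rfl⟩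
      exact ⟨th (n+2) y, (th_bd G (n+1) y).symm⟩

end nerve
end RH

theorem realization_with_H4
    (A C : Type) [AddCommGroup A] [AddCommGroup C] :
    ∃ (S : Type) (_ : Group S),
      StronglyTorsionGenerated S ∧
      Nonempty (Subgroup.center S ≃* Multiplicative A) ∧
      Subsingleton (grpHomology S 1) ∧
      Subsingleton (grpHomology S 2) ∧
      Nonempty (grpHomology S 3 ≃+ C) ∧
      Nonempty (grpHomology S 4 ≃+ A) := by
  obtain ⟨S, hS, h1, h2, h3, h4, ⟨e5⟩, ⟨e6⟩⟩ := RH.exists_S A C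
  obtain ⟨a1⟩ := RH.hom_equiv S 0
  obtain ⟨a2⟩ := RH.hom_equiv S 1
  obtain ⟨a3⟩ := RH.hom_equiv S 2
  obtain ⟨a4⟩ := RH.hom_equiv S 3
  exact ⟨S, hS, h1, h2, a1.symm.toEquiv.subsingleton, a2.symm.toEquiv.subsingleton,
    ⟨a3.symm.trans e5⟩, ⟨a4.symm.trans e6⟩⟩
end
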